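/- (Lemma 1) Assume 𝔓≠{{1,…,d}} and Assumptions (N1)-(N2) hold, let p∈(1,+∞], and set r_k := kp for p<∞ and r_k := k for p=∞ (k=1,2,4). Define ξ_p := sup_{I∈I_d^⋄} sup_{h_I∈H_{p,I}} [ ‖ξ_{h_I}‖_p − γ_p·U_p(h_I) ]_+ and f̄_p := 𝔡²‖K‖_1^d (Ḡ_p)^{𝔡(𝔡−1)} (max{Ḡ_p, ‖K‖_1^d·f_p})^{𝔡−1}. Then for r∈{r_1,r_2,r_4} there exist constants c_{p,1}(r)>0 and c_{p,2}(r,f_p)>0, with f_p ↦ c_{p,2}(r,f_p) bounded on any bounded interval of ℝ_+, such that for every integer n ≥ 3 and every f∈F_p[𝔓]: (E_f|ξ_p|^r)^{1/r} ≤ c_{p,1}(r)·n^{-1/2} and (E_f|f̄_p|^r)^{1/r} ≤ c_{p,2}(r,f_p). -/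

import Mathlib

open MeasureTheory ENNReal Filter Finset
open scoped ENNReal Topology

noncomputable section

namespace Deconv

/-- Euclidean inner product on a finite coordinate space. -/
def dotp {ι : Type} [Fintype ι] (t x : ι → ℝ) : ℝ := ∑ j, t j * x j

/-- Fourier transform `ĝ(t) = ∫ e^{i⟨t,x⟩} g(x) dx` of a real function. -/
def ftI {ι : Type} [Fintype ι] (g : (ι → ℝ) → ℝ) (t : ι → ℝ) : ℂ :=
  ∫ x : ι → ℝ, Complex.exp (Complex.I * (dotp t x : ℝ)) * (g x : ℂ)

/-- Glue coordinates indexed by `I` with coordinates indexed by `Iᶜ`. -/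
def glue {d : ℕ} (I : Finset (Fin d)) (xI : I → ℝ) (y : ↥(Iᶜ) → ℝ) : Fin d → ℝ :=
  fun i => if h : i ∈ I then xI ⟨i, h⟩ else y ⟨i, Finset.mem_compl.mpr h⟩

/-- Marginal density on the coordinates indexed by `I`. -/
def marginal {d : ℕ} (I : Finset (Fin d)) (g : (Fin d → ℝ) → ℝ) (xI : I → ℝ) : ℝ :=
  ∫ y : ↥(Iᶜ) → ℝ, g (glue I xI y)

/-- A probability density. -/
def IsDensity {ι : Type} [Fintype ι] (g : (ι → ℝ) → ℝ) : Prop :=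
  (∀ x, 0 ≤ g x) ∧ (∫ x, g x) = 1

/-- Product kernel `K_I`. -/
def KI {d : ℕ} (I : Finset (Fin d)) (K : ℝ → ℝ) (xI : I → ℝ) : ℝ := ∏ j : I, K (xI j)

/-- Rescaled product kernel `K_{h_I}`. -/
def Kh {d : ℕ} (I : Finset (Fin d)) (K : ℝ → ℝ) (h : Fin d → ℝ) (xI : I → ℝ) : ℝ :=
  (∏ j ∈ I, h j)⁻¹ * ∏ j : I, K (xI j / h ↑j)

/-- The deconvolution kernel `L_{(h_I)}`. -/
def Lh {d : ℕ} (I : Finset (Fin d)) (K : ℝ → ℝ) (q : (Fin d → ℝ) → ℝ) (h : Fin d → ℝ)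
    (xI : I → ℝ) : ℂ :=
  (((2 * Real.pi) ^ (-(I.card : ℝ)) : ℝ) : ℂ) *
    ∫ t : I → ℝ, Complex.exp (-(Complex.I * (dotp t xI : ℝ))) *
      (ftI (Kh I K h) t / ftI (marginal I q) t)

/-- Convolution of two densities on `ℝ^d`. -/
def conv {d : ℕ} (f g : (Fin d → ℝ) → ℝ) (x : Fin d → ℝ) : ℝ := ∫ y, f (x - y) * g y

/-- Law of the observation vector `Y^{(n)} = (Y_1,…,Y_n)`, `Y_k = X_k + ε_k`:
the `n`-fold product of the measure with density `f ⋆ q`. -/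
def obsMeasure (d n : ℕ) (f q : (Fin d → ℝ) → ℝ) : Measure (Fin n → Fin d → ℝ) :=
  Measure.pi fun _ => volume.withDensity fun x => ENNReal.ofReal (conv f q x)

/-- Kernel deconvolution estimator `f̃_{h_I}` built from the sample `y`. -/
def fHat {d : ℕ} (I : Finset (Fin d)) (K : ℝ → ℝ) (q : (Fin d → ℝ) → ℝ) (h : Fin d → ℝ)
    {n : ℕ} (y : Fin n → Fin d → ℝ) (xI : I → ℝ) : ℂ :=
  (n : ℂ)⁻¹ * ∑ k, Lh I K q h (fun j => xI j - y k ↑j)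

/-- Expectation `E_f f̃_{h_I}(x_I)`. -/
def fHatMean {d : ℕ} (I : Finset (Fin d)) (K : ℝ → ℝ) (f q : (Fin d → ℝ) → ℝ)
    (h : Fin d → ℝ) (xI : I → ℝ) : ℂ :=
  ∫ y : Fin d → ℝ, Lh I K q h (fun j => xI j - y ↑j)
    ∂(volume.withDensity fun x => ENNReal.ofReal (conv f q x))

/-- Stochastic error `ξ_{h_I} = f̃_{h_I} - E_f f̃_{h_I}`. -/
def xiProc {d : ℕ} (I : Finset (Fin d)) (K : ℝ → ℝ) (f q : (Fin d → ℝ) → ℝ) (h : Fin d → ℝ)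
    {n : ℕ} (y : Fin n → Fin d → ℝ) (xI : I → ℝ) : ℂ :=
  fHat I K q h y xI - fHatMean I K f q h xI

/-- `λ_max = max_j λ_j`. -/
def lamMax {d : ℕ} (lam : Fin d → ℝ) : ℝ := sSup (Set.range lam)

/-- `b_p = (1/2) ∧ (1 - 1/p)`  (with the convention `p.toReal = 0` for `p = ∞`). -/
def bp (p : ℝ≥0∞) : ℝ := min (1 / 2) (1 - 1 / p.toReal)

/-- The constant `c_p` of the bandwidth grid. -/
def cpGrid {d : ℕ} (lam : Fin d → ℝ) (p : ℝ≥0∞) : ℝ :=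
  min 1 ((p.toReal / Real.exp 1 * (1 + lamMax lam * max 2 (p.toReal / (p.toReal - 1))))
    ^ (-(p.toReal * (bp p + lamMax lam))))

/-- Minimal bandwidth `h_min^{(p)}`. -/
def hminG (p : ℝ≥0∞) (n : ℕ) (m : ℕ) : ℝ :=
  if p = ⊤ then (n : ℝ)⁻¹ else (n : ℝ) ^ (-(max 1 (p.toReal / m)))

/-- Maximal bandwidth `h_max^{(p)}`. -/
def hmaxG (p : ℝ≥0∞) (n : ℕ) (m : ℕ) : ℝ :=
  if p = ⊤ then 1 else (Real.log n) ^ (-(p.toReal / m))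

/-- Membership in the dyadic bandwidth set `H_{p,I}` (only the coordinates in `I` matter). -/
def memGrid {d : ℕ} (lam : Fin d → ℝ) (p : ℝ≥0∞) (n : ℕ) (I : Finset (Fin d))
    (h : Fin d → ℝ) : Prop :=
  (∀ j ∈ I, ∃ k : ℕ, 1 ≤ k ∧ h j = 2 ^ (-(k : ℝ))) ∧
  (∀ j ∈ I, hminG p n I.card ≤ h j ∧ h j ≤ hmaxG p n I.card) ∧
  ((if p = ⊤ then Real.sqrt (Real.log n) else cpGrid lam p) ≤
    ((n : ℝ) * ∏ j ∈ I, h j) ^ bp p * ∏ j ∈ I, h j ^ lam j)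

/-- The majorant `U_p(h_I)`. -/
def Up {d : ℕ} (K : ℝ → ℝ) (q : (Fin d → ℝ) → ℝ) (lam : Fin d → ℝ) (p : ℝ≥0∞) (n : ℕ)
    (I : Finset (Fin d)) (h : Fin d → ℝ) : ℝ≥0∞ :=
  if p = ⊤ then
    ENNReal.ofReal ((n : ℝ) ^ (-(1 : ℝ) / 2) * Real.sqrt (Real.log n) *
      ∏ j ∈ I, h j ^ (-lam j - 1 / 2))
  else if p = 2 then
    ENNReal.ofReal ((n : ℝ) ^ (-(1 : ℝ) / 2) * ∏ j ∈ I, h j ^ (-lam j - 1 / 2))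
  else if p.toReal < 2 then
    ENNReal.ofReal ((n : ℝ) ^ (1 / p.toReal - 1)) * eLpNorm (Lh I K q h) p volume
  else
    ENNReal.ofReal ((n : ℝ) ^ (-(1 : ℝ) / 2)) *
      (ENNReal.ofReal (∏ j ∈ I, h j ^ (-lam j - 1 / 2)) +
        ENNReal.ofReal (Real.sqrt (Real.log n)) *
          eLpNorm (Lh I K q h) (ENNReal.ofReal (2 * p.toReal / (p.toReal + 2))) volume)

/-- First-order partial derivative in direction `j` of a complex-valued function. -/
def cpd {ι : Type} [Fintype ι] [DecidableEq ι] (j : ι) (φ : (ι → ℝ) → ℂ) (t : ι → ℝ) : ℂ :=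
  fderiv ℝ φ t (Pi.single j 1)

/-- Iterated mixed partial derivative `D^α φ`. -/
def multiPD {ι : Type} [Fintype ι] [DecidableEq ι] (α : ι → ℕ) (φ : (ι → ℝ) → ℂ) :
    (ι → ℝ) → ℂ :=
  (Finset.univ (α := ι)).toList.foldr (fun j ψ => (cpd j)^[α j] ψ) φ

/-- Assumption (N2), case `p = 2`: lower bound on `|q̂_I|`. -/
def N2two {d : ℕ} (I : Finset (Fin d)) (q : (Fin d → ℝ) → ℝ) (A : ℝ) (lam : Fin d → ℝ) :
    Prop :=
  ∀ t : I → ℝ, A⁻¹ * ∏ j : I, (1 + t j ^ 2) ^ (-lam ↑j / 2) ≤ ‖ftI (marginal I q) t‖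

/-- Assumption (N2), case `p ∈ (1,∞) \ {2}`. -/
def N2mid {d : ℕ} (I : Finset (Fin d)) (q : (Fin d → ℝ) → ℝ) (A : ℝ) (lam : Fin d → ℝ) :
    Prop :=
  (∀ t : I → ℝ, ftI (marginal I q) t ≠ 0) ∧
  ContDiff ℝ I.card (fun t : I → ℝ => (ftI (marginal I q) t)⁻¹) ∧
  ∀ α : I → ℕ, (∑ j, α j) ≤ I.card → ∀ t : I → ℝ,
    ‖multiPD α (fun u => (ftI (marginal I q) u)⁻¹) t * ∏ j, (t j : ℂ) ^ α j‖ ≤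
      A * ∏ j : I, (1 + t j ^ 2) ^ (lam ↑j / 2)

/-- Assumption (N2), case `p = ∞`. -/
def N2inf {d : ℕ} (I : Finset (Fin d)) (q : (Fin d → ℝ) → ℝ) (A : ℝ) (lam : Fin d → ℝ) :
    Prop :=
  (∀ t : I → ℝ, ftI (marginal I q) t ≠ 0) ∧
  ContDiff ℝ 1 (fun t : I → ℝ => (ftI (marginal I q) t)⁻¹) ∧
  ∀ k : I, ∀ a : ℕ, a ≤ 1 → ∀ t : I → ℝ,
    ‖(cpd k)^[a] (fun u => (ftI (marginal I q) u)⁻¹) t‖ ≤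
      A * ∏ j : I, (1 + t j ^ 2) ^ (lam ↑j / 2)

/-- Assumptions (N1)-(N2) of the paper, for a given `p` and a given block `I`. -/
def N1N2 {d : ℕ} (p : ℝ≥0∞) (I : Finset (Fin d)) (q : (Fin d → ℝ) → ℝ) (A : ℝ)
    (lam : Fin d → ℝ) : Prop :=
  0 < A ∧ (∀ j, 0 < lam j) ∧
  (p = 2 → Integrable (ftI (marginal I q)) ∧ N2two I q A lam) ∧
  (2 < p → eLpNorm (marginal I q) ⊤ volume < ⊤) ∧
  (p ≠ 2 → p ≠ ⊤ → N2mid I q A lam) ∧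
  (p = ⊤ → N2inf I q A lam)

/-- `K` is a symmetric Schwartz kernel integrating to one. -/
def IsKernel (K : ℝ → ℝ) : Prop :=
  (∃ KS : SchwartzMap ℝ ℝ, ⇑KS = K) ∧ (∀ z, K (-z) = K z) ∧ (∫ z, K z) = 1

/-- `⌊a⌋`, the largest integer strictly smaller than `a` (for `a > 0`). -/
def flr (a : ℝ) : ℕ := ⌈a⌉₊ - 1

/-- Partial derivative in direction `j` of a real function on `ℝ^ι`. -/
def rpd {ι : Type} [Fintype ι] [DecidableEq ι] (j : ι) (g : (ι → ℝ) → ℝ) (x : ι → ℝ) : ℝ :=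
  fderiv ℝ g x (Pi.single j 1)

/-- The anisotropic Nikolskii class `N_{r,s}(β,L)` of probability densities. -/
def Nikolskii {ι : Type} [Fintype ι] [DecidableEq ι] (r : ι → ℝ≥0∞) (β L : ι → ℝ) :
    Set ((ι → ℝ) → ℝ) :=
  {g | IsDensity g ∧
    (∀ j, ∀ k ≤ flr (β j), eLpNorm ((rpd j)^[k] g) (r j) volume ≤ ENNReal.ofReal (L j)) ∧
    (∀ j, ∀ z : ℝ,
      eLpNorm (fun x => (rpd j)^[flr (β j)] g (x + z • (Pi.single j 1 : ι → ℝ)) -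
        (rpd j)^[flr (β j)] g x) (r j) volume ≤
          ENNReal.ofReal (L j * |z| ^ (β j - flr (β j))))}

/-- Partitions of `{1,…,d}`. -/
abbrev Part (d : ℕ) := Finpartition (Finset.univ : Finset (Fin d))

/-- The operation `P ⋄ P'` on partitions. -/
def diamond {d : ℕ} (P P' : Part d) : Finset (Finset (Fin d)) :=
  ((P.parts ×ˢ P'.parts).image fun z => z.1 ∩ z.2).filter fun I => I.Nonempty

/-- The class `N_{r,d}(β,L,P)` taking smoothness and independence structure into account. -/
def NikolskiiP {d : ℕ} (𝔓 : Set (Part d)) (r : Fin d → ℝ≥0∞) (β L : Fin d → ℝ) (P : Part d) :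
    Set ((Fin d → ℝ) → ℝ) :=
  {g | IsDensity g ∧ (∀ x, g x = ∏ I ∈ P.parts, marginal I g fun j => x ↑j) ∧
    ∀ P' ∈ 𝔓, ∀ P'' ∈ 𝔓, ∀ I ∈ diamond P' P'',
      marginal I g ∈
        Nikolskii (fun j : I => r ↑j) (fun j : I => β ↑j) (fun j : I => L ↑j)}

/-- The set of partitions encoding an independence structure of `f`. -/
def structSet {d : ℕ} (𝔓 : Set (Part d)) (f : (Fin d → ℝ) → ℝ) : Set (Part d) :=
  {P ∈ 𝔓 | ∀ x, f x = ∏ I ∈ P.parts, marginal I f fun j => x ↑j}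

/-- The set `H_p[𝔓]` of admissible pairs `(h,P)`. -/
def HpSet {d : ℕ} (lam : Fin d → ℝ) (p : ℝ≥0∞) (n : ℕ) (𝔓 : Set (Part d)) :
    Set ((Fin d → ℝ) × Part d) :=
  {hP | hP.2 ∈ 𝔓 ∧ ∀ I ∈ hP.2.parts, memGrid lam p n I hP.1}

/-- The product estimator `f̃_{(h,P)}`. -/
def fHatProd {d : ℕ} (K : ℝ → ℝ) (q : (Fin d → ℝ) → ℝ) {n : ℕ}
    (hP : (Fin d → ℝ) × Part d) (y : Fin n → Fin d → ℝ) (x : Fin d → ℝ) : ℂ :=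
  ∏ I ∈ hP.2.parts, fHat I K q hP.1 y fun j => x ↑j

/-- Smoothed estimator `f̃_{h_I,η_I} = K_{η_I} ⋆ f̃_{h_I}`. -/
def fHatConv {d : ℕ} (K : ℝ → ℝ) (q : (Fin d → ℝ) → ℝ) (I : Finset (Fin d))
    (h η : Fin d → ℝ) {n : ℕ} (y : Fin n → Fin d → ℝ) (xI : I → ℝ) : ℂ :=
  ∫ u : I → ℝ, ((Kh I K η u : ℝ) : ℂ) * fHat I K q h y fun j => xI j - u j

/-- Auxiliary estimator `f̃_{(h,P),(η,P')}`. -/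
def fHatProdAux {d : ℕ} (K : ℝ → ℝ) (q : (Fin d → ℝ) → ℝ) {n : ℕ}
    (hP ηP' : (Fin d → ℝ) × Part d) (y : Fin n → Fin d → ℝ) (x : Fin d → ℝ) : ℂ :=
  ∏ I ∈ diamond hP.2 ηP'.2, fHatConv K q I hP.1 ηP'.1 y fun j => x ↑j

/-- `𝔡 = sup_{P ∈ 𝔓} |P|`. -/
def Dd {d : ℕ} (𝔓 : Set (Part d)) : ℕ := sSup ((fun P : Part d => P.parts.card) '' 𝔓)

/-- The random quantity `Ḡ_p`. -/
def Gbar {d : ℕ} (K : ℝ → ℝ) (q : (Fin d → ℝ) → ℝ) (lam : Fin d → ℝ) (p : ℝ≥0∞)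
    (𝔓 : Set (Part d)) {n : ℕ} (y : Fin n → Fin d → ℝ) : ℝ≥0∞ :=
  max 1 (ENNReal.ofReal ((∫ z, |K z|) ^ d) *
    ⨆ hP ∈ HpSet lam p n 𝔓, ⨆ P' ∈ 𝔓, ⨆ I ∈ diamond hP.2 P',
      eLpNorm (fHat I K q hP.1 y) p volume)

/-- The random threshold `Λ_p = 𝔡 γ_p Ḡ_p^{𝔡(𝔡-1)}`. -/
def LamThr {d : ℕ} (K : ℝ → ℝ) (q : (Fin d → ℝ) → ℝ) (lam : Fin d → ℝ) (p : ℝ≥0∞)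
    (𝔓 : Set (Part d)) (γp : ℝ≥0∞) {n : ℕ} (y : Fin n → Fin d → ℝ) : ℝ≥0∞ :=
  (Dd 𝔓 : ℝ≥0∞) * γp * Gbar K q lam p 𝔓 y ^ (Dd 𝔓 * (Dd 𝔓 - 1))

/-- `U_p(h,P) = sup_{I ∈ P} U_p(h_I)`. -/
def UpPart {d : ℕ} (K : ℝ → ℝ) (q : (Fin d → ℝ) → ℝ) (lam : Fin d → ℝ) (p : ℝ≥0∞) (n : ℕ)
    (hP : (Fin d → ℝ) × Part d) : ℝ≥0∞ :=
  ⨆ I ∈ hP.2.parts, Up K q lam p n I hP.1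

/-- The quantity `Δ̃_p(h,P)` of the selection rule. -/
def DeltaT {d : ℕ} (K : ℝ → ℝ) (q : (Fin d → ℝ) → ℝ) (lam : Fin d → ℝ) (p : ℝ≥0∞)
    (𝔓 : Set (Part d)) (γp : ℝ≥0∞) {n : ℕ} (y : Fin n → Fin d → ℝ)
    (hP : (Fin d → ℝ) × Part d) : ℝ≥0∞ :=
  ⨆ ηP' ∈ HpSet lam p n 𝔓,
    (eLpNorm (fun x => fHatProdAux K q hP ηP' y x - fHatProd K q ηP' y x) p volume -
      LamThr K q lam p 𝔓 γp y * UpPart K q lam p n ηP')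

/-- The selection criterion. -/
def crit {d : ℕ} (K : ℝ → ℝ) (q : (Fin d → ℝ) → ℝ) (lam : Fin d → ℝ) (p : ℝ≥0∞)
    (𝔓 : Set (Part d)) (γp : ℝ≥0∞) {n : ℕ} (y : Fin n → Fin d → ℝ)
    (hP : (Fin d → ℝ) × Part d) : ℝ≥0∞ :=
  DeltaT K q lam p 𝔓 γp y hP + LamThr K q lam p 𝔓 γp y * UpPart K q lam p n hP

/-- `(h̃,P̃)` obeys the data-driven selection rule. -/
def IsSelection {d : ℕ} (K : ℝ → ℝ) (q : (Fin d → ℝ) → ℝ) (lam : Fin d → ℝ) (p : ℝ≥0∞)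
    (𝔓 : Set (Part d)) (γp : ℝ≥0∞) {n : ℕ}
    (sel : (Fin n → Fin d → ℝ) → (Fin d → ℝ) × Part d) : Prop :=
  ∀ y, sel y ∈ HpSet lam p n 𝔓 ∧
    crit K q lam p 𝔓 γp y (sel y) = ⨅ hP ∈ HpSet lam p n 𝔓, crit K q lam p 𝔓 γp y hP

/-- `L_p`-risk of the selected estimator `f̃ = f̃_{(h̃,P̃)}` (`E_f ‖f̃ - f‖_∞` for `p = ∞`). -/
def riskSel {d : ℕ} (K : ℝ → ℝ) (q : (Fin d → ℝ) → ℝ) (p : ℝ≥0∞) {n : ℕ}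
    (sel : (Fin n → Fin d → ℝ) → (Fin d → ℝ) × Part d) (f : (Fin d → ℝ) → ℝ) : ℝ≥0∞ :=
  if p = ⊤ then
    ∫⁻ y, eLpNorm (fun x => fHatProd K q (sel y) y x - (f x : ℂ)) ⊤ volume
      ∂obsMeasure d n f q
  else
    (∫⁻ y, eLpNorm (fun x => fHatProd K q (sel y) y x - (f x : ℂ)) p volume ^ p.toReal
      ∂obsMeasure d n f q) ^ (1 / p.toReal)

/-- The oracle risk `R_p[(h,P),f]`. -/
def riskOracle {d : ℕ} (K : ℝ → ℝ) (q : (Fin d → ℝ) → ℝ) (p : ℝ≥0∞) (𝔓 : Set (Part d))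
    (n : ℕ) (hP : (Fin d → ℝ) × Part d) (f : (Fin d → ℝ) → ℝ) : ℝ≥0∞ :=
  if p = ⊤ then
    ∫⁻ y, (⨆ P' ∈ 𝔓, ⨆ I ∈ diamond hP.2 P',
      eLpNorm (fun xI => fHat I K q hP.1 y xI - (marginal I f xI : ℂ)) ⊤ volume)
      ∂obsMeasure d n f q
  else
    (∫⁻ y, (⨆ P' ∈ 𝔓, ⨆ I ∈ diamond hP.2 P',
      eLpNorm (fun xI => fHat I K q hP.1 y xI - (marginal I f xI : ℂ)) p volume) ^ p.toReal
      ∂obsMeasure d n f q) ^ (1 / p.toReal)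

/-- `f_p = 1 ∨ sup_{P,P' ∈ 𝔓} sup_{I ∈ P⋄P'} ‖f_I‖_p` (as an extended real). -/
def fpE {d : ℕ} (p : ℝ≥0∞) (𝔓 : Set (Part d)) (f : (Fin d → ℝ) → ℝ) : ℝ≥0∞ :=
  max 1 (⨆ P ∈ 𝔓, ⨆ P' ∈ 𝔓, ⨆ I ∈ diamond P P', eLpNorm (marginal I f) p volume)

/-- `I_d^⋄ = {I ∈ P⋄P' : P,P' ∈ 𝔓}`. -/
def Idia {d : ℕ} (𝔓 : Set (Part d)) : Set (Finset (Fin d)) :=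
  {I | ∃ P ∈ 𝔓, ∃ P' ∈ 𝔓, I ∈ diamond P P'}

/-- `ξ_p = sup_{I ∈ I_d^⋄} sup_{h_I ∈ H_{p,I}} [‖ξ_{h_I}‖_p - γ_p U_p(h_I)]_+`
(the positive part is realized by truncated subtraction in `ℝ≥0∞`). -/
def xiP {d : ℕ} (K : ℝ → ℝ) (f q : (Fin d → ℝ) → ℝ) (lam : Fin d → ℝ) (p : ℝ≥0∞)
    (𝔓 : Set (Part d)) (γp : ℝ≥0∞) {n : ℕ} (y : Fin n → Fin d → ℝ) : ℝ≥0∞ :=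
  ⨆ I ∈ Idia 𝔓, ⨆ h ∈ {h : Fin d → ℝ | memGrid lam p n I h},
    (eLpNorm (xiProc I K f q h y) p volume - γp * Up K q lam p n I h)

/-- `f̄_p = 𝔡² ‖K‖_1^d Ḡ_p^{𝔡(𝔡-1)} (max{Ḡ_p, ‖K‖_1^d 𝐟_p})^{𝔡-1}`. -/
def fbarP {d : ℕ} (K : ℝ → ℝ) (f q : (Fin d → ℝ) → ℝ) (lam : Fin d → ℝ) (p : ℝ≥0∞)
    (𝔓 : Set (Part d)) {n : ℕ} (y : Fin n → Fin d → ℝ) : ℝ≥0∞ :=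
  (Dd 𝔓 : ℝ≥0∞) ^ 2 * ENNReal.ofReal ((∫ z, |K z|) ^ d) *
    Gbar K q lam p 𝔓 y ^ (Dd 𝔓 * (Dd 𝔓 - 1)) *
    max (Gbar K q lam p 𝔓 y) (ENNReal.ofReal ((∫ z, |K z|) ^ d) * fpE p 𝔓 f) ^ (Dd 𝔓 - 1)

section

lemma exp_quad (y : ℝ) : Real.exp y ≤ 1 + y + y ^ 2 * Real.exp |y| := by
  have h := Complex.norm_exp_sub_sum_le_norm_mul_exp (y : ℂ) 2
  simp only [Finset.sum_range_succ, Finset.range_zero, Finset.sum_empty, zero_add, pow_zero,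
    Nat.factorial, pow_one, Complex.norm_real, Real.norm_eq_abs] at h
  have e : (Complex.exp (y : ℂ) - (1 / ((1 : ℕ) : ℂ) + (y : ℂ) / ((1 * 1 : ℕ) : ℂ))) =
    ((Real.exp y - (1 + y) : ℝ) : ℂ) := by push_cast; ring
  simp only [Nat.succ_eq_add_one, zero_add] at h
  rw [e, Complex.norm_real, Real.norm_eq_abs, sq_abs] at h
  have := le_abs_self (Real.exp y - (1 + y))
  linarith

/-- one-variable version -/
lemma one_add_pow_ineq (p : ℝ) (hp : 1 < p) :
    ∃ C : ℝ, 1 ≤ C ∧ ∀ z : ℂ, ‖1 + z‖ ^ p ≤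
      1 + p * z.re + C * ((if 2 < p then ‖z‖ ^ 2 else 0) + ‖z‖ ^ p) := by
  set C1 : ℝ := p / 2 + (2 * p) ^ 2 * Real.exp (2 * p) with hC1
  set C2 : ℝ := 3 ^ p + p * 2 ^ (p - 1) with hC2
  have hC1' : 0 ≤ C1 := by positivity
  have hC2' : 1 ≤ C2 := by
    have : (1:ℝ) ≤ 3 ^ p := Real.one_le_rpow (by norm_num) (by linarith)
    have : 0 ≤ p * 2 ^ (p - 1) := by positivity
    linarith
  refine ⟨C1 + C2, by linarith, fun z => ?_⟩
  have hzre : |z.re| ≤ ‖z‖ := Complex.abs_re_le_norm z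
  have hz0 := norm_nonneg z
  by_cases hz : ‖z‖ ≤ 1 / 2
  · have h1 : ‖1 + z‖ ^ 2 = 1 + (2 * z.re + ‖z‖ ^ 2) := by
      rw [← Complex.normSq_eq_norm_sq, ← Complex.normSq_eq_norm_sq, Complex.normSq_apply,
        Complex.normSq_apply]
      simp; ring
    set x := 2 * z.re + ‖z‖ ^ 2 with hx
    have hxa : |x| ≤ 4 * ‖z‖ := by
      rw [abs_le] at hzre ⊢
      constructor <;> nlinarith
    have h2 : ‖1 + z‖ ^ p = (‖1 + z‖ ^ 2) ^ (p / 2) := by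
      rw [← Real.rpow_natCast, ← Real.rpow_mul (norm_nonneg _)]; congr 1; push_cast; ring
    have h3 : (‖1 + z‖ ^ 2) ^ (p / 2) ≤ Real.exp (p / 2 * x) := by
      rw [h1]
      have : (1 + x) ≤ Real.exp x := by linarith [Real.add_one_le_exp x]
      calc (1 + x) ^ (p / 2) ≤ (Real.exp x) ^ (p / 2) :=
            Real.rpow_le_rpow (by rw [← h1]; positivity) this (by positivity)
        _ = _ := by rw [← Real.exp_mul]; ring_nf
    have h4 := exp_quad (p / 2 * x)
    have habs : |p / 2 * x| ≤ 2 * p * ‖z‖ := by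
      rw [abs_mul, abs_of_pos (by positivity : 0 < p / 2)]
      nlinarith
    have h5 : (p / 2 * x) ^ 2 * Real.exp |p / 2 * x| ≤ (2 * p) ^ 2 * ‖z‖ ^ 2 * Real.exp (2 * p) := by
      have e1 : (p / 2 * x) ^ 2 ≤ (2 * p) ^ 2 * ‖z‖ ^ 2 := by
        rw [← sq_abs (p / 2 * x), ← mul_pow]
        exact pow_le_pow_left₀ (abs_nonneg _) habs 2
      have e2 : Real.exp |p / 2 * x| ≤ Real.exp (2 * p) := by
        apply Real.exp_le_exp.mpr; nlinarith
      exact mul_le_mul e1 e2 (by positivity) (by positivity)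
    have h6 : ‖1 + z‖ ^ p ≤ 1 + p * z.re + C1 * ‖z‖ ^ 2 := by
      rw [h2]
      have : p / 2 * x = p * z.re + p / 2 * ‖z‖ ^ 2 := by rw [hx]; ring
      calc _ ≤ 1 + p / 2 * x + (p / 2 * x) ^ 2 * Real.exp |p / 2 * x| := h3.trans h4
        _ ≤ 1 + p / 2 * x + (2 * p) ^ 2 * ‖z‖ ^ 2 * Real.exp (2 * p) := by linarith
        _ = _ := by rw [this, hC1]; ring
    have hpp : 0 ≤ ‖z‖ ^ p := by positivity
    split_ifs with h2p
    · have : 0 ≤ ‖z‖ ^ 2 := by positivity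
      nlinarith
    · have h7 : ‖z‖ ^ 2 ≤ ‖z‖ ^ p := by
        rw [← Real.rpow_natCast]
        rcases hz0.eq_or_lt with h | h
        · rw [← h]; rw [Real.zero_rpow (by norm_num), Real.zero_rpow (by linarith)]
        · exact Real.rpow_le_rpow_of_exponent_ge h (by linarith) (by push_cast; linarith)
      nlinarith
  · push Not at hz
    have h1 : ‖1 + z‖ ≤ 3 * ‖z‖ := by
      calc ‖1 + z‖ ≤ ‖(1:ℂ)‖ + ‖z‖ := norm_add_le _ _
        _ ≤ _ := by simp; linarith
    have h2 : ‖1 + z‖ ^ p ≤ 3 ^ p * ‖z‖ ^ p := by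
      rw [← Real.mul_rpow (by norm_num) hz0]
      exact Real.rpow_le_rpow (norm_nonneg _) h1 (by linarith)
    have h3 : ‖z‖ ≤ 2 ^ (p - 1) * ‖z‖ ^ p := by
      have : ‖z‖ ^ p = ‖z‖ ^ (p - 1) * ‖z‖ := by
        rw [← Real.rpow_add_one (by linarith)]; ring_nf
      rw [this, ← mul_assoc, ← Real.mul_rpow (by norm_num) hz0]
      have : 1 ≤ (2 * ‖z‖) ^ (p - 1) := Real.one_le_rpow (by linarith) (by linarith)
      nlinarith
    have h4 : 0 ≤ (if 2 < p then ‖z‖ ^ 2 else 0) := by split_ifs <;> positivity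
    have hpp : 0 ≤ ‖z‖ ^ p := by positivity
    have h5 : -(p * z.re) ≤ p * ‖z‖ := by
      rw [abs_le] at hzre; nlinarith
    have h6 : p * ‖z‖ ≤ p * 2 ^ (p - 1) * ‖z‖ ^ p := by
      rw [mul_assoc]; exact mul_le_mul_of_nonneg_left h3 (by linarith)
    have h7 : 0 ≤ (C1 + C2) * (if 2 < p then ‖z‖ ^ 2 else 0) := mul_nonneg (by linarith) h4
    have h8 : C2 * ‖z‖ ^ p = 3 ^ p * ‖z‖ ^ p + p * 2 ^ (p - 1) * ‖z‖ ^ p := by rw [hC2]; ring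
    have h9 : 0 ≤ C1 * ‖z‖ ^ p := mul_nonneg hC1' hpp
    nlinarith

lemma pow_ineq (p : ℝ) (hp : 1 < p) :
    ∃ C : ℝ, 1 ≤ C ∧ ∀ a b : ℂ, ‖a + b‖ ^ p ≤
      ‖a‖ ^ p + p * (((‖a‖ ^ (p - 2) : ℝ) : ℂ) * (starRingEnd ℂ a) * b).re +
        C * ((if 2 < p then ‖a‖ ^ (p - 2) * ‖b‖ ^ 2 else 0) + ‖b‖ ^ p) := by
  obtain ⟨C, hC, h⟩ := one_add_pow_ineq p hp
  refine ⟨C, hC, fun a b => ?_⟩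
  by_cases ha : a = 0
  · subst ha
    have : 0 ≤ (if 2 < p then (0:ℝ) ^ (p - 2) * ‖b‖ ^ 2 else 0) := by split_ifs <;> positivity
    have h3 : 0 ≤ ‖b‖ ^ p := by positivity
    simp only [zero_add, norm_zero, map_zero, mul_zero, zero_mul, Complex.zero_re, add_zero]
    rw [Real.zero_rpow (by linarith)]
    nlinarith
  · have hn : 0 < ‖a‖ := norm_pos_iff.mpr ha
    have h1 := h (b / a)
    have e1 : ‖a + b‖ ^ p = ‖a‖ ^ p * ‖1 + b / a‖ ^ p := by
      rw [← Real.mul_rpow (norm_nonneg _) (norm_nonneg _), ← norm_mul]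
      congr 2; field_simp
    have e2 : (((‖a‖ ^ (p - 2) : ℝ) : ℂ) * (starRingEnd ℂ a) * b).re = ‖a‖ ^ p * (b / a).re := by
      have : (((‖a‖ ^ (p - 2) : ℝ) : ℂ) * (starRingEnd ℂ a) * b) =
          ((‖a‖ ^ (p - 2) * ‖a‖ ^ 2 : ℝ) : ℂ) * (b / a) := by
        push_cast
        rw [← Complex.conj_mul']
        field_simp
      rw [this, Complex.re_ofReal_mul, ← Real.rpow_natCast ‖a‖ 2, ← Real.rpow_add hn]
      norm_num
    have e3 : ‖b‖ ^ p = ‖a‖ ^ p * ‖b / a‖ ^ p := by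
      rw [← Real.mul_rpow (norm_nonneg _) (norm_nonneg _), ← norm_mul]
      congr 2; field_simp
    have e4 : ‖a‖ ^ (p - 2) * ‖b‖ ^ 2 = ‖a‖ ^ p * ‖b / a‖ ^ 2 := by
      have : ‖a‖ ^ p = ‖a‖ ^ (p - 2) * ‖a‖ ^ 2 := by
        rw [← Real.rpow_natCast ‖a‖ 2, ← Real.rpow_add hn]; norm_num
      rw [this, norm_div]; field_simp
    have h2 := mul_le_mul_of_nonneg_left h1 (by positivity : 0 ≤ ‖a‖ ^ p)
    rw [e1, e2, e3]
    split_ifs at h2 ⊢ with h2p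
    · rw [e4]; linarith
    · linarith

/-- scalar step -/
lemma scalar_step {Ω : Type*} [MeasurableSpace Ω] (μ : Measure Ω) [IsProbabilityMeasure μ]
    (p C c0 M N β τ : ℝ) (hp : 0 < p) (hC : 0 ≤ C) (hM : 0 ≤ M) (hN : 0 < N)
    (hβ : 0 ≤ β) (a b : Ω → ℝ) (ha : Measurable a) (hb : Measurable b)
    (haβ : ∀ ω, |a ω| ≤ β) (ha0 : ∫ ω, a ω ∂μ = 0) (ha2 : ∫ ω, a ω ^ 2 ∂μ ≤ τ)
    (hb0 : ∀ ω, 0 ≤ b ω) (hbβ : ∀ ω, b ω ≤ 2 * β) (hbi : ∫ ω, b ω ∂μ ≤ 2 / N)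
    (hMβ : M * β ≤ c0) (hMτ : M * τ ≤ c0 / N) :
    Integrable (fun ω => Real.exp (M * (p * a ω + C * b ω))) μ ∧
    ∫ ω, Real.exp (M * (p * a ω + C * b ω)) ∂μ ≤
      Real.exp (M * (2 * C + Real.exp (c0 * (p + 2 * C)) * (2 * p ^ 2 * c0 + 8 * C ^ 2 * c0)) / N)
      := by
  set x : Ω → ℝ := fun ω => p * a ω + C * b ω with hx
  set Λ := c0 * (p + 2 * C) with hΛ
  have hxm : Measurable x := by fun_prop
  have hia : Integrable a μ := Integrable.of_bound ha.aestronglyMeasurable β (ae_of_all _ haβ)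
  have hib : Integrable b μ := Integrable.of_bound hb.aestronglyMeasurable (2 * β)
    (ae_of_all _ fun ω => by rw [Real.norm_eq_abs, abs_of_nonneg (hb0 ω)]; exact hbβ ω)
  have hia2 : Integrable (fun ω => a ω ^ 2) μ := Integrable.of_bound
    (by fun_prop) (β ^ 2) (ae_of_all _ fun ω => by
      rw [Real.norm_eq_abs, abs_pow]; exact pow_le_pow_left₀ (abs_nonneg _) (haβ ω) 2)
  have hix : Integrable x μ := (hia.const_mul p).add (hib.const_mul C)
  have hxb : ∀ ω, |x ω| ≤ (p + 2 * C) * β := fun ω => by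
    calc |x ω| ≤ |p * a ω| + |C * b ω| := abs_add_le _ _
      _ = p * |a ω| + C * b ω := by
        rw [abs_mul, abs_mul, abs_of_pos hp, abs_of_nonneg hC, abs_of_nonneg (hb0 ω)]
      _ ≤ p * β + C * (2 * β) := by
        gcongr
        · exact haβ ω
        · exact hbβ ω
      _ = _ := by ring
  have hMx : ∀ ω, |M * x ω| ≤ Λ := fun ω => by
    rw [abs_mul, abs_of_nonneg hM]
    calc M * |x ω| ≤ M * ((p + 2 * C) * β) := by gcongr; exact hxb ω
      _ = (M * β) * (p + 2 * C) := by ring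
      _ ≤ _ := by rw [hΛ]; gcongr
  have hx2 : ∀ ω, x ω ^ 2 ≤ 2 * p ^ 2 * a ω ^ 2 + 4 * C ^ 2 * β * b ω := fun ω => by
    have h1 : x ω ^ 2 ≤ 2 * (p * a ω) ^ 2 + 2 * (C * b ω) ^ 2 := by
      have := sq_nonneg (p * a ω - C * b ω); simp only [hx]; nlinarith
    have h2 : (C * b ω) ^ 2 ≤ C ^ 2 * (2 * β) * b ω := by
      have := mul_le_mul_of_nonneg_right (hbβ ω) (hb0 ω)
      nlinarith [sq_nonneg C]
    nlinarith
  have hint : Integrable (fun ω => 1 + M * x ω + M ^ 2 * Real.exp Λ *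
      (2 * p ^ 2 * a ω ^ 2 + 4 * C ^ 2 * β * b ω)) μ := by
    apply Integrable.add
    · exact (integrable_const _).add (hix.const_mul M)
    · exact ((hia2.const_mul _).add (hib.const_mul _)).const_mul _
  have step : ∀ ω, Real.exp (M * x ω) ≤ 1 + M * x ω + M ^ 2 * Real.exp Λ *
      (2 * p ^ 2 * a ω ^ 2 + 4 * C ^ 2 * β * b ω) := fun ω => by
    refine (exp_quad _).trans ?_
    have : (M * x ω) ^ 2 * Real.exp |M * x ω| ≤ M ^ 2 * Real.exp Λ *
      (2 * p ^ 2 * a ω ^ 2 + 4 * C ^ 2 * β * b ω) := by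
      calc (M * x ω) ^ 2 * Real.exp |M * x ω| ≤ (M * x ω) ^ 2 * Real.exp Λ := by
            gcongr; exact hMx ω
        _ = M ^ 2 * Real.exp Λ * x ω ^ 2 := by ring
        _ ≤ _ := by gcongr; exact hx2 ω
    linarith
  have hexpi : Integrable (fun ω => Real.exp (M * x ω)) μ :=
    Integrable.of_bound (by fun_prop) (Real.exp Λ) (ae_of_all _ fun ω => by
      rw [Real.norm_eq_abs, abs_of_pos (Real.exp_pos _)]
      exact Real.exp_le_exp.mpr ((le_abs_self _).trans (hMx ω)))
  refine ⟨hexpi, ?_⟩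
  have hle := integral_mono hexpi hint step
  have hxint : ∫ ω, x ω ∂μ = C * ∫ ω, b ω ∂μ := by
    simp only [hx]
    rw [integral_add (hia.const_mul p) (hib.const_mul C), integral_const_mul, integral_const_mul,
      ha0]; ring
  have hcalc : ∫ ω, (1 + M * x ω + M ^ 2 * Real.exp Λ *
      (2 * p ^ 2 * a ω ^ 2 + 4 * C ^ 2 * β * b ω)) ∂μ = 1 + M * (C * ∫ ω, b ω ∂μ) +
      M ^ 2 * Real.exp Λ * (2 * p ^ 2 * (∫ ω, a ω ^ 2 ∂μ) + 4 * C ^ 2 * β * ∫ ω, b ω ∂μ) := by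
    have i1 : Integrable (fun ω => 1 + M * x ω) μ := (integrable_const _).add (hix.const_mul M)
    have i2 : Integrable (fun ω => 2 * p ^ 2 * a ω ^ 2 + 4 * C ^ 2 * β * b ω) μ :=
      (hia2.const_mul _).add (hib.const_mul _)
    rw [integral_add i1 (i2.const_mul _),
      integral_add (integrable_const _) (hix.const_mul M), integral_const_mul, integral_const_mul,
      integral_add (hia2.const_mul _) (hib.const_mul _), integral_const_mul, integral_const_mul,
      hxint]
    simp
  rw [hcalc] at hle
  refine hle.trans ?_
  refine le_trans ?_ (Real.add_one_le_exp _)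
  have e1 : M * (C * ∫ ω, b ω ∂μ) ≤ M * (C * (2 / N)) := by gcongr
  have e2 : M ^ 2 * Real.exp Λ * (2 * p ^ 2 * (∫ ω, a ω ^ 2 ∂μ) + 4 * C ^ 2 * β * ∫ ω, b ω ∂μ)
      ≤ M * Real.exp Λ * (2 * p ^ 2 * (c0 / N) + 4 * C ^ 2 * c0 * (2 / N)) := by
    calc _ ≤ M ^ 2 * Real.exp Λ * (2 * p ^ 2 * τ + 4 * C ^ 2 * β * (2 / N)) := by gcongr
      _ = M * Real.exp Λ * (2 * p ^ 2 * (M * τ) + 4 * C ^ 2 * (M * β) * (2 / N)) := by ring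
      _ ≤ _ := by gcongr
  have e3 : M * (2 * C + Real.exp Λ * (2 * p ^ 2 * c0 + 8 * C ^ 2 * c0)) / N =
    M * (C * (2 / N)) + M * Real.exp Λ * (2 * p ^ 2 * (c0 / N) + 4 * C ^ 2 * c0 * (2 / N)) := by
    ring
  rw [e3]; linarith

end

section

/-- `∫ |s|^p`. -/
def Fp {X : Type*} [MeasurableSpace X] (ν : Measure X) (p : ℝ) (s : X → ℂ) : ℝ≥0∞ :=
  ∫⁻ x, ‖s x‖ₑ ^ p ∂ν

structure CoreHyp {X Ω : Type*} [MeasurableSpace X] [MeasurableSpace Ω] (ν : Measure X)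
    (μ : Measure Ω) (p : ℝ) (ζ : Ω → X → ℂ) (B σ2 v2 : ℝ) : Prop where
  meas : Measurable (Function.uncurry ζ)
  hB0 : 0 ≤ B
  hσ0 : 0 ≤ σ2
  hv0 : 0 ≤ v2
  hB : ∀ ω, Fp ν p (ζ ω) ≤ ENNReal.ofReal (B ^ p)
  mean : ∀ x, ∫ ω, ζ ω x ∂μ = 0
  hσ : ∀ g : X → ℂ, Measurable g → ∫⁻ x, ‖g x‖ₑ ^ (p / (p - 1)) ∂ν ≠ ⊤ →
    ∫⁻ ω, ‖∫ x, g x * ζ ω x ∂ν‖ₑ ^ (2 : ℝ) ∂μ ≤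
      ENNReal.ofReal σ2 * (∫⁻ x, ‖g x‖ₑ ^ (p / (p - 1)) ∂ν) ^ (2 * (p - 1) / p)
  hv : 2 < p → ∫⁻ x, (∫⁻ ω, ‖ζ ω x‖ₑ ^ (2 : ℝ) ∂μ) ^ (p / 2) ∂ν ≤ ENNReal.ofReal (v2 ^ (p / 2))

lemma enorm_rpow_eq (z : ℂ) {p : ℝ} (hp : 0 ≤ p) : ‖z‖ₑ ^ p = ENNReal.ofReal (‖z‖ ^ p) := by
  rw [← ofReal_norm, ENNReal.ofReal_rpow_of_nonneg (norm_nonneg _) hp]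

lemma step_bound {X Ω : Type*} [MeasurableSpace X] [MeasurableSpace Ω] (ν : Measure X)
    [SFinite ν] (μ : Measure Ω) [IsProbabilityMeasure μ] (p C : ℝ) (hp : 1 < p) (hC1 : 1 ≤ C)
    (hC : ∀ a b : ℂ, ‖a + b‖ ^ p ≤
      ‖a‖ ^ p + p * (((‖a‖ ^ (p - 2) : ℝ) : ℂ) * (starRingEnd ℂ a) * b).re +
        C * ((if 2 < p then ‖a‖ ^ (p - 2) * ‖b‖ ^ 2 else 0) + ‖b‖ ^ p))
    (ζ : Ω → X → ℂ) (B σ2 v2 : ℝ) (H : CoreHyp ν μ p ζ B σ2 v2)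
    (R M N c0 : ℝ) (hR : 0 < R) (hM : 0 ≤ M) (hN : 1 ≤ N)
    (h1 : N * B ^ p ≤ R ^ p) (h2 : 2 < p → N * v2 ≤ R ^ 2) (h3 : M * (B / R) ≤ c0)
    (h4 : M * (σ2 / R ^ 2) ≤ c0 / N) (s : X → ℂ) (hs : Measurable s) (hsF : Fp ν p s ≠ ⊤) :
    ∫⁻ ω, (Fp ν p (s + ζ ω) + ENNReal.ofReal (R ^ p)) ^ M ∂μ ≤
      ENNReal.ofReal (Real.exp
        (M * (2 * C + Real.exp (c0 * (p + 2 * C)) * (2 * p ^ 2 * c0 + 8 * C ^ 2 * c0)) / N)) *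
      (Fp ν p s + ENNReal.ofReal (R ^ p)) ^ M := by
  have hp0 : 0 < p := by linarith
  have hp1 : 0 < p - 1 := by linarith
  set F : ℝ := (Fp ν p s).toReal with hF
  have hF0 : 0 ≤ F := ENNReal.toReal_nonneg
  have hFe : Fp ν p s = ENNReal.ofReal F := (ENNReal.ofReal_toReal hsF).symm
  set G : ℝ := F + R ^ p with hG
  have hRp : 0 < R ^ p := Real.rpow_pos_of_pos hR p
  have hGpos : 0 < G := by positivity
  have hFG : F ≤ G := by linarith
  have hB0 := H.hB0
  have hRG : R ≤ G ^ (1 / p) := by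
    calc R = (R ^ p) ^ (1 / p) := by rw [← Real.rpow_mul hR.le]; field_simp; simp
      _ ≤ _ := Real.rpow_le_rpow hRp.le (by linarith) (by positivity)
  -- the key normalised inequality
  have key1 : F ^ ((p - 1) / p) * R ≤ G := by
    calc F ^ ((p - 1) / p) * R ≤ G ^ ((p - 1) / p) * G ^ (1 / p) := by gcongr
      _ = G := by
        rw [← Real.rpow_add hGpos]
        have : (p - 1) / p + 1 / p = 1 := by field_simp; ring
        rw [this, Real.rpow_one]
  have key2 : 2 < p → F ^ ((p - 2) / p) * R ^ 2 ≤ G := fun h2p => by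
    have : 0 ≤ (p - 2) / p := div_nonneg (by linarith) hp0.le
    calc F ^ ((p - 2) / p) * R ^ 2 ≤ G ^ ((p - 2) / p) * (G ^ (1 / p)) ^ 2 := by gcongr
      _ = G := by
        rw [← Real.rpow_natCast (G ^ (1 / p)) 2, ← Real.rpow_mul hGpos.le, ← Real.rpow_add hGpos]
        have : (p - 2) / p + 1 / p * ((2 : ℕ) : ℝ) = 1 := by push_cast; field_simp; ring
        rw [this, Real.rpow_one]
  set β : ℝ := B / R with hβ
  have hβ0 : 0 ≤ β := by positivity
  have hβp : β ^ p ≤ 1 / N := by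
    rw [hβ, Real.div_rpow hB0 hR.le, div_le_div_iff₀ hRp (by linarith)]; linarith
  have hβ1 : β ≤ 1 := by
    by_contra hcon
    push Not at hcon
    have : 1 < β ^ p := Real.one_lt_rpow hcon hp0
    have : 1 / N ≤ 1 := by rw [div_le_one (by linarith)]; exact hN
    linarith
  have hβpβ : β ^ p ≤ β := by
    rcases hβ0.eq_or_lt with h | h
    · rw [← h, Real.zero_rpow hp0.ne']
    · calc β ^ p ≤ β ^ (1:ℝ) := Real.rpow_le_rpow_of_exponent_ge h hβ1 hp.le
        _ = β := Real.rpow_one _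
  set g : X → ℂ := fun x => ((‖s x‖ ^ (p - 2) : ℝ) : ℂ) * (starRingEnd ℂ (s x)) with hg
  have hgm : Measurable g := by
    have : Measurable fun x => (starRingEnd ℂ (s x)) := Complex.continuous_conj.measurable.comp hs
    have h' : Measurable fun x => ((‖s x‖ ^ (p - 2) : ℝ) : ℂ) :=
      Complex.measurable_ofReal.comp ((hs.norm).pow_const _)
    exact h'.mul this
  have hζm : ∀ ω, Measurable (ζ ω) := fun ω => H.meas.of_uncurry_left
  have hgn : ∀ x, ‖g x‖ = ‖s x‖ ^ (p - 1) := fun x => by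
    simp only [hg, norm_mul, Complex.norm_real, RCLike.norm_conj]
    rw [Real.norm_of_nonneg (by positivity)]
    rcases (norm_nonneg (s x)).eq_or_lt with h | h
    · rw [← h, mul_zero, Real.zero_rpow hp1.ne']
    · rw [← Real.rpow_add_one h.ne']; ring_nf
  have hgp : ∫⁻ x, ‖g x‖ₑ ^ (p / (p - 1)) ∂ν = ENNReal.ofReal F := by
    rw [← hFe]; unfold Fp
    congr 1; ext x
    rw [enorm_rpow_eq _ (by positivity), enorm_rpow_eq _ hp0.le, hgn, ← Real.rpow_mul (norm_nonneg _)]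
    congr 2; field_simp
  have hpq : (p / (p - 1)).HolderConjugate p := by
    rw [Real.holderConjugate_iff]
    constructor
    · rw [lt_div_iff₀ hp1]; linarith
    · field_simp; ring
  have hgζ : ∀ ω, ∫⁻ x, ‖g x * ζ ω x‖ₑ ∂ν ≤ ENNReal.ofReal (F ^ ((p - 1) / p) * B) := fun ω => by
    have := ENNReal.lintegral_mul_le_Lp_mul_Lq ν hpq (f := fun x => ‖g x‖ₑ)
      (g := fun x => ‖ζ ω x‖ₑ) hgm.enorm.aemeasurable (hζm ω).enorm.aemeasurable
    simp only [Pi.mul_apply] at this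
    simp_rw [enorm_mul]
    refine this.trans ?_
    rw [hgp, ENNReal.ofReal_rpow_of_nonneg hF0 (by positivity), ENNReal.ofReal_mul (by positivity)]
    have e : 1 / (p / (p - 1)) = (p - 1) / p := by field_simp
    rw [e]
    gcongr
    calc _ ≤ (ENNReal.ofReal (B ^ p)) ^ (1 / p) := by
          gcongr; exact H.hB ω
      _ = ENNReal.ofReal B := by
          rw [ENNReal.ofReal_rpow_of_nonneg (by positivity) (by positivity), ← Real.rpow_mul hB0]
          field_simp; simp
  have hgζi : ∀ ω, Integrable (fun x => g x * ζ ω x) ν := fun ω =>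
    ⟨(hgm.mul (hζm ω)).aestronglyMeasurable, (hgζ ω).trans_lt ENNReal.ofReal_lt_top⟩
  set ell : Ω → ℝ := fun ω => (∫ x, g x * ζ ω x ∂ν).re with hell
  have hjm : StronglyMeasurable fun z : Ω × X => g z.2 * ζ z.1 z.2 :=
    ((hgm.comp measurable_snd).mul H.meas).stronglyMeasurable
  have hintm : Measurable fun ω => ∫ x, g x * ζ ω x ∂ν :=
    (StronglyMeasurable.integral_prod_right' hjm).measurable
  have hellm : Measurable ell := Complex.measurable_re.comp hintm
  have hnint : ∀ ω, ‖∫ x, g x * ζ ω x ∂ν‖ ≤ F ^ ((p - 1) / p) * B := fun ω => by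
    have h := enorm_integral_le_lintegral_enorm (μ := ν) (fun x => g x * ζ ω x)
    have h' := h.trans (hgζ ω)
    rw [← ofReal_norm] at h'
    exact (ENNReal.ofReal_le_ofReal_iff (by positivity)).mp h'
  have hellb : ∀ ω, |ell ω| ≤ F ^ ((p - 1) / p) * B := fun ω =>
    (Complex.abs_re_le_norm _).trans (hnint ω)
  have hprodint : Integrable (fun z : Ω × X => g z.2 * ζ z.1 z.2) (μ.prod ν) := by
    refine ⟨hjm.aestronglyMeasurable, ?_⟩
    unfold HasFiniteIntegral
    rw [lintegral_prod _ hjm.measurable.enorm.aemeasurable]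
    calc _ ≤ ∫⁻ ω, ENNReal.ofReal (F ^ ((p - 1) / p) * B) ∂μ := lintegral_mono hgζ
      _ < ⊤ := by simp
  have hell0 : ∫ ω, ell ω ∂μ = 0 := by
    have e1 : ∫ ω, (∫ x, g x * ζ ω x ∂ν) ∂μ = 0 := by
      rw [integral_integral_swap hprodint]
      simp_rw [integral_const_mul, H.mean]; simp
    have i1 : Integrable (fun ω => ∫ x, g x * ζ ω x ∂ν) μ :=
      Integrable.of_bound hintm.aestronglyMeasurable _ (ae_of_all _ hnint)
    have := integral_re (𝕜 := ℂ) i1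
    simp only [hell]
    simp only [RCLike.re_eq_complex_re] at this
    rw [this, e1]; simp
  have hell2 : ∫ ω, ell ω ^ 2 ∂μ ≤ σ2 * F ^ (2 * (p - 1) / p) := by
    have hc := H.hσ g hgm (by rw [hgp]; exact ENNReal.ofReal_ne_top)
    rw [hgp, ENNReal.ofReal_rpow_of_nonneg hF0 (by positivity),
      ← ENNReal.ofReal_mul H.hσ0] at hc
    have hpos : 0 ≤ σ2 * F ^ (2 * (p - 1) / p) := mul_nonneg H.hσ0 (by positivity)
    rw [integral_eq_lintegral_of_nonneg_ae (ae_of_all _ fun ω => sq_nonneg _)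
      (by fun_prop)]
    refine ENNReal.toReal_le_of_le_ofReal hpos (le_trans ?_ hc)
    refine lintegral_mono fun ω => ?_
    rw [enorm_rpow_eq _ (by norm_num)]
    apply ENNReal.ofReal_le_ofReal
    rw [← sq_abs, Real.rpow_two]
    exact pow_le_pow_left₀ (abs_nonneg _) (Complex.abs_re_le_norm _) 2
  -- quadratic part
  set Q1 : Ω → ℝ≥0∞ := fun ω => if 2 < p then ∫⁻ x, ‖s x‖ₑ ^ (p - 2) * ‖ζ ω x‖ₑ ^ (2 : ℝ) ∂ν else 0
    with hQ1
  have hQ1m : Measurable Q1 := by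
    simp only [hQ1]
    split_ifs
    · apply Measurable.lintegral_prod_right'
        (f := fun z : Ω × X => ‖s z.2‖ₑ ^ (p - 2) * ‖ζ z.1 z.2‖ₑ ^ (2 : ℝ))
      exact ((hs.comp measurable_snd).enorm.pow_const _).mul (H.meas.enorm.pow_const _)
    · exact measurable_const
  set Q2 : Ω → ℝ≥0∞ := fun ω => Fp ν p (ζ ω) with hQ2
  have hQ2m : Measurable Q2 := by
    simp only [hQ2, Fp]
    apply Measurable.lintegral_prod_right' (f := fun z : Ω × X => ‖ζ z.1 z.2‖ₑ ^ p)
    exact H.meas.enorm.pow_const _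
  have hholder : 2 < p → ∀ w : X → ℝ≥0∞, Measurable w →
      ∫⁻ x, ‖s x‖ₑ ^ (p - 2) * w x ∂ν ≤
        ENNReal.ofReal (F ^ ((p - 2) / p)) * (∫⁻ x, w x ^ (p / 2) ∂ν) ^ (2 / p) := by
    intro h2p w hw
    have hp2 : 0 < p - 2 := by linarith
    have hpq2 : (p / (p - 2)).HolderConjugate (p / 2) := by
      rw [Real.holderConjugate_iff]
      constructor
      · rw [lt_div_iff₀ hp2]; linarith
      · field_simp; ring
    have := ENNReal.lintegral_mul_le_Lp_mul_Lq ν hpq2 (f := fun x => ‖s x‖ₑ ^ (p - 2))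
      (g := w) (hs.enorm.pow_const _).aemeasurable hw.aemeasurable
    simp only [Pi.mul_apply] at this
    refine this.trans (le_of_eq ?_)
    have e1 : ∫⁻ x, (‖s x‖ₑ ^ (p - 2)) ^ (p / (p - 2)) ∂ν = ENNReal.ofReal F := by
      rw [← hFe]; unfold Fp
      congr 1; ext x
      rw [← ENNReal.rpow_mul]; congr 1; field_simp
    rw [e1, ENNReal.ofReal_rpow_of_nonneg hF0 (by positivity)]
    have e2 : 1 / (p / (p - 2)) = (p - 2) / p := by field_simp
    have e3 : 1 / (p / 2) = 2 / p := by field_simp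
    rw [e2, e3]
  have hζ2p : ∀ ω, (∫⁻ x, (‖ζ ω x‖ₑ ^ (2 : ℝ)) ^ (p / 2) ∂ν) ^ (2 / p) ≤ ENNReal.ofReal (B ^ 2) := by
    intro ω
    calc _ = (Fp ν p (ζ ω)) ^ (2 / p) := by
          unfold Fp; congr 2; ext x; rw [← ENNReal.rpow_mul]; congr 1; ring
      _ ≤ (ENNReal.ofReal (B ^ p)) ^ (2 / p) := by gcongr; exact H.hB ω
      _ = _ := by
        rw [ENNReal.ofReal_rpow_of_nonneg (by positivity) (by positivity), ← Real.rpow_mul hB0]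
        congr 1
        rw [← Real.rpow_two]; congr 1; field_simp
  have hQ1b : ∀ ω, Q1 ω ≤ ENNReal.ofReal (G * β ^ 2) := fun ω => by
    simp only [hQ1]
    split_ifs with h2p
    · refine (hholder h2p _ ((hζm ω).enorm.pow_const _)).trans ?_
      calc _ ≤ ENNReal.ofReal (F ^ ((p - 2) / p)) * ENNReal.ofReal (B ^ 2) := by
            gcongr; exact hζ2p ω
        _ = ENNReal.ofReal (F ^ ((p - 2) / p) * B ^ 2) := by
            rw [← ENNReal.ofReal_mul (by positivity)]
        _ ≤ _ := by
            apply ENNReal.ofReal_le_ofReal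
            have : F ^ ((p - 2) / p) * B ^ 2 = F ^ ((p - 2) / p) * R ^ 2 * β ^ 2 := by
              rw [hβ]; field_simp
            rw [this]; gcongr; exact key2 h2p
    · exact zero_le
  have hQ2b : ∀ ω, Q2 ω ≤ ENNReal.ofReal (G * β ^ p) := fun ω => by
    refine (H.hB ω).trans (ENNReal.ofReal_le_ofReal ?_)
    have : B ^ p = R ^ p * β ^ p := by
      rw [← Real.mul_rpow hR.le hβ0, hβ]; congr 1; field_simp
    rw [this]; gcongr; linarith
  have hQ1i : ∫⁻ ω, Q1 ω ∂μ ≤ ENNReal.ofReal (G * (1 / N)) := by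
    by_cases h2p : 2 < p
    · simp only [hQ1, h2p, if_true]
      rw [lintegral_lintegral_swap]
      · have : ∀ x, ∫⁻ ω, ‖s x‖ₑ ^ (p - 2) * ‖ζ ω x‖ₑ ^ (2 : ℝ) ∂μ =
            ‖s x‖ₑ ^ (p - 2) * ∫⁻ ω, ‖ζ ω x‖ₑ ^ (2 : ℝ) ∂μ := fun x => by
          rw [lintegral_const_mul]
          exact ((H.meas.of_uncurry_right (y := x)).enorm.pow_const _)
        simp_rw [this]
        refine (hholder h2p _ ?_).trans ?_
        · apply Measurable.lintegral_prod_left' (f := fun z : Ω × X => ‖ζ z.1 z.2‖ₑ ^ (2 : ℝ))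
          exact H.meas.enorm.pow_const _
        · calc _ ≤ ENNReal.ofReal (F ^ ((p - 2) / p)) * (ENNReal.ofReal (v2 ^ (p / 2))) ^ (2 / p) := by
                gcongr; exact H.hv h2p
            _ = ENNReal.ofReal (F ^ ((p - 2) / p) * v2) := by
                have hv0 := H.hv0
                rw [ENNReal.ofReal_rpow_of_nonneg (by positivity) (by positivity),
                  ← Real.rpow_mul H.hv0, ← ENNReal.ofReal_mul (by positivity)]
                have : p / 2 * (2 / p) = 1 := by field_simp
                rw [this, Real.rpow_one]
            _ ≤ _ := by
                apply ENNReal.ofReal_le_ofReal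
                have e1 : v2 ≤ R ^ 2 * (1 / N) := by
                  rw [mul_one_div, le_div_iff₀ (by linarith)]; linarith [h2 h2p]
                calc F ^ ((p - 2) / p) * v2 ≤ F ^ ((p - 2) / p) * (R ^ 2 * (1 / N)) := by gcongr
                  _ = F ^ ((p - 2) / p) * R ^ 2 * (1 / N) := by ring
                  _ ≤ _ := by
                    have : 0 ≤ 1 / N := by positivity
                    gcongr; exact key2 h2p
      · exact (((hs.comp measurable_snd).enorm.pow_const _).mul
          (H.meas.enorm.pow_const _)).aemeasurable
    · simp only [hQ1, h2p, if_false]; simp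
  have hQ1f : ∀ ω, Q1 ω ≠ ⊤ := fun ω => ((hQ1b ω).trans_lt ENNReal.ofReal_lt_top).ne
  have hQ2f : ∀ ω, Q2 ω ≠ ⊤ := fun ω => ((hQ2b ω).trans_lt ENNReal.ofReal_lt_top).ne
  set a : Ω → ℝ := fun ω => ell ω / G with ha
  set b : Ω → ℝ := fun ω => ((Q1 ω).toReal + (Q2 ω).toReal) / G with hb
  have hbm : Measurable b := (hQ1m.ennreal_toReal.add hQ2m.ennreal_toReal).div_const _
  have key3 : F ^ ((p - 1) / p) * B ≤ G * β := by
    have : F ^ ((p - 1) / p) * B = F ^ ((p - 1) / p) * R * β := by rw [hβ]; field_simp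
    rw [this]; gcongr
  have hQ1r : ∀ ω, (Q1 ω).toReal ≤ G * β ^ 2 := fun ω =>
    ENNReal.toReal_le_of_le_ofReal (by positivity) (hQ1b ω)
  have hQ2r : ∀ ω, (Q2 ω).toReal ≤ G * β ^ p := fun ω =>
    ENNReal.toReal_le_of_le_ofReal (by positivity) (hQ2b ω)
  have hQ1int : Integrable (fun ω => (Q1 ω).toReal) μ :=
    Integrable.of_bound hQ1m.ennreal_toReal.aestronglyMeasurable _ (ae_of_all _ fun ω => by
      rw [Real.norm_of_nonneg ENNReal.toReal_nonneg]; exact hQ1r ω)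
  have hQ2int : Integrable (fun ω => (Q2 ω).toReal) μ :=
    Integrable.of_bound hQ2m.ennreal_toReal.aestronglyMeasurable _ (ae_of_all _ fun ω => by
      rw [Real.norm_of_nonneg ENNReal.toReal_nonneg]; exact hQ2r ω)
  have main := scalar_step μ p C c0 M N β (σ2 / R ^ 2) hp0 (by linarith) hM (by linarith) hβ0 a b
    (hellm.div_const _) hbm
    (fun ω => by
      simp only [ha]
      rw [abs_div, abs_of_pos hGpos, div_le_iff₀ hGpos, mul_comm]
      exact (hellb ω).trans key3)
    (by simp only [ha]; rw [integral_div, hell0, zero_div])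
    (by
      simp only [ha, div_pow]
      rw [integral_div, div_le_div_iff₀ (by positivity) (by positivity)]
      have e1 : F ^ (2 * (p - 1) / p) = (F ^ ((p - 1) / p)) ^ 2 := by
        rw [← Real.rpow_natCast, ← Real.rpow_mul hF0]; congr 1; push_cast; ring
      calc (∫ ω, ell ω ^ 2 ∂μ) * R ^ 2 ≤ σ2 * F ^ (2 * (p - 1) / p) * R ^ 2 := by gcongr
        _ = σ2 * (F ^ ((p - 1) / p) * R) ^ 2 := by rw [e1]; ring
        _ ≤ σ2 * G ^ 2 := by
          have := H.hσ0
          gcongr)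
    (fun ω => by simp only [hb]; positivity)
    (fun ω => by
      simp only [hb]
      rw [div_le_iff₀ hGpos]
      have e1 : β ^ 2 ≤ β := by nlinarith
      calc _ ≤ G * β ^ 2 + G * β ^ p := add_le_add (hQ1r ω) (hQ2r ω)
        _ ≤ G * β + G * β := by gcongr
        _ = _ := by ring)
    (by
      simp only [hb]
      rw [integral_div, integral_add hQ1int hQ2int, div_le_iff₀ hGpos]
      have e1 : ∫ ω, (Q1 ω).toReal ∂μ ≤ G * (1 / N) := by
        rw [integral_toReal hQ1m.aemeasurable (ae_of_all _ fun ω => (hQ1f ω).lt_top)]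
        exact ENNReal.toReal_le_of_le_ofReal (by positivity) hQ1i
      have e2 : ∫ ω, (Q2 ω).toReal ∂μ ≤ G * (1 / N) := by
        calc _ ≤ ∫ _ω, G * (1 / N) ∂μ := integral_mono hQ2int (integrable_const _) fun ω =>
              (hQ2r ω).trans (by gcongr)
          _ = _ := by simp
      calc _ ≤ G * (1 / N) + G * (1 / N) := add_le_add e1 e2
        _ = _ := by ring)
    h3 h4
  -- pointwise
  have hpt : ∀ ω, 0 ≤ F + p * ell ω + C * ((Q1 ω).toReal + (Q2 ω).toReal) ∧ Fp ν p (s + ζ ω) ≤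
      ENNReal.ofReal (F + p * ell ω + C * ((Q1 ω).toReal + (Q2 ω).toReal)) := by
    intro ω
    have hsi : Integrable (fun x => ‖s x‖ ^ p) ν := by
      refine ⟨(hs.norm.pow_const _).aestronglyMeasurable, ?_⟩
      have : ∫⁻ x, ‖‖s x‖ ^ p‖ₑ ∂ν = Fp ν p s := by
        unfold Fp; congr 1; ext x
        rw [enorm_rpow_eq _ hp0.le, Real.enorm_eq_ofReal (by positivity)]
      unfold HasFiniteIntegral; rw [this]; exact hsF.lt_top
    have hzi : Integrable (fun x => ‖ζ ω x‖ ^ p) ν := by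
      refine ⟨((hζm ω).norm.pow_const _).aestronglyMeasurable, ?_⟩
      have : ∫⁻ x, ‖‖ζ ω x‖ ^ p‖ₑ ∂ν = Fp ν p (ζ ω) := by
        unfold Fp; congr 1; ext x
        rw [enorm_rpow_eq _ hp0.le, Real.enorm_eq_ofReal (by positivity)]
      unfold HasFiniteIntegral; rw [this]; exact (hQ2f ω).lt_top
    have hrei : Integrable (fun x => (g x * ζ ω x).re) ν := (hgζi ω).re
    set qf : X → ℝ := fun x => if 2 < p then ‖s x‖ ^ (p - 2) * ‖ζ ω x‖ ^ 2 else 0 with hqf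
    have hqe : ∫⁻ x, ENNReal.ofReal (qf x) ∂ν = Q1 ω := by
      simp only [hqf, hQ1]
      split_ifs with h2p
      · congr 1; ext x
        rw [ENNReal.ofReal_mul (by positivity), enorm_rpow_eq _ (by linarith),
          enorm_rpow_eq _ (by norm_num), Real.rpow_two]
      · simp
    have hq0 : ∀ x, 0 ≤ qf x := fun x => by simp only [hqf]; split_ifs <;> positivity
    have hqm : Measurable qf := by
      simp only [hqf]; split_ifs
      · exact (hs.norm.pow_const _).mul ((hζm ω).norm.pow_const _)
      · exact measurable_const
    have hqi : Integrable qf ν := by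
      refine ⟨hqm.aestronglyMeasurable, ?_⟩
      unfold HasFiniteIntegral
      have : ∫⁻ x, ‖qf x‖ₑ ∂ν = Q1 ω := by
        rw [← hqe]; congr 1; ext x; rw [Real.enorm_eq_ofReal (hq0 x)]
      rw [this]; exact (hQ1f ω).lt_top
    have hqv : ∫ x, qf x ∂ν = (Q1 ω).toReal := by
      rw [integral_eq_lintegral_of_nonneg_ae (ae_of_all _ hq0) hqm.aestronglyMeasurable, hqe]
    have hsv : ∫ x, ‖s x‖ ^ p ∂ν = F := by
      rw [integral_eq_lintegral_of_nonneg_ae (ae_of_all _ fun x => by positivity)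
        hsi.aestronglyMeasurable, hF]
      unfold Fp; congr 2; ext x; rw [enorm_rpow_eq _ hp0.le]
    have hzv : ∫ x, ‖ζ ω x‖ ^ p ∂ν = (Q2 ω).toReal := by
      rw [integral_eq_lintegral_of_nonneg_ae (ae_of_all _ fun x => by positivity)
        hzi.aestronglyMeasurable, hQ2]
      unfold Fp; congr 2; ext x; rw [enorm_rpow_eq _ hp0.le]
    have hrev : ∫ x, (g x * ζ ω x).re ∂ν = ell ω := by
      have := integral_re (𝕜 := ℂ) (hgζi ω)
      simpa using this
    have hrhs : Integrable (fun x => ‖s x‖ ^ p + p * (g x * ζ ω x).re + C * (qf x + ‖ζ ω x‖ ^ p)) ν :=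
      (hsi.add (hrei.const_mul p)).add ((hqi.add hzi).const_mul C)
    have hle : ∀ x, ‖(s + ζ ω) x‖ ^ p ≤
        ‖s x‖ ^ p + p * (g x * ζ ω x).re + C * (qf x + ‖ζ ω x‖ ^ p) := fun x => hC (s x) (ζ ω x)
    have hval : ∫ x, (‖s x‖ ^ p + p * (g x * ζ ω x).re + C * (qf x + ‖ζ ω x‖ ^ p)) ∂ν =
        F + p * ell ω + C * ((Q1 ω).toReal + (Q2 ω).toReal) := by
      have i1 : Integrable (fun x => ‖s x‖ ^ p + p * (g x * ζ ω x).re) ν :=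
        hsi.add (hrei.const_mul p)
      have i2 : Integrable (fun x => qf x + ‖ζ ω x‖ ^ p) ν := hqi.add hzi
      rw [integral_add i1 (i2.const_mul C), integral_add hsi (hrei.const_mul p),
        integral_const_mul, integral_const_mul, integral_add hqi hzi, hsv, hrev, hqv, hzv]
    refine ⟨by rw [← hval]; exact integral_nonneg fun x => le_trans (by positivity) (hle x), ?_⟩
    rw [← hval, ofReal_integral_eq_lintegral_ofReal hrhs
      (ae_of_all _ fun x => le_trans (by positivity) (hle x))]
    unfold Fp
    refine lintegral_mono fun x => ?_
    rw [enorm_rpow_eq _ hp0.le]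
    exact ENNReal.ofReal_le_ofReal (hle x)
  have hptM : ∀ ω, (Fp ν p (s + ζ ω) + ENNReal.ofReal (R ^ p)) ^ M ≤
      ENNReal.ofReal (G ^ M) * ENNReal.ofReal (Real.exp (M * (p * a ω + C * b ω))) := by
    intro ω
    have e0 : F + p * ell ω + C * ((Q1 ω).toReal + (Q2 ω).toReal) + R ^ p ≤
        G * Real.exp (p * a ω + C * b ω) := by
      have : F + p * ell ω + C * ((Q1 ω).toReal + (Q2 ω).toReal) + R ^ p =
        G * ((p * a ω + C * b ω) + 1) := by
        simp only [ha, hb]; field_simp; rw [hG]; ring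
      rw [this]
      exact mul_le_mul_of_nonneg_left (Real.add_one_le_exp _) hGpos.le
    have e1 : Fp ν p (s + ζ ω) + ENNReal.ofReal (R ^ p) ≤
        ENNReal.ofReal (G * Real.exp (p * a ω + C * b ω)) := by
      calc _ ≤ ENNReal.ofReal (F + p * ell ω + C * ((Q1 ω).toReal + (Q2 ω).toReal)) +
              ENNReal.ofReal (R ^ p) := by gcongr; exact (hpt ω).2
          _ = ENNReal.ofReal (F + p * ell ω + C * ((Q1 ω).toReal + (Q2 ω).toReal) + R ^ p) :=
              (ENNReal.ofReal_add (hpt ω).1 hRp.le).symm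
          _ ≤ _ := ENNReal.ofReal_le_ofReal e0
    calc _ ≤ (ENNReal.ofReal (G * Real.exp (p * a ω + C * b ω))) ^ M := by gcongr
      _ = _ := by
        rw [ENNReal.ofReal_rpow_of_nonneg (by positivity) hM, Real.mul_rpow hGpos.le (by positivity),
          ← Real.exp_mul, ENNReal.ofReal_mul (by positivity)]
        congr 3; ring
  calc _ ≤ ∫⁻ ω, ENNReal.ofReal (G ^ M) * ENNReal.ofReal (Real.exp (M * (p * a ω + C * b ω))) ∂μ :=
        lintegral_mono hptM
    _ = ENNReal.ofReal (G ^ M) * ENNReal.ofReal (∫ ω, Real.exp (M * (p * a ω + C * b ω)) ∂μ) := by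
        rw [lintegral_const_mul _ (by fun_prop), ofReal_integral_eq_lintegral_ofReal main.1
          (ae_of_all _ fun ω => (Real.exp_pos _).le)]
    _ ≤ _ := by
        rw [mul_comm]
        gcongr
        · exact main.2
        rw [hFe, ← ENNReal.ofReal_add hF0 hRp.le, ← ENNReal.ofReal_rpow_of_nonneg hGpos.le hM]

lemma Fp_add_ne_top {X : Type*} [MeasurableSpace X] (ν : Measure X) {p : ℝ} (hp : 1 < p)
    {s t : X → ℂ} (hs : Measurable s) (hsF : Fp ν p s ≠ ⊤) (htF : Fp ν p t ≠ ⊤) :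
    Fp ν p (s + t) ≠ ⊤ := by
  have hp0 : 0 ≤ p := by linarith
  refine ne_top_of_le_ne_top (b := 2 ^ (p - 1) * (Fp ν p s + Fp ν p t)) ?_ ?_
  · refine ENNReal.mul_ne_top (ENNReal.rpow_ne_top_of_nonneg (by linarith) (by simp)) (by simp [*])
  · unfold Fp
    rw [← lintegral_add_left (hs.enorm.pow_const _), ← lintegral_const_mul' _ _
      (ENNReal.rpow_ne_top_of_nonneg (by linarith) (by simp))]
    refine lintegral_mono fun x => ?_
    refine le_trans ?_ (ENNReal.rpow_add_le_mul_rpow_add_rpow _ _ hp.le)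
    gcongr
    exact enorm_add_le _ _

set_option maxHeartbeats 400000 in
lemma iter_bound {X Ω : Type*} [MeasurableSpace X] [MeasurableSpace Ω] (ν : Measure X)
    [SFinite ν] (μ : Measure Ω) [IsProbabilityMeasure μ] (p : ℝ) (hp : 1 < p)
    (ζ : Ω → X → ℂ) (B σ2 v2 : ℝ) (H : CoreHyp ν μ p ζ B σ2 v2) (R M : ℝ) (E : ℝ≥0∞)
    (hstep : ∀ s : X → ℂ, Measurable s → Fp ν p s ≠ ⊤ →
      ∫⁻ ω, (Fp ν p (s + ζ ω) + ENNReal.ofReal (R ^ p)) ^ M ∂μ ≤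
        E * (Fp ν p s + ENNReal.ofReal (R ^ p)) ^ M) (n : ℕ) :
    ∀ s : X → ℂ, Measurable s → Fp ν p s ≠ ⊤ →
      ∫⁻ ω : Fin n → Ω, (Fp ν p (s + ∑ k, ζ (ω k)) + ENNReal.ofReal (R ^ p)) ^ M
        ∂(Measure.pi fun _ => μ) ≤ E ^ n * (Fp ν p s + ENNReal.ofReal (R ^ p)) ^ M := by
  induction n with
  | zero => intro s _ _; simp
  | succ n ih =>
    intro s hs hsF
    have hmp := measurePreserving_piFinSuccAbove (fun _ : Fin (n + 1) => μ) 0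
    have hzm : ∀ ω, Measurable (ζ ω) := fun ω => H.meas.of_uncurry_left
    have hζ : Measurable fun z : Ω × X => ζ z.1 z.2 := H.meas
    set Φ : Ω × (Fin n → Ω) → ℝ≥0∞ := fun z =>
      (Fp ν p (s + ζ z.1 + ∑ k, ζ (z.2 k)) + ENNReal.ofReal (R ^ p)) ^ M with hΦ
    have hΦm : Measurable Φ := by
      simp only [hΦ]
      refine Measurable.pow_const (Measurable.add_const ?_ _) _
      unfold Fp
      refine Measurable.lintegral_prod_right'
        (f := fun w : (Ω × (Fin n → Ω)) × X => ‖(s + ζ w.1.1 + ∑ k, ζ (w.1.2 k)) w.2‖ₑ ^ p) ?_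
      refine (Measurable.enorm ?_).pow_const _
      simp only [Pi.add_apply, Finset.sum_apply]
      have m1 : Measurable fun w : (Ω × (Fin n → Ω)) × X => s w.2 := hs.comp measurable_snd
      have m2 : Measurable fun w : (Ω × (Fin n → Ω)) × X => ζ w.1.1 w.2 := hζ.comp
        ((measurable_fst.comp measurable_fst).prodMk measurable_snd)
      have m3 : ∀ k, Measurable fun w : (Ω × (Fin n → Ω)) × X => ζ (w.1.2 k) w.2 := fun k =>
        hζ.comp (f := fun w : (Ω × (Fin n → Ω)) × X => (w.1.2 k, w.2))
          (((measurable_pi_apply k).comp (measurable_snd.comp measurable_fst)).prodMk measurable_snd)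
      exact (m1.add m2).add (Finset.measurable_sum _ fun k _ => m3 k)
    have e1 : ∫⁻ ω : Fin (n + 1) → Ω, (Fp ν p (s + ∑ k, ζ (ω k)) + ENNReal.ofReal (R ^ p)) ^ M
        ∂(Measure.pi fun _ => μ) = ∫⁻ z, Φ z ∂(μ.prod (Measure.pi fun _ => μ)) := by
      rw [← hmp.lintegral_comp hΦm]
      congr 1; ext ω
      simp only [hΦ, Fin.sum_univ_succ, add_assoc]
      rfl
    rw [e1, lintegral_prod _ hΦm.aemeasurable]
    calc _ ≤ ∫⁻ ω, E ^ n * (Fp ν p (s + ζ ω) + ENNReal.ofReal (R ^ p)) ^ M ∂μ := by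
          refine lintegral_mono fun ω => ?_
          have h1 : Fp ν p (s + ζ ω) ≠ ⊤ :=
            Fp_add_ne_top ν hp hs hsF ((H.hB ω).trans_lt ENNReal.ofReal_lt_top).ne
          have h2 := ih (s + ζ ω) (hs.add (hzm ω)) h1
          simp only [hΦ]
          exact h2
      _ = E ^ n * ∫⁻ ω, (Fp ν p (s + ζ ω) + ENNReal.ofReal (R ^ p)) ^ M ∂μ := by
          rw [lintegral_const_mul]
          refine Measurable.pow_const (Measurable.add_const ?_ _) _
          unfold Fp
          refine Measurable.lintegral_prod_right'
            (f := fun w : Ω × X => ‖(s + ζ w.1) w.2‖ₑ ^ p) ?_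
          refine (Measurable.enorm ?_).pow_const _
          have m1 : Measurable fun w : Ω × X => s w.2 := hs.comp measurable_snd
          exact m1.add hζ
      _ ≤ E ^ n * (E * (Fp ν p s + ENNReal.ofReal (R ^ p)) ^ M) := by
          exact mul_le_mul' le_rfl (hstep s hs hsF)
      _ = _ := by rw [pow_succ, mul_assoc]

/-- the core moment inequality -/
lemma core_moment (p c0 : ℝ) (hp : 1 < p) : ∃ c : ℝ, ∀ {X Ω : Type} [MeasurableSpace X]
    [MeasurableSpace Ω] (ν : Measure X) [SFinite ν] (μ : Measure Ω) [IsProbabilityMeasure μ]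
    (ζ : Ω → X → ℂ) (B σ2 v2 : ℝ) (_ : CoreHyp ν μ p ζ B σ2 v2)
    (R M : ℝ) (n : ℕ) (_ : 0 < R) (_ : 0 ≤ M) (_ : 1 ≤ n)
    (_ : n * B ^ p ≤ R ^ p) (_ : 2 < p → n * v2 ≤ R ^ 2) (_ : M * (B / R) ≤ c0)
    (_ : M * (σ2 / R ^ 2) ≤ c0 / n),
    ∫⁻ ω : Fin n → Ω, (Fp ν p (∑ k, ζ (ω k))) ^ M ∂(Measure.pi fun _ => μ) ≤
      ENNReal.ofReal (R ^ (p * M) * Real.exp (c * M)) := by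
  obtain ⟨C, hC1, hC⟩ := pow_ineq p hp
  refine ⟨2 * C + Real.exp (c0 * (p + 2 * C)) * (2 * p ^ 2 * c0 + 8 * C ^ 2 * c0), ?_⟩
  intro X Ω _ _ ν _ μ _ ζ B σ2 v2 H R M n hR hM hn h1 h2 h3 h4
  have hn' : (1 : ℝ) ≤ n := by exact_mod_cast hn
  have hst := fun s hs hsF => step_bound ν μ p C hp hC1 hC ζ B σ2 v2 H R M n c0 hR hM hn' h1 h2 h3 h4
    s hs hsF
  have hit := iter_bound ν μ p hp ζ B σ2 v2 H R M _ hst n 0 measurable_zero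
    (by unfold Fp; simp [ENNReal.zero_rpow_of_pos (by linarith : 0 < p)])
  have h0 : Fp ν p (0 : X → ℂ) = 0 := by
    unfold Fp; simp [ENNReal.zero_rpow_of_pos (by linarith : 0 < p)]
  rw [h0, zero_add] at hit
  calc _ ≤ _ := lintegral_mono fun ω => by
        show _ ≤ (Fp ν p (0 + ∑ k, ζ (ω k)) + ENNReal.ofReal (R ^ p)) ^ M
        rw [zero_add]; gcongr; exact le_self_add
    _ ≤ _ := hit
    _ = _ := by
      rw [ENNReal.ofReal_rpow_of_nonneg (by positivity) hM, ← Real.rpow_mul hR.le,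
        ← ENNReal.ofReal_pow (Real.exp_pos _).le, ← Real.exp_nat_mul,
        ← ENNReal.ofReal_mul (Real.exp_pos _).le, mul_comm]
      congr 3
      field_simp

end

section

lemma jensen_lint {Ω : Type*} [MeasurableSpace Ω] (μ : Measure Ω) [IsProbabilityMeasure μ]
    {p : ℝ} (hp : 1 ≤ p) {f : Ω → ℝ≥0∞} (hf : AEMeasurable f μ) :
    (∫⁻ ω, f ω ∂μ) ^ p ≤ ∫⁻ ω, f ω ^ p ∂μ := by
  have h := eLpNorm'_le_eLpNorm'_of_exponent_le (p := 1) (q := p) one_pos hp μ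
    (f := f) hf.aestronglyMeasurable
  simp only [eLpNorm', enorm_eq_self, ENNReal.rpow_one, one_div, inv_one] at h
  calc _ ≤ ((∫⁻ ω, f ω ^ p ∂μ) ^ p⁻¹) ^ p := by gcongr
    _ = _ := by rw [← ENNReal.rpow_mul, inv_mul_cancel₀ (by linarith), ENNReal.rpow_one]

lemma enorm_sub_rpow_le (a b : ℂ) {p : ℝ} (hp : 1 ≤ p) :
    ‖a - b‖ₑ ^ p ≤ 2 ^ (p - 1) * (‖a‖ₑ ^ p + ‖b‖ₑ ^ p) :=
  le_trans (by gcongr; exact enorm_sub_le) (ENNReal.rpow_add_le_mul_rpow_add_rpow _ _ hp)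

lemma enorm_sub_sq_le (a b : ℂ) : ‖a - b‖ₑ ^ (2:ℝ) ≤ 2 * (‖a‖ₑ ^ (2:ℝ) + ‖b‖ₑ ^ (2:ℝ)) := by
  have := enorm_sub_rpow_le a b (p := 2) (by norm_num)
  norm_num at this ⊢; exact this

lemma core_center {X Ω : Type*} [MeasurableSpace X] [MeasurableSpace Ω] (ν : Measure X)
    [SFinite ν] (μ : Measure Ω) [IsProbabilityMeasure μ] (p : ℝ) (hp : 1 < p)
    (ζ : Ω → X → ℂ) (b σ v : ℝ) (hm : Measurable (Function.uncurry ζ))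
    (hb0 : 0 ≤ b) (hσ0 : 0 ≤ σ) (hv0 : 0 ≤ v)
    (hb : ∀ ω, Fp ν p (ζ ω) ≤ ENNReal.ofReal (b ^ p)) (hi : ∀ x, Integrable (fun ω => ζ ω x) μ)
    (hσ : ∀ g : X → ℂ, Measurable g → ∫⁻ x, ‖g x‖ₑ ^ (p / (p - 1)) ∂ν ≠ ⊤ →
      ∫⁻ ω, ‖∫ x, g x * ζ ω x ∂ν‖ₑ ^ (2 : ℝ) ∂μ ≤
        ENNReal.ofReal σ * (∫⁻ x, ‖g x‖ₑ ^ (p / (p - 1)) ∂ν) ^ (2 * (p - 1) / p))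
    (hv : 2 < p → ∫⁻ x, (∫⁻ ω, ‖ζ ω x‖ₑ ^ (2 : ℝ) ∂μ) ^ (p / 2) ∂ν ≤ ENNReal.ofReal (v ^ (p / 2))) :
    CoreHyp ν μ p (fun ω x => ζ ω x - ∫ ω', ζ ω' x ∂μ) (2 * b) (4 * σ) (4 * v) := by
  have hp0 : 0 < p := by linarith
  have hp1 : 0 < p - 1 := by linarith
  have hζ : Measurable fun z : Ω × X => ζ z.1 z.2 := hm
  have hζ1 : ∀ ω, Measurable (ζ ω) := fun ω => hm.of_uncurry_left
  have hζ2 : ∀ x, Measurable (fun ω => ζ ω x) := fun x => hm.of_uncurry_right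
  set m : X → ℂ := fun x => ∫ ω', ζ ω' x ∂μ with hmdef
  have hmm : Measurable m := (StronglyMeasurable.integral_prod_left' (μ := μ)
    hζ.stronglyMeasurable).measurable
  have hmr : ∀ x (q : ℝ), 1 ≤ q → ‖m x‖ₑ ^ q ≤ ∫⁻ ω, ‖ζ ω x‖ₑ ^ q ∂μ := fun x q hq =>
    le_trans (by gcongr; exact enorm_integral_le_lintegral_enorm _)
      (jensen_lint μ hq (hζ2 x).enorm.aemeasurable)
  have hmF : Fp ν p m ≤ ENNReal.ofReal (b ^ p) := by
    calc Fp ν p m ≤ ∫⁻ x, ∫⁻ ω, ‖ζ ω x‖ₑ ^ p ∂μ ∂ν := lintegral_mono fun x => hmr x p hp.le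
      _ = ∫⁻ ω, ∫⁻ x, ‖ζ ω x‖ₑ ^ p ∂ν ∂μ :=
          (lintegral_lintegral_swap (hζ.enorm.pow_const p).aemeasurable).symm
      _ ≤ ∫⁻ ω, ENNReal.ofReal (b ^ p) ∂μ := lintegral_mono hb
      _ = _ := by simp
  have hpq : (p / (p - 1)).HolderConjugate p := by
    rw [Real.holderConjugate_iff]
    constructor
    · rw [lt_div_iff₀ hp1]; linarith
    · field_simp; ring
  refine ⟨?_, by positivity, by positivity, by positivity, ?_, ?_, ?_, ?_⟩
  · exact hζ.sub (hmm.comp measurable_snd)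
  · intro ω
    calc Fp ν p (fun x => ζ ω x - m x) ≤ ∫⁻ x, 2 ^ (p - 1) * (‖ζ ω x‖ₑ ^ p + ‖m x‖ₑ ^ p) ∂ν :=
          lintegral_mono fun x => enorm_sub_rpow_le _ _ hp.le
      _ = 2 ^ (p - 1) * (Fp ν p (ζ ω) + Fp ν p m) := by
          rw [lintegral_const_mul' _ _ (ENNReal.rpow_ne_top_of_nonneg hp1.le (by simp)),
            lintegral_add_left ((hζ1 ω).enorm.pow_const _)]; rfl
      _ ≤ 2 ^ (p - 1) * (ENNReal.ofReal (b ^ p) + ENNReal.ofReal (b ^ p)) := by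
          gcongr; exact hb ω
      _ = 2 ^ (p - 1) * 2 ^ (1 : ℝ) * ENNReal.ofReal (b ^ p) := by
          rw [ENNReal.rpow_one]; ring
      _ = ENNReal.ofReal ((2 * b) ^ p) := by
          rw [← ENNReal.rpow_add _ _ (by simp) (by simp), Real.mul_rpow (by norm_num) hb0,
            ENNReal.ofReal_mul (by positivity),
            ← ENNReal.ofReal_rpow_of_pos (show (0:ℝ) < 2 by norm_num)]
          simp
  · intro x
    rw [integral_sub (hi x) (integrable_const _)]; simp [hmdef]
  · intro g hg hgF
    have hol : ∀ w : X → ℂ, Measurable w → Fp ν p w ≤ ENNReal.ofReal (b ^ p) →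
        ∫⁻ x, ‖g x * w x‖ₑ ∂ν ≤ (∫⁻ x, ‖g x‖ₑ ^ (p / (p - 1)) ∂ν) ^ (1 / (p / (p - 1))) *
          (ENNReal.ofReal (b ^ p)) ^ (1 / p) := by
      intro w hw hwF
      have := ENNReal.lintegral_mul_le_Lp_mul_Lq ν hpq (f := fun x => ‖g x‖ₑ)
        (g := fun x => ‖w x‖ₑ) hg.enorm.aemeasurable hw.enorm.aemeasurable
      simp only [Pi.mul_apply] at this
      simp_rw [enorm_mul]
      refine this.trans ?_
      gcongr; exact hwF
    set T := (∫⁻ x, ‖g x‖ₑ ^ (p / (p - 1)) ∂ν) ^ (1 / (p / (p - 1))) *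
          (ENNReal.ofReal (b ^ p)) ^ (1 / p) with hT
    have hTf : T < ⊤ := ENNReal.mul_lt_top
      (ENNReal.rpow_lt_top_of_nonneg (by positivity) hgF)
      (ENNReal.rpow_lt_top_of_nonneg (by positivity) (by simp))
    have hgi : ∀ w : X → ℂ, Measurable w → Fp ν p w ≤ ENNReal.ofReal (b ^ p) →
        Integrable (fun x => g x * w x) ν := fun w hw hwF =>
      ⟨(hg.mul hw).aestronglyMeasurable, (hol w hw hwF).trans_lt hTf⟩
    have hjm : Measurable fun z : Ω × X => g z.2 * ζ z.1 z.2 := (hg.comp measurable_snd).mul hζ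
    have hpi : Integrable (fun z : Ω × X => g z.2 * ζ z.1 z.2) (μ.prod ν) := by
      refine ⟨hjm.aestronglyMeasurable, ?_⟩
      unfold HasFiniteIntegral
      rw [lintegral_prod _ hjm.enorm.aemeasurable]
      calc _ ≤ ∫⁻ ω, T ∂μ := lintegral_mono fun ω => hol _ (hζ1 ω) (hb ω)
        _ < ⊤ := by simpa using hTf
    set Z : Ω → ℂ := fun ω => ∫ x, g x * ζ ω x ∂ν with hZ
    have hZm : Measurable Z :=
      (StronglyMeasurable.integral_prod_right' (ν := ν) hjm.stronglyMeasurable).measurable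
    have hEZ : ∫ x, g x * m x ∂ν = ∫ ω, Z ω ∂μ := by
      simp only [hZ]
      rw [integral_integral_swap hpi]
      congr 1; ext x; rw [integral_const_mul]
    have hsub : ∀ ω, ∫ x, g x * (ζ ω x - m x) ∂ν = Z ω - ∫ ω', Z ω' ∂μ := fun ω => by
      rw [← hEZ, ← integral_sub (hgi _ (hζ1 ω) (hb ω)) (hgi _ hmm hmF)]
      congr 1; ext x; ring
    change ∫⁻ ω, ‖∫ x, g x * (ζ ω x - m x) ∂ν‖ₑ ^ (2:ℝ) ∂μ ≤ _
    simp_rw [hsub]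
    have hEZ2 : ‖∫ ω', Z ω' ∂μ‖ₑ ^ (2:ℝ) ≤ ∫⁻ ω, ‖Z ω‖ₑ ^ (2:ℝ) ∂μ :=
      le_trans (by gcongr; exact enorm_integral_le_lintegral_enorm _)
        (jensen_lint μ (by norm_num) hZm.enorm.aemeasurable)
    calc ∫⁻ ω, ‖Z ω - ∫ ω', Z ω' ∂μ‖ₑ ^ (2:ℝ) ∂μ
        ≤ ∫⁻ ω, 2 * (‖Z ω‖ₑ ^ (2:ℝ) + ‖∫ ω', Z ω' ∂μ‖ₑ ^ (2:ℝ)) ∂μ :=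
          lintegral_mono fun ω => enorm_sub_sq_le _ _
      _ = 2 * (∫⁻ ω, ‖Z ω‖ₑ ^ (2:ℝ) ∂μ + ‖∫ ω', Z ω' ∂μ‖ₑ ^ (2:ℝ)) := by
          rw [lintegral_const_mul' _ _ (by simp), lintegral_add_right _ measurable_const]; simp
      _ ≤ 2 * (∫⁻ ω, ‖Z ω‖ₑ ^ (2:ℝ) ∂μ + ∫⁻ ω, ‖Z ω‖ₑ ^ (2:ℝ) ∂μ) := by gcongr
      _ = 4 * ∫⁻ ω, ‖Z ω‖ₑ ^ (2:ℝ) ∂μ := by ring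
      _ ≤ 4 * (ENNReal.ofReal σ * (∫⁻ x, ‖g x‖ₑ ^ (p / (p - 1)) ∂ν) ^ (2 * (p - 1) / p)) := by
          gcongr; exact hσ g hg hgF
      _ = _ := by rw [ENNReal.ofReal_mul (by norm_num)]; simp [mul_assoc]
  · intro h2p
    have h1 : ∀ x, ∫⁻ ω, ‖ζ ω x - m x‖ₑ ^ (2:ℝ) ∂μ ≤ 4 * ∫⁻ ω, ‖ζ ω x‖ₑ ^ (2:ℝ) ∂μ := fun x => by
      calc _ ≤ ∫⁻ ω, 2 * (‖ζ ω x‖ₑ ^ (2:ℝ) + ‖m x‖ₑ ^ (2:ℝ)) ∂μ :=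
            lintegral_mono fun ω => enorm_sub_sq_le _ _
        _ = 2 * (∫⁻ ω, ‖ζ ω x‖ₑ ^ (2:ℝ) ∂μ + ‖m x‖ₑ ^ (2:ℝ)) := by
            rw [lintegral_const_mul' _ _ (by simp), lintegral_add_right _ measurable_const]; simp
        _ ≤ 2 * (∫⁻ ω, ‖ζ ω x‖ₑ ^ (2:ℝ) ∂μ + ∫⁻ ω, ‖ζ ω x‖ₑ ^ (2:ℝ) ∂μ) := by
            gcongr; exact hmr x 2 (by norm_num)
        _ = _ := by ring
    calc _ ≤ ∫⁻ x, (4 * ∫⁻ ω, ‖ζ ω x‖ₑ ^ (2:ℝ) ∂μ) ^ (p / 2) ∂ν := by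
          refine lintegral_mono fun x => ?_
          have := h1 x
          gcongr; 
      _ = 4 ^ (p / 2) * ∫⁻ x, (∫⁻ ω, ‖ζ ω x‖ₑ ^ (2:ℝ) ∂μ) ^ (p / 2) ∂ν := by
          simp_rw [ENNReal.mul_rpow_of_nonneg _ _ (by positivity : 0 ≤ p / 2)]
          rw [lintegral_const_mul' _ _ (ENNReal.rpow_ne_top_of_nonneg (by positivity) (by simp))]
      _ ≤ 4 ^ (p / 2) * ENNReal.ofReal (v ^ (p / 2)) := by gcongr; exact hv h2p
      _ = _ := by
          rw [Real.mul_rpow (by norm_num) hv0, ENNReal.ofReal_mul (by positivity),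
            ← ENNReal.ofReal_rpow_of_pos (show (0:ℝ) < 4 by norm_num)]; simp

/-- Hölder bound for the weak variance. -/
lemma sigma_holder {X Ω : Type*} [MeasurableSpace X] [MeasurableSpace Ω] (ν : Measure X)
    (μ : Measure Ω) [IsProbabilityMeasure μ] (p : ℝ) (hp : 1 < p)
    (ζ : Ω → X → ℂ) (b : ℝ) (hζ : ∀ ω, Measurable (ζ ω)) (hb0 : 0 ≤ b)
    (hb : ∀ ω, Fp ν p (ζ ω) ≤ ENNReal.ofReal (b ^ p)) (g : X → ℂ) (hg : Measurable g) :
      ∫⁻ ω, ‖∫ x, g x * ζ ω x ∂ν‖ₑ ^ (2 : ℝ) ∂μ ≤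
        ENNReal.ofReal (b ^ 2) * (∫⁻ x, ‖g x‖ₑ ^ (p / (p - 1)) ∂ν) ^ (2 * (p - 1) / p) := by
  have hp0 : 0 < p := by linarith
  have hp1 : 0 < p - 1 := by linarith
  have hpq : (p / (p - 1)).HolderConjugate p := by
    rw [Real.holderConjugate_iff]
    constructor
    · rw [lt_div_iff₀ hp1]; linarith
    · field_simp; ring
  set Q := ∫⁻ x, ‖g x‖ₑ ^ (p / (p - 1)) ∂ν
  have hol : ∀ ω, ‖∫ x, g x * ζ ω x ∂ν‖ₑ ^ (2:ℝ) ≤ ENNReal.ofReal (b ^ 2) * Q ^ (2 * (p - 1) / p) := by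
    intro ω
    have := ENNReal.lintegral_mul_le_Lp_mul_Lq ν hpq (f := fun x => ‖g x‖ₑ)
      (g := fun x => ‖ζ ω x‖ₑ) hg.enorm.aemeasurable (hζ ω).enorm.aemeasurable
    simp only [Pi.mul_apply] at this
    have h2 : ‖∫ x, g x * ζ ω x ∂ν‖ₑ ≤ Q ^ (1 / (p / (p - 1))) * (ENNReal.ofReal (b ^ p)) ^ (1 / p) := by
      refine (enorm_integral_le_lintegral_enorm _).trans ?_
      simp_rw [enorm_mul]
      refine this.trans ?_
      gcongr; exact hb ω
    calc _ ≤ (Q ^ (1 / (p / (p - 1))) * (ENNReal.ofReal (b ^ p)) ^ (1 / p)) ^ (2:ℝ) := by gcongr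
      _ = _ := by
        rw [ENNReal.mul_rpow_of_nonneg _ _ (by norm_num), ← ENNReal.rpow_mul, ← ENNReal.rpow_mul,
          ENNReal.ofReal_rpow_of_nonneg (by positivity) (by positivity), ← Real.rpow_mul hb0, mul_comm]
        congr 2
        · rw [← Real.rpow_two]; congr 1; field_simp
        · field_simp
  calc _ ≤ ∫⁻ _ω, ENNReal.ofReal (b ^ 2) * Q ^ (2 * (p - 1) / p) ∂μ := lintegral_mono hol
    _ = _ := by simp

end

section

/-- measure with density `f`. -/
def Pd {ι : Type} [Fintype ι] (f : (ι → ℝ) → ℝ) : Measure (ι → ℝ) :=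
  volume.withDensity fun x => ENNReal.ofReal (f x)

/-- restriction to coordinates in `I` -/
def res {d : ℕ} (I : Finset (Fin d)) (y : Fin d → ℝ) : I → ℝ := fun j => y ↑j

lemma res_meas {d : ℕ} (I : Finset (Fin d)) : Measurable (res I) := by unfold res; fun_prop

lemma IsDensity.int {ι : Type} [Fintype ι] {f : (ι → ℝ) → ℝ} (hf : IsDensity f) :
    Integrable f := integrable_of_integral_eq_one hf.2

lemma IsDensity.lint {ι : Type} [Fintype ι] {f : (ι → ℝ) → ℝ} (hf : IsDensity f) :
    ∫⁻ x, ENNReal.ofReal (f x) = 1 := by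
  rw [← ofReal_integral_eq_lintegral_ofReal hf.int (ae_of_all _ hf.1), hf.2, ENNReal.ofReal_one]

lemma IsDensity.prob {ι : Type} [Fintype ι] {f : (ι → ℝ) → ℝ} (hf : IsDensity f) :
    IsProbabilityMeasure (Pd f) :=
  ⟨by unfold Pd; rw [withDensity_apply _ MeasurableSet.univ]; simpa using hf.lint⟩

lemma law_eq {d : ℕ} {f q : (Fin d → ℝ) → ℝ} (hf : IsDensity f) (hq : IsDensity q) :
    (volume.withDensity fun x => ENNReal.ofReal (conv f q x)) = Pd q ∗ Pd f := by
  have := hf.prob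
  have := hq.prob
  have hfm : AEMeasurable (fun x => ENNReal.ofReal (f x)) := hf.int.aemeasurable.ennreal_ofReal
  have hqm : AEMeasurable (fun x => ENNReal.ofReal (q x)) := hq.int.aemeasurable.ennreal_ofReal
  have h1 := conv_withDensity_eq_mlconvolution₀ (μ := (volume : Measure (Fin d → ℝ))) hqm hfm
  have h2 : Pd q ∗ Pd f = volume.withDensity
    ((fun x => ENNReal.ofReal (q x)) ⋆ₗ[volume] (fun x => ENNReal.ofReal (f x))) := h1
  rw [h2]
  have hfin : ∫⁻ x, ((fun x => ENNReal.ofReal (q x)) ⋆ₗ[volume] (fun x => ENNReal.ofReal (f x))) x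
      ≠ ⊤ := by
    have h3 : (Pd q ∗ Pd f) Set.univ = 1 := measure_univ
    rw [h2, withDensity_apply _ MeasurableSet.univ] at h3
    rw [Measure.restrict_univ] at h3
    rw [h3]; exact one_ne_top
  have hae := ae_lt_top' (aemeasurable_lconvolution hqm hfm) hfin
  refine withDensity_congr_ae ?_
  filter_upwards [hae] with x hx
  rw [lconvolution_def] at hx ⊢
  have hqmp := (Measure.measurePreserving_sub_left (volume : Measure (Fin d → ℝ)) x).quasiMeasurePreserving
  have hm : AEStronglyMeasurable (fun y => f (x - y) * q y) volume :=
    (hf.int.aestronglyMeasurable.comp_quasiMeasurePreserving hqmp).mul hq.int.aestronglyMeasurable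
  have he : ∀ y, ENNReal.ofReal (f (x - y) * q y) =
      ENNReal.ofReal (q y) * ENNReal.ofReal (f (-y + x)) := fun y => by
    rw [mul_comm, ENNReal.ofReal_mul (hq.1 y), sub_eq_neg_add]
  unfold conv
  rw [integral_eq_lintegral_of_nonneg_ae (ae_of_all _ fun y => mul_nonneg (hf.1 _) (hq.1 _)) hm]
  simp_rw [he]
  exact ENNReal.ofReal_toReal hx.ne

lemma glue_mp {d : ℕ} (I : Finset (Fin d)) :
    MeasurePreserving (fun z : (I → ℝ) × (↥(Iᶜ) → ℝ) => glue I z.1 z.2)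
      (volume.prod volume) volume := by
  have hm : Measurable (fun z : (I → ℝ) × (↥(Iᶜ) → ℝ) => glue I z.1 z.2) := by
    refine measurable_pi_lambda _ fun i => ?_
    unfold glue
    by_cases h : i ∈ I <;> simp only [h, dite_true, dite_false]
    · exact (measurable_pi_apply _).comp measurable_fst
    · exact (measurable_pi_apply _).comp measurable_snd
  refine ⟨hm, ?_⟩
  symm
  rw [volume_pi]
  refine Measure.pi_eq fun s hs => ?_
  rw [Measure.map_apply hm (MeasurableSet.univ_pi hs)]
  have : (fun z : (I → ℝ) × (↥(Iᶜ) → ℝ) => glue I z.1 z.2) ⁻¹' (Set.univ.pi s) =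
      (Set.univ.pi fun j : I => s j) ×ˢ (Set.univ.pi fun j : ↥(Iᶜ) => s j) := by
    ext z
    simp only [Set.mem_preimage, Set.mem_pi, Set.mem_univ, true_implies, Set.mem_prod, glue]
    constructor
    · intro h
      refine ⟨fun j => ?_, fun j => ?_⟩
      · have := h j; simpa using this
      · have := h j; simpa [Finset.mem_compl.mp j.2] using this
    · rintro ⟨h1, h2⟩ i
      by_cases hi : i ∈ I
      · simpa [hi] using h1 ⟨i, hi⟩
      · simpa [hi] using h2 ⟨i, Finset.mem_compl.mpr hi⟩
  rw [this, Measure.prod_prod, volume_pi, volume_pi, Measure.pi_pi, Measure.pi_pi,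
    Finset.prod_coe_sort I (fun i => volume (s i)), Finset.prod_coe_sort Iᶜ (fun i => volume (s i)),
    Finset.prod_mul_prod_compl]

lemma res_glue {d : ℕ} (I : Finset (Fin d)) (u : I → ℝ) (v : ↥(Iᶜ) → ℝ) :
    res I (glue I u v) = u := by
  ext j; simp [res, glue]

lemma map_res {d : ℕ} (I : Finset (Fin d)) {g : (Fin d → ℝ) → ℝ} (hg : IsDensity g) :
    (Pd g).map (res I) = Pd (marginal I g) ∧ IsDensity (marginal I g) := by
  have hmp := glue_mp I
  have hint : Integrable (fun z : (I → ℝ) × (↥(Iᶜ) → ℝ) => g (glue I z.1 z.2))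
      (volume.prod volume) := hmp.integrable_comp_of_integrable hg.int
  refine ⟨?_, fun u => integral_nonneg fun v => hg.1 _, ?_⟩
  · refine Measure.ext_of_lintegral _ fun Φ hΦ => ?_
    have hgm : AEMeasurable (fun x => ENNReal.ofReal (g x)) := hg.int.aemeasurable.ennreal_ofReal
    rw [lintegral_map hΦ (res_meas I)]
    unfold Pd
    have hΦ' : Measurable fun x => Φ (res I x) := hΦ.comp (res_meas I)
    have hmarg : AEMeasurable (fun x => ENNReal.ofReal (marginal I g x)) :=
      hint.integral_prod_left.aemeasurable.ennreal_ofReal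
    rw [lintegral_withDensity_eq_lintegral_mul₀ hgm hΦ'.aemeasurable,
      lintegral_withDensity_eq_lintegral_mul₀ hmarg hΦ.aemeasurable]
    have hm2 : AEMeasurable (fun x => ENNReal.ofReal (g x) * Φ (res I x)) :=
      hgm.mul (hΦ.comp (res_meas I)).aemeasurable
    have e1 : ∫⁻ x, ENNReal.ofReal (g x) * Φ (res I x) =
        ∫⁻ z, ENNReal.ofReal (g (glue I z.1 z.2)) * Φ z.1 ∂(volume.prod volume) := by
      rw [← hmp.map_eq, lintegral_map' (by rw [hmp.map_eq]; exact hm2) hmp.measurable.aemeasurable]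
      simp only [res_glue]
    simp only [Pi.mul_apply, Function.comp_apply]
    rw [e1, lintegral_prod]
    · refine lintegral_congr_ae ?_
      filter_upwards [hint.prod_right_ae] with u hu
      rw [lintegral_mul_const'' _ hu.aemeasurable.ennreal_ofReal,
        ← ofReal_integral_eq_lintegral_ofReal hu (ae_of_all _ fun v => hg.1 _)]
      rfl
    · exact hint.aemeasurable.ennreal_ofReal.mul (hΦ.comp measurable_fst).aemeasurable
  · show ∫ u, ∫ v, g (glue I u v) = 1
    rw [← hg.2, ← hmp.map_eq, integral_map hmp.measurable.aemeasurable
      (by rw [hmp.map_eq]; exact hg.int.aestronglyMeasurable), integral_prod _ hint]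

/-- complex exponential -/
def ex {ι : Type} [Fintype ι] (t x : ι → ℝ) : ℂ := Complex.exp (Complex.I * (dotp t x : ℝ))

lemma ex_norm {ι : Type} [Fintype ι] (t x : ι → ℝ) : ‖ex t x‖ = 1 := by
  unfold ex; rw [mul_comm]; exact Complex.norm_exp_ofReal_mul_I _

lemma ex_add {ι : Type} [Fintype ι] (t x y : ι → ℝ) : ex t (x + y) = ex t x * ex t y := by
  unfold ex dotp
  rw [← Complex.exp_add]; congr 1
  simp only [Pi.add_apply, mul_add, Finset.sum_add_distrib]; push_cast; ring

lemma ex_cont {ι : Type} [Fintype ι] : Continuous fun z : (ι → ℝ) × (ι → ℝ) => ex z.1 z.2 := by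
  unfold ex dotp; fun_prop

lemma ft_pd {ι : Type} [Fintype ι] {g : (ι → ℝ) → ℝ} (hg : IsDensity g) (t : ι → ℝ) :
    ftI g t = ∫ x, ex t x ∂(Pd g) := by
  unfold Pd
  rw [integral_withDensity_eq_integral_toReal_smul₀ hg.int.aemeasurable.ennreal_ofReal
    (ae_of_all _ fun x => ENNReal.ofReal_lt_top)]
  unfold ftI ex
  congr 1; ext x
  rw [ENNReal.toReal_ofReal (hg.1 x), Complex.real_smul, mul_comm]

lemma ft_marg {d : ℕ} (I : Finset (Fin d)) {g : (Fin d → ℝ) → ℝ} (hg : IsDensity g) (t : I → ℝ) :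
    ftI (marginal I g) t = ∫ x, ex t (res I x) ∂(Pd g) := by
  rw [ft_pd (map_res I hg).2, ← (map_res I hg).1, integral_map (res_meas I).aemeasurable]
  exact (ex_cont.comp (Continuous.prodMk_right t)).aestronglyMeasurable

lemma ft_cont {ι : Type} [Fintype ι] {g : (ι → ℝ) → ℝ} (hg : IsDensity g) : Continuous (ftI g) := by
  have := hg.prob
  have : ftI g = fun t => ∫ x, ex t x ∂(Pd g) := funext (ft_pd hg)
  rw [this]
  refine continuous_of_dominated (bound := fun _ => 1) (fun t => ?_) (fun t => ?_)
    (integrable_const _) (ae_of_all _ fun x => ex_cont.comp (Continuous.prodMk_left x))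
  · exact (ex_cont.comp (Continuous.prodMk_right t)).aestronglyMeasurable
  · exact ae_of_all _ fun x => (ex_norm t x).le

lemma ft_norm_le {ι : Type} [Fintype ι] {g : (ι → ℝ) → ℝ} (hg : IsDensity g) (t : ι → ℝ) :
    ‖ftI g t‖ ≤ 1 := by
  have := hg.prob
  rw [ft_pd hg]
  refine (norm_integral_le_integral_norm _).trans ?_
  simp [ex_norm]

/-- characteristic function of `Y_I` -/
lemma cf_law {d : ℕ} (I : Finset (Fin d)) {f q : (Fin d → ℝ) → ℝ} (hf : IsDensity f)
    (hq : IsDensity q) (t : I → ℝ) :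
    ∫ y, ex t (res I y) ∂(Pd q ∗ Pd f) = ftI (marginal I q) t * ftI (marginal I f) t := by
  have := hf.prob
  have := hq.prob
  have hm : Measurable fun y => ex t (res I y) :=
    (ex_cont.comp (Continuous.prodMk_right t)).measurable.comp (res_meas I)
  rw [integral_conv]
  · have : ∀ x y, ex t (res I (x + y)) = ex t (res I x) * ex t (res I y) := fun x y => by
      rw [← ex_add]; rfl
    simp_rw [this, integral_const_mul, integral_mul_const]
    rw [← ft_marg I hf, ← ft_marg I hq]
  · exact Integrable.of_bound hm.aestronglyMeasurable 1 (ae_of_all _ fun y => (ex_norm _ _).le)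

/-- the law of `Y_I` is bounded by Lebesgue measure -/
lemma law_le {d : ℕ} (I : Finset (Fin d)) {q : (Fin d → ℝ) → ℝ}
    (hq : IsDensity q) {f : (Fin d → ℝ) → ℝ} (hf : IsDensity f)
    (Φ : (I → ℝ) → ℝ≥0∞) (hΦ : Measurable Φ) :
    ∫⁻ y, Φ (res I y) ∂(Pd q ∗ Pd f) ≤ eLpNorm (marginal I q) ⊤ volume * ∫⁻ u, Φ u := by
  have := hf.prob
  have := hq.prob
  obtain ⟨e1, hd⟩ := map_res I hq
  have key : ∀ Ψ : (I → ℝ) → ℝ≥0∞, Measurable Ψ →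
      ∫⁻ y, Ψ (res I y) ∂(Pd q) ≤ eLpNorm (marginal I q) ⊤ volume * ∫⁻ u, Ψ u := by
    intro Ψ hΨ
    rw [← lintegral_map hΨ (res_meas I), e1]
    unfold Pd
    rw [lintegral_withDensity_eq_lintegral_mul₀ hd.int.aemeasurable.ennreal_ofReal hΨ.aemeasurable,
      ← lintegral_const_mul _ hΨ]
    refine lintegral_mono_ae ?_
    rw [eLpNorm_exponent_top]
    filter_upwards [ae_le_eLpNormEssSup (f := marginal I q) (μ := volume)] with u hu
    simp only [Pi.mul_apply]
    gcongr
    rwa [Real.enorm_eq_ofReal (hd.1 u)] at hu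
  have hΦ' : Measurable fun x => Φ (res I x) := hΦ.comp (res_meas I)
  have hΦ2 : Measurable fun z : (Fin d → ℝ) × (Fin d → ℝ) => Φ (res I (z.1 + z.2)) :=
    hΦ'.comp (measurable_fst.add measurable_snd)
  rw [Measure.conv, lintegral_map hΦ' (by fun_prop), lintegral_prod_symm _ hΦ2.aemeasurable]
  calc _ ≤ ∫⁻ _x, (eLpNorm (marginal I q) ⊤ volume * ∫⁻ u, Φ u) ∂(Pd f) := by
        refine lintegral_mono fun x => ?_
        refine (key (fun u => Φ (u + res I x)) (hΦ.comp (by fun_prop))).trans ?_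
        rw [lintegral_add_right_eq_self Φ]
    _ = _ := by simp

end

section

/-- inverse Fourier type integral -/
def ift {ι : Type} [Fintype ι] (F : (ι → ℝ) → ℂ) (x : ι → ℝ) : ℂ := ∫ t, ex (-t) x * F t

lemma ex_neg_eq {ι : Type} [Fintype ι] (t x : ι → ℝ) :
    ex (-t) x = Complex.exp (-(Complex.I * (dotp t x : ℝ))) := by
  unfold ex dotp; simp

lemma ex_conj {ι : Type} [Fintype ι] (t x : ι → ℝ) : (starRingEnd ℂ) (ex (-t) x) = ex t x := by
  rw [ex_neg_eq, ← Complex.exp_conj]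
  simp [ex, Complex.conj_ofReal]

lemma ex_add_left {ι : Type} [Fintype ι] (s t x : ι → ℝ) : ex (s + t) x = ex s x * ex t x := by
  unfold ex dotp
  rw [← Complex.exp_add]; congr 1
  simp only [Pi.add_apply, add_mul, Finset.sum_add_distrib]; push_cast; ring

lemma ex_enorm {ι : Type} [Fintype ι] (t x : ι → ℝ) : ‖ex t x‖ₑ = 1 := by
  rw [← ofReal_norm, ex_norm]; simp

lemma ift_cont {ι : Type} [Fintype ι] {F : (ι → ℝ) → ℂ} (hF : Integrable F) :
    Continuous (ift F) := by
  unfold ift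
  refine continuous_of_dominated (bound := fun t => ‖F t‖) (fun x => ?_) (fun x => ?_)
    hF.norm (ae_of_all _ fun t => ?_)
  · exact ((ex_cont.comp (continuous_neg.prodMk continuous_const)).aestronglyMeasurable).mul
      hF.aestronglyMeasurable
  · exact ae_of_all _ fun t => by rw [norm_mul, ex_norm, one_mul]
  · exact (ex_cont.comp (Continuous.prodMk_right _)).mul continuous_const

lemma ift_norm_le {ι : Type} [Fintype ι] (F : (ι → ℝ) → ℂ) (x : ι → ℝ) :
    ‖ift F x‖ ≤ ∫ t, ‖F t‖ := by
  refine (norm_integral_le_integral_norm _).trans ?_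
  simp [ex_norm]

lemma quad_le {ι : Type} [Fintype ι] (μ : Measure (ι → ℝ)) [IsFiniteMeasure μ]
    {F : (ι → ℝ) → ℂ} (hF : Integrable F) (hFm : Measurable F) :
    ∫⁻ x, ‖ift F x‖ₑ ^ (2 : ℝ) ∂μ ≤
      (∫⁻ t : ι → ℝ, ‖∫ x, ex t x ∂μ‖ₑ) * ∫⁻ t, ‖F t‖ₑ ^ (2 : ℝ) := by
  have hc := ift_cont hF
  set m : (ι → ℝ) → ℂ := fun t => ∫ x, ex t x ∂μ with hm
  have hmc : Continuous m := by
    refine continuous_of_dominated (bound := fun _ => 1) (fun t => ?_) (fun t => ?_)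
      (integrable_const _) (ae_of_all _ fun x => ex_cont.comp (Continuous.prodMk_left x))
    · exact (ex_cont.comp (Continuous.prodMk_right t)).aestronglyMeasurable
    · exact ae_of_all _ fun x => (ex_norm t x).le
  have hi : Integrable (fun x => ‖ift F x‖ ^ 2) μ := by
    refine Integrable.of_bound (by fun_prop) ((∫ t, ‖F t‖) ^ 2) (ae_of_all _ fun x => ?_)
    rw [Real.norm_of_nonneg (by positivity)]
    gcongr; exact ift_norm_le F x
  have hFF : Integrable (fun z : (ι → ℝ) × (ι → ℝ) => F z.1 * (starRingEnd ℂ) (F z.2))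
      (volume.prod volume) := by
    have h2 : Integrable (fun t => (starRingEnd ℂ) (F t)) := by
      simpa using (Complex.conjCLE.toContinuousLinearMap.integrable_comp hF)
    exact hF.mul_prod h2
  have e1 : ∀ x, ((‖ift F x‖ ^ 2 : ℝ) : ℂ) =
      ∫ z : (ι → ℝ) × (ι → ℝ), ex (z.2 - z.1) x * (F z.1 * (starRingEnd ℂ) (F z.2))
        ∂(volume.prod volume) := by
    intro x
    have h3 : (starRingEnd ℂ) (ift F x) = ∫ s, ex s x * (starRingEnd ℂ) (F s) := by
      unfold ift; rw [← integral_conj]; congr 1; ext s; rw [map_mul, ex_conj]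
    rw [Complex.ofReal_pow, ← Complex.mul_conj', h3]
    unfold ift
    rw [← integral_prod_mul]
    congr 1; ext z
    rw [sub_eq_add_neg, ex_add_left]; ring
  have e2 : ((∫ x, ‖ift F x‖ ^ 2 ∂μ : ℝ) : ℂ) =
      ∫ z : (ι → ℝ) × (ι → ℝ), m (z.2 - z.1) * (F z.1 * (starRingEnd ℂ) (F z.2))
        ∂(volume.prod volume) := by
    rw [← integral_complex_ofReal]
    simp_rw [e1]
    rw [integral_integral_swap]
    · congr 1; ext z
      rw [integral_mul_const]
    · have h4 : Integrable (fun w : (ι → ℝ) × ((ι → ℝ) × (ι → ℝ)) =>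
        (1 : ℂ) * (F w.2.1 * (starRingEnd ℂ) (F w.2.2))) (μ.prod (volume.prod volume)) :=
        (integrable_const (1:ℂ)).mul_prod hFF
      refine h4.mono ?_ (ae_of_all _ fun w => ?_)
      · have h5 : Measurable (Function.uncurry fun (x : ι → ℝ) (z : (ι → ℝ) × (ι → ℝ)) =>
            ex (z.2 - z.1) x * (F z.1 * (starRingEnd ℂ) (F z.2))) := by
          have h6 : Measurable fun w : (ι → ℝ) × ((ι → ℝ) × (ι → ℝ)) => ex (w.2.2 - w.2.1) w.1 :=
            (ex_cont.comp (by fun_prop : Continuous fun w : (ι → ℝ) × ((ι → ℝ) × (ι → ℝ)) =>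
              (w.2.2 - w.2.1, w.1))).measurable
          have h7 : Measurable fun z : ℂ => (starRingEnd ℂ) z := Complex.continuous_conj.measurable
          exact h6.mul ((hFm.comp (by fun_prop)).mul (h7.comp (hFm.comp (by fun_prop))))
        exact h5.aestronglyMeasurable
      · simp only [Function.uncurry, norm_mul, ex_norm]; simp
  have e3 : ∫⁻ x, ‖ift F x‖ₑ ^ (2 : ℝ) ∂μ = ‖((∫ x, ‖ift F x‖ ^ 2 ∂μ : ℝ) : ℂ)‖ₑ := by
    rw [← ofReal_norm, Complex.norm_real, Real.norm_of_nonneg (integral_nonneg fun x => by positivity),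
      ofReal_integral_eq_lintegral_ofReal hi (ae_of_all _ fun x => by positivity)]
    refine lintegral_congr fun x => ?_
    rw [enorm_rpow_eq _ (by norm_num)]; norm_num
  rw [e3, e2]
  refine (enorm_integral_le_lintegral_enorm _).trans ?_
  have am : ∀ a b : ℝ≥0∞, a * b ≤ 2⁻¹ * (a ^ (2:ℝ) + b ^ (2:ℝ)) := fun a b => by
    have := ENNReal.young_inequality a b (p := 2) (q := 2)
      ((Real.holderConjugate_iff).2 ⟨by norm_num, by norm_num⟩)
    refine this.trans (le_of_eq ?_)
    rw [show ENNReal.ofReal 2 = 2 by simp, ENNReal.div_eq_inv_mul, ENNReal.div_eq_inv_mul, mul_add]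
  have hm1 : Measurable fun z : (ι → ℝ) × (ι → ℝ) => ‖m (z.2 - z.1)‖ₑ :=
    (hmc.comp (by fun_prop)).measurable.enorm
  have hmm : Measurable fun u => ‖m u‖ₑ := hmc.measurable.enorm
  have hF2 : Measurable fun t => ‖F t‖ₑ ^ (2:ℝ) := hFm.enorm.pow_const _
  calc _ ≤ ∫⁻ z : (ι → ℝ) × (ι → ℝ), 2⁻¹ * (‖m (z.2 - z.1)‖ₑ * ‖F z.1‖ₑ ^ (2:ℝ) +
        ‖m (z.2 - z.1)‖ₑ * ‖F z.2‖ₑ ^ (2:ℝ)) ∂(volume.prod volume) := by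
        refine lintegral_mono fun z => ?_
        rw [enorm_mul, enorm_mul, RCLike.enorm_conj, ← mul_add,
          mul_left_comm (2⁻¹ : ℝ≥0∞) ‖m (z.2 - z.1)‖ₑ]
        exact mul_le_mul_right (am _ _) _
    _ = 2⁻¹ * ((∫⁻ t, ‖m t‖ₑ) * (∫⁻ t, ‖F t‖ₑ ^ (2:ℝ)) + (∫⁻ t, ‖m t‖ₑ) * (∫⁻ t, ‖F t‖ₑ ^ (2:ℝ))) := by
        have h1 : Measurable fun z : (ι → ℝ) × (ι → ℝ) => ‖m (z.2 - z.1)‖ₑ * ‖F z.1‖ₑ ^ (2:ℝ) :=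
          hm1.mul (hF2.comp measurable_fst)
        have h2 : Measurable fun z : (ι → ℝ) × (ι → ℝ) => ‖m (z.2 - z.1)‖ₑ * ‖F z.2‖ₑ ^ (2:ℝ) :=
          hm1.mul (hF2.comp measurable_snd)
        rw [lintegral_const_mul _ (by exact h1.add h2), lintegral_add_left h1, lintegral_prod _ h1.aemeasurable,
          lintegral_prod_symm _ h2.aemeasurable]
        congr 2
        · rw [← lintegral_const_mul _ hF2]
          refine lintegral_congr fun t => ?_
          dsimp only
          rw [lintegral_mul_const _ (by exact hmm.comp (measurable_id.sub_const t)), lintegral_sub_right_eq_self (fun u => ‖m u‖ₑ)]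
        · rw [← lintegral_const_mul _ hF2]
          refine lintegral_congr fun t => ?_
          dsimp only
          rw [lintegral_mul_const _ (by exact hmm.comp (measurable_id.const_sub t)), lintegral_sub_left_eq_self (fun u => ‖m u‖ₑ)]
    _ = _ := by
        rw [← two_mul, ← mul_assoc, ENNReal.inv_mul_cancel (by norm_num) (by norm_num), one_mul]

lemma lint_prod_real {ι : Type} [Fintype ι] (f : ι → ℝ → ℝ) (h0 : ∀ i x, 0 ≤ f i x)
    (hf : ∀ i, Integrable (f i)) :
    ∫⁻ x : ι → ℝ, ENNReal.ofReal (∏ i, f i (x i)) = ENNReal.ofReal (∏ i, ∫ x, f i x) := by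
  rw [← integral_fintype_prod_volume_eq_prod, ofReal_integral_eq_lintegral_ofReal]
  · exact Integrable.fintype_prod hf
  · exact ae_of_all _ fun x => Finset.prod_nonneg fun i _ => h0 i _

lemma plancherel_le {ι : Type} [Fintype ι] {F : (ι → ℝ) → ℂ} (hF : Integrable F)
    (hFm : Measurable F) :
    ∫⁻ x, ‖ift F x‖ₑ ^ (2 : ℝ) ≤
      ENNReal.ofReal ((2 * Real.pi) ^ Fintype.card ι) * ∫⁻ t, ‖F t‖ₑ ^ (2 : ℝ) := by
  have hm : Measurable fun x => ‖ift F x‖ₑ ^ (2:ℝ) := (ift_cont hF).measurable.enorm.pow_const _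
  have key : ∀ e : ℝ, 0 < e → ∫⁻ x : ι → ℝ, ENNReal.ofReal (∏ i, Real.exp (-e * x i ^ 2)) *
      ‖ift F x‖ₑ ^ (2 : ℝ) ≤
      ENNReal.ofReal ((2 * Real.pi) ^ Fintype.card ι) * ∫⁻ t, ‖F t‖ₑ ^ (2 : ℝ) := by
    intro e he
    have hgm : Measurable fun x : ι → ℝ => ENNReal.ofReal (∏ i, Real.exp (-e * x i ^ 2)) := by
      fun_prop
    set μ : Measure (ι → ℝ) := volume.withDensity fun x =>
      ENNReal.ofReal (∏ i, Real.exp (-e * x i ^ 2)) with hμ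
    have hfin : IsFiniteMeasure μ := by
      refine isFiniteMeasure_withDensity ?_
      rw [lint_prod_real (fun _ x => Real.exp (-e * x ^ 2)) (fun _ _ => (Real.exp_pos _).le)
        (fun _ => integrable_exp_neg_mul_sq he)]
      exact ENNReal.ofReal_ne_top
    have h := quad_le μ hF hFm
    rw [hμ, lintegral_withDensity_eq_lintegral_mul _ hgm hm] at h
    refine h.trans ?_
    gcongr
    rw [← hμ]
    have hcf : ∀ t : ι → ℝ, ∫ x, ex t x ∂μ =
        ∏ i, (((Real.sqrt (Real.pi / e) * Real.exp (-(1 / (4 * e)) * t i ^ 2) : ℝ)) : ℂ) := by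
      intro t
      rw [hμ, integral_withDensity_eq_integral_toReal_smul hgm
        (ae_of_all _ fun x => ENNReal.ofReal_lt_top)]
      have : ∀ x : ι → ℝ, (ENNReal.ofReal (∏ i, Real.exp (-e * x i ^ 2))).toReal • ex t x =
          ∏ i, (Complex.exp (Complex.I * (t i : ℂ) * (x i : ℝ)) *
            Complex.exp (-(e : ℂ) * (x i : ℝ) ^ 2)) := by
        intro x
        rw [ENNReal.toReal_ofReal (Finset.prod_nonneg fun i _ => (Real.exp_pos _).le),
          Complex.real_smul, Finset.prod_mul_distrib, mul_comm]
        congr 1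
        · unfold ex dotp
          rw [← Complex.exp_sum]; congr 1
          push_cast
          rw [Finset.mul_sum]
          exact Finset.sum_congr rfl fun i _ => by ring
        · push_cast; rfl
      simp_rw [this]
      rw [integral_fintype_prod_volume_eq_prod
        (fun i (x : ℝ) => Complex.exp (Complex.I * (t i : ℂ) * x) * Complex.exp (-(e : ℂ) * x ^ 2))]
      refine Finset.prod_congr rfl fun i _ => ?_
      rw [fourierIntegral_gaussian (by simpa using he)]
      push_cast
      congr 1
      · rw [Real.sqrt_eq_rpow, Complex.ofReal_cpow (by positivity)]; push_cast; rfl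
      · congr 1; ring
    have hnn : ∀ t : ι → ℝ, ‖∫ x, ex t x ∂μ‖ₑ = ENNReal.ofReal
        (∏ i, Real.sqrt (Real.pi / e) * Real.exp (-(1 / (4 * e)) * t i ^ 2)) := by
      intro t
      rw [hcf, ← Complex.ofReal_prod, ← ofReal_norm, Complex.norm_real, Real.norm_of_nonneg
        (Finset.prod_nonneg fun i _ => by positivity)]
    simp_rw [hnn]
    rw [lint_prod_real (fun _ x => Real.sqrt (Real.pi / e) * Real.exp (-(1 / (4 * e)) * x ^ 2))
      (fun _ _ => by positivity)
      (fun _ => (integrable_exp_neg_mul_sq (by positivity)).const_mul _)]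
    refine le_of_eq ?_
    congr 1
    rw [Finset.prod_const, Finset.card_univ]
    congr 1
    rw [integral_const_mul, integral_gaussian, ← Real.sqrt_mul (by positivity),
      show Real.pi / e * (Real.pi / (1 / (4 * e))) = (2 * Real.pi) ^ 2 by field_simp; ring,
      Real.sqrt_sq (by positivity)]
  set W : ℝ≥0∞ := ENNReal.ofReal ((2 * Real.pi) ^ Fintype.card ι) * ∫⁻ t, ‖F t‖ₑ ^ (2 : ℝ)
  set G : ℕ → (ι → ℝ) → ℝ≥0∞ := fun k x =>
    ENNReal.ofReal (∏ i, Real.exp (-(1 / ((k:ℝ) + 1)) * x i ^ 2)) * ‖ift F x‖ₑ ^ (2 : ℝ)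
  have hGm : ∀ k, Measurable (G k) := fun k => by
    refine Measurable.mul ?_ hm
    fun_prop
  have hlim : ∀ x, ‖ift F x‖ₑ ^ (2 : ℝ) = liminf (fun k => G k x) atTop := by
    intro x
    refine (Tendsto.liminf_eq ?_).symm
    have h1 : Tendsto (fun k : ℕ => ENNReal.ofReal (∏ i, Real.exp (-(1 / ((k:ℝ) + 1)) * x i ^ 2)))
        atTop (𝓝 1) := by
      rw [← ENNReal.ofReal_one]
      refine ENNReal.tendsto_ofReal ?_
      have : (1 : ℝ) = ∏ i : ι, Real.exp (-0 * x i ^ 2) := by simp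
      have h3 : Tendsto (fun k : ℕ => ∏ i, Real.exp (-(1 / ((k:ℝ) + 1)) * x i ^ 2))
          atTop (𝓝 (∏ i : ι, Real.exp (-0 * x i ^ 2))) := ?_
      · rwa [← this] at h3
      refine tendsto_finsetProd _ fun i _ => ?_
      refine (Real.continuous_exp.tendsto _).comp ?_
      exact ((tendsto_one_div_add_atTop_nhds_zero_nat (𝕜 := ℝ)).neg).mul_const _
    have h2 := ENNReal.Tendsto.mul_const (b := ‖ift F x‖ₑ ^ (2 : ℝ)) h1 (Or.inl one_ne_zero)
    rwa [one_mul] at h2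
  simp_rw [hlim]
  refine (lintegral_liminf_le hGm).trans ?_
  refine liminf_le_of_frequently_le' (Frequently.of_forall fun k => ?_)
  exact key _ (by positivity)

end

section

open scoped FourierTransform SchwartzMap in
lemma kern_ex {K : ℝ → ℝ} (hK : IsKernel K) : ∃ Q : SchwartzMap ℝ ℂ,
    (∀ s : ℝ, Q s = ∫ x : ℝ, Complex.exp (Complex.I * ((s * x : ℝ) : ℂ)) * (K x : ℂ)) ∧
    ∀ x : ℝ, (K x : ℂ) = ((2 * Real.pi)⁻¹ : ℝ) *
      ∫ s : ℝ, Complex.exp (-(Complex.I * ((s * x : ℝ) : ℂ))) * Q s := by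
  obtain ⟨⟨KS, rfl⟩, -, -⟩ := hK
  set Kc : SchwartzMap ℝ ℂ := KS.postcompCLM (𝕜 := ℝ) Complex.ofRealCLM with hKc
  have hKc' : ∀ x, Kc x = (KS x : ℂ) := fun x => rfl
  have h2pi : (2 * Real.pi)⁻¹ ≠ 0 := by positivity
  set g : ℝ ≃L[ℝ] ℝ := ContinuousLinearEquiv.unitsEquivAut ℝ (Units.mk0 _ h2pi) with hg
  have hg' : ∀ s, g s = s * (2 * Real.pi)⁻¹ := fun s => by
    simp [hg, ContinuousLinearEquiv.unitsEquivAut]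
  set Q : SchwartzMap ℝ ℂ := SchwartzMap.compCLMOfContinuousLinearEquiv ℝ g (𝓕⁻ Kc) with hQ
  have hQ' : ∀ s, Q s = (𝓕⁻ Kc) (s * (2 * Real.pi)⁻¹) := fun s => by rw [← hg']; rfl
  refine ⟨Q, fun s => ?_, fun x => ?_⟩
  · rw [hQ', SchwartzMap.fourierInv_coe, Real.fourierInv_eq']
    congr 1; ext x
    rw [hKc', smul_eq_mul]
    congr 2
    have : (Real.pi : ℂ) ≠ 0 := by exact_mod_cast Real.pi_ne_zero
    simp; field_simp
  · have h1 : 𝓕 (𝓕⁻ Kc) = Kc := FourierTransform.fourier_fourierInv_eq Kc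
    have h2 : Kc x = 𝓕 ((𝓕⁻ Kc : SchwartzMap ℝ ℂ) : ℝ → ℂ) x := by
      rw [← SchwartzMap.fourier_coe, h1]
    rw [← hKc', h2, Real.fourier_eq']
    have h3 := Measure.integral_comp_mul_right (fun v : ℝ =>
      Complex.exp (((-2 * Real.pi * inner ℝ v x : ℝ) : ℂ) * Complex.I) • (𝓕⁻ Kc) v) ((2 * Real.pi)⁻¹)
    simp only [hQ']
    rw [inv_inv, abs_of_pos (by positivity)] at h3
    have h4 : ∀ s : ℝ, Complex.exp (-(Complex.I * ((s * x : ℝ) : ℂ))) * (𝓕⁻ Kc) (s * (2 * Real.pi)⁻¹) =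
        Complex.exp (((-2 * Real.pi * inner ℝ (s * (2 * Real.pi)⁻¹) x : ℝ) : ℂ) * Complex.I) •
          (𝓕⁻ Kc) (s * (2 * Real.pi)⁻¹) := fun s => by
      rw [smul_eq_mul]; congr 2
      have : (Real.pi : ℂ) ≠ 0 := by exact_mod_cast Real.pi_ne_zero
      simp; field_simp
    simp_rw [h4]
    rw [h3, ← Complex.real_smul, smul_smul, inv_mul_cancel₀ (by positivity), one_smul]

lemma sch_decay (Q : SchwartzMap ℝ ℂ) (N : ℕ) : ∃ C : ℝ, 0 < C ∧ ∀ s : ℝ,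
    ‖Q s‖ * (1 + |s|) ^ N ≤ C ∧ ‖deriv Q s‖ * (1 + |s|) ^ N ≤ C := by
  have h0 := fun s => SchwartzMap.one_add_le_sup_seminorm_apply (𝕜 := ℝ) (m := (N, 1)) (k := N) (n := 0)
    le_rfl (by norm_num) Q s
  have h1 := fun s => SchwartzMap.one_add_le_sup_seminorm_apply (𝕜 := ℝ) (m := (N, 1)) (k := N) (n := 1)
    le_rfl le_rfl Q s
  set C := 2 ^ N * ((Finset.Iic (N, 1)).sup fun m => SchwartzMap.seminorm ℝ m.1 m.2) Q
  refine ⟨max C 1, by positivity, fun s => ⟨?_, ?_⟩⟩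
  · refine le_trans ?_ (le_max_left _ _)
    have := h0 s
    rw [norm_iteratedFDeriv_zero, Real.norm_eq_abs] at this
    rw [mul_comm]; exact this
  · refine le_trans ?_ (le_max_left _ _)
    have := h1 s
    rw [norm_iteratedFDeriv_one, Real.norm_eq_abs, ← norm_deriv_eq_norm_fderiv] at this
    rw [mul_comm]; exact this

lemma ft_Kh {d : ℕ} (I : Finset (Fin d)) {K : ℝ → ℝ} {Q : SchwartzMap ℝ ℂ}
    (hQ : ∀ s : ℝ, Q s = ∫ x : ℝ, Complex.exp (Complex.I * ((s * x : ℝ) : ℂ)) * (K x : ℂ))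
    (h : Fin d → ℝ) (hh : ∀ j ∈ I, 0 < h j) (t : I → ℝ) :
    ftI (Kh I K h) t = ∏ j : I, Q (h j * t j) := by
  unfold ftI Kh
  have e1 : ∀ x : I → ℝ, Complex.exp (Complex.I * (dotp t x : ℝ)) *
      (((∏ j ∈ I, h j)⁻¹ * ∏ j : I, K (x j / h ↑j) : ℝ) : ℂ) =
      ∏ j : I, (((h j : ℝ) : ℂ)⁻¹ * (Complex.exp (Complex.I * ((t j * x j : ℝ) : ℂ)) *
        (K (x j / h j) : ℂ))) := by
    intro x
    rw [Finset.prod_mul_distrib, Finset.prod_mul_distrib, ← Finset.prod_coe_sort]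
    unfold dotp
    push_cast
    rw [Finset.mul_sum, Complex.exp_sum, Finset.prod_inv_distrib]
    ring
  simp_rw [e1]
  rw [integral_fintype_prod_volume_eq_prod (fun (j : I) (x : ℝ) => ((h j : ℝ) : ℂ)⁻¹ *
    (Complex.exp (Complex.I * ((t j * x : ℝ) : ℂ)) * (K (x / h j) : ℂ)))]
  refine Finset.prod_congr rfl fun j _ => ?_
  have hj := hh j j.2
  rw [hQ, integral_const_mul]
  have := Measure.integral_comp_div (fun x : ℝ =>
    Complex.exp (Complex.I * ((h j * t j * x : ℝ) : ℂ)) * (K x : ℂ)) (h j)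
  have e2 : ∀ x : ℝ, Complex.exp (Complex.I * ((h j * t j * (x / h j) : ℝ) : ℂ)) =
    Complex.exp (Complex.I * ((t j * x : ℝ) : ℂ)) := fun x => by congr 3; field_simp
  simp_rw [e2] at this
  rw [this, abs_of_pos hj, Complex.real_smul, ← mul_assoc, inv_mul_cancel₀, one_mul]
  exact_mod_cast hj.ne'

/-- the inverse characteristic function bound, valid for all `p` -/
lemma invq_bound {d : ℕ} {p : ℝ≥0∞} {I : Finset (Fin d)} (hI : I.Nonempty) {q : (Fin d → ℝ) → ℝ}
    {A : ℝ} {lam : Fin d → ℝ} (hN : N1N2 p I q A lam) (t : I → ℝ) :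
    ftI (marginal I q) t ≠ 0 ∧
    ‖(ftI (marginal I q) t)⁻¹‖ ≤ A * ∏ j : I, (1 + t j ^ 2) ^ (lam ↑j / 2) := by
  obtain ⟨hA, hl, h2, h3, h4, h5⟩ := hN
  by_cases hp2 : p = 2
  · have hb := (h2 hp2).2 t
    have hpos : 0 < A⁻¹ * ∏ j : I, (1 + t j ^ 2) ^ (-lam ↑j / 2) :=
      mul_pos (inv_pos.2 hA) (Finset.prod_pos fun j _ => by positivity)
    refine ⟨fun h => ?_, ?_⟩
    · rw [h, norm_zero] at hb; linarith
    · rw [norm_inv]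
      refine (inv_anti₀ hpos hb).trans (le_of_eq ?_)
      rw [mul_inv, inv_inv, ← Finset.prod_inv_distrib]
      congr 1
      refine Finset.prod_congr rfl fun j _ => ?_
      rw [neg_div, Real.rpow_neg (by positivity), inv_inv]
  · by_cases hpt : p = ⊤
    · obtain ⟨h6, -, h7⟩ := h5 hpt
      obtain ⟨j, hj⟩ := hI
      exact ⟨h6 t, h7 ⟨j, hj⟩ 0 (by norm_num) t⟩
    · obtain ⟨h6, -, h7⟩ := h4 hp2 hpt
      refine ⟨h6 t, ?_⟩
      have := h7 0 (by simp) t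
      have e : multiPD (0 : I → ℕ) (fun u => (ftI (marginal I q) u)⁻¹) =
          fun u => (ftI (marginal I q) u)⁻¹ := by
        unfold multiPD
        induction (Finset.univ : Finset I).toList with
        | nil => rfl
        | cons a l ih => simpa using ih
      rw [e] at this
      simpa using this

/-- Fourier multiplier of the deconvolution kernel -/
def Gh {d : ℕ} (I : Finset (Fin d)) (K : ℝ → ℝ) (q : (Fin d → ℝ) → ℝ) (h : Fin d → ℝ)
    (t : I → ℝ) : ℂ := ftI (Kh I K h) t / ftI (marginal I q) t

lemma Lh_eq {d : ℕ} (I : Finset (Fin d)) (K : ℝ → ℝ) (q : (Fin d → ℝ) → ℝ) (h : Fin d → ℝ)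
    (x : I → ℝ) : Lh I K q h x = (((2 * Real.pi) ^ (-(I.card : ℝ)) : ℝ) : ℂ) * ift (Gh I K q h) x := by
  unfold Lh ift Gh; simp_rw [ex_neg_eq]

end

section

/-- standing assumptions for a block -/
structure Std {d : ℕ} (K : ℝ → ℝ) (q : (Fin d → ℝ) → ℝ) (A : ℝ) (lam : Fin d → ℝ) (p : ℝ≥0∞)
    (I : Finset (Fin d)) : Prop where
  hK : IsKernel K
  hq : IsDensity q
  hI : I.Nonempty
  hN : N1N2 p I q A lam

def BW {d : ℕ} (I : Finset (Fin d)) (h : Fin d → ℝ) : Prop := ∀ j ∈ I, 0 < h j ∧ h j ≤ 1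

def La {d : ℕ} (lam : Fin d → ℝ) (I : Finset (Fin d)) (h : Fin d → ℝ) : ℝ := ∏ j ∈ I, h j ^ lam j
def Hp {d : ℕ} (I : Finset (Fin d)) (h : Fin d → ℝ) : ℝ := ∏ j ∈ I, h j

section
variable {d : ℕ} {K : ℝ → ℝ} {q : (Fin d → ℝ) → ℝ} {A : ℝ} {lam : Fin d → ℝ} {p : ℝ≥0∞}
  {I : Finset (Fin d)} {h : Fin d → ℝ}

lemma La_pos (hh : BW I h) : 0 < La lam I h :=
  Finset.prod_pos fun j hj => Real.rpow_pos_of_pos (hh j hj).1 _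
lemma Hp_pos (hh : BW I h) : 0 < Hp I h := Finset.prod_pos fun j hj => (hh j hj).1
lemma La_le (hl : ∀ j, 0 < lam j) (hh : BW I h) : La lam I h ≤ 1 :=
  Finset.prod_le_one (fun j hj => Real.rpow_nonneg (hh j hj).1.le _)
    fun j hj => Real.rpow_le_one (hh j hj).1.le (hh j hj).2 (hl j).le
lemma Hp_le (hh : BW I h) : Hp I h ≤ 1 :=
  Finset.prod_le_one (fun j hj => (hh j hj).1.le) fun j hj => (hh j hj).2

lemma prod_int (φ : ℝ → ℝ) (hφ : Integrable φ) (hh : BW I h) :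
    Integrable (fun t : I → ℝ => ∏ j : I, φ (h j * t j)) ∧
    ∫ t : I → ℝ, ∏ j : I, φ (h j * t j) = (Hp I h)⁻¹ * (∫ s, φ s) ^ I.card := by
  constructor
  · exact Integrable.fintype_prod (f := fun (j : I) (s : ℝ) => φ (h j * s))
      (fun j => (integrable_comp_mul_left_iff φ (hh j j.2).1.ne').2 hφ)
  · rw [integral_fintype_prod_volume_eq_prod (fun (j : I) (s : ℝ) => φ (h j * s))]
    simp_rw [Measure.integral_comp_mul_left, smul_eq_mul]
    rw [Finset.prod_mul_distrib, Finset.prod_const, Finset.card_univ, Fintype.card_coe]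
    unfold Hp
    rw [← Finset.prod_coe_sort I h, ← Finset.prod_inv_distrib]
    congr 1
    exact Finset.prod_congr rfl fun j _ => abs_of_pos (inv_pos.2 (hh j j.2).1)

/-- weight -/
def wt (r s : ℝ) : ℝ := (1 + |s|) ^ (-r)
lemma wt_pos (r s : ℝ) : 0 < wt r s := Real.rpow_pos_of_pos (by positivity) _
lemma wt_le {r : ℝ} (hr : 0 ≤ r) (s : ℝ) : wt r s ≤ 1 :=
  Real.rpow_le_one_of_one_le_of_nonpos (by linarith [abs_nonneg s]) (by linarith)
lemma wt_int {r : ℝ} (hr : 1 < r) : Integrable (wt r) := by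
  have := integrable_one_add_norm (E := ℝ) (μ := volume) (r := r) (by simpa using hr)
  exact this

lemma kern_wt {Q : SchwartzMap ℝ ℂ} (b : ℝ) (lm : ℝ) : ∃ C : ℝ, 0 < C ∧ ∀ s : ℝ, ∀ l : ℝ, l ≤ lm →
    ‖Q s‖ * (1 + |s|) ^ l ≤ C * wt b s ∧ ‖deriv Q s‖ * (1 + |s|) ^ l ≤ C * wt b s := by
  obtain ⟨N, hN⟩ := exists_nat_ge (lm + b)
  obtain ⟨C, hC, h1⟩ := sch_decay Q N
  refine ⟨C, hC, fun s l hl => ?_⟩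
  have key : ∀ a : ℝ, 0 ≤ a → a * (1 + |s|) ^ N ≤ C → a * (1 + |s|) ^ l ≤ C * wt b s := by
    intro a ha hb
    have h0 : (0:ℝ) < 1 + |s| := by positivity
    have e : (1 + |s|) ^ l = (1 + |s|) ^ (l + b) * wt b s := by
      unfold wt; rw [← Real.rpow_add h0]; congr 1; ring
    rw [e, ← mul_assoc]
    refine mul_le_mul_of_nonneg_right (le_trans ?_ hb) (wt_pos _ _).le
    refine mul_le_mul_of_nonneg_left ?_ ha
    rw [← Real.rpow_natCast]
    exact Real.rpow_le_rpow_of_exponent_le (by linarith [abs_nonneg s]) (by linarith)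
  exact ⟨key _ (norm_nonneg _) (h1 s).1, key _ (norm_nonneg _) (h1 s).2⟩

lemma jap_le {a t l : ℝ} (ha : 0 < a) (ha1 : a ≤ 1) (hl : 0 ≤ l) :
    (1 + t ^ 2) ^ (l / 2) ≤ a ^ (-l) * (1 + |a * t|) ^ l := by
  have h0 : (0:ℝ) < 1 + |a * t| := by positivity
  have h1 : 1 + t ^ 2 ≤ (a⁻¹ * (1 + |a * t|)) ^ (2:ℝ) := by
    rw [Real.rpow_two, abs_mul, abs_of_pos ha, mul_add, ← mul_assoc, inv_mul_cancel₀ ha.ne', one_mul]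
    have : 1 ≤ a⁻¹ := (one_le_inv₀ ha).2 ha1
    have h3 := abs_nonneg t
    have h4 := sq_abs t
    nlinarith [mul_nonneg (inv_pos.2 ha).le h3]
  calc (1 + t ^ 2) ^ (l / 2) ≤ ((a⁻¹ * (1 + |a * t|)) ^ (2:ℝ)) ^ (l / 2) :=
        Real.rpow_le_rpow (by positivity) h1 (by positivity)
    _ = a ^ (-l) * (1 + |a * t|) ^ l := by
        rw [← Real.rpow_mul (by positivity), Real.mul_rpow (by positivity) h0.le,
          Real.inv_rpow ha.le, Real.rpow_neg ha.le]
        congr 2 <;> congr 1 <;> ring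

lemma lamMax_ge (j : Fin d) : lam j ≤ ∑ i, |lam i| :=
  (le_abs_self _).trans (Finset.single_le_sum (f := fun i => |lam i|) (fun _ _ => abs_nonneg _) (mem_univ j))

lemma G_cont (S : Std K q A lam p I) (hh : BW I h) : Continuous (Gh I K q h) := by
  obtain ⟨Q, hQ, -⟩ := kern_ex S.hK
  unfold Gh
  refine Continuous.div ?_ (ft_cont (map_res I S.hq).2) fun t => (invq_bound S.hI S.hN t).1
  have : ftI (Kh I K h) = fun t => ∏ j : I, Q (h j * t j) :=
    funext fun t => ft_Kh I hQ h (fun j hj => (hh j hj).1) t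
  rw [this]
  exact continuous_finsetProd _ fun j _ => Q.continuous.comp (by fun_prop)

lemma G_bound (S : Std K q A lam p I) : ∃ C : ℝ, 0 < C ∧ ∀ h, BW I h → ∀ t : I → ℝ,
    ‖Gh I K q h t‖ ≤ C * (La lam I h)⁻¹ * ∏ j : I, wt 3 (h j * t j) := by
  obtain ⟨Q, hQ, -⟩ := kern_ex S.hK
  obtain ⟨C, hC, hb⟩ := kern_wt (Q := Q) 3 (∑ i, |lam i|)
  have hA := S.hN.1
  refine ⟨A * C ^ I.card, by positivity, fun h hh t => ?_⟩
  unfold Gh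
  rw [ft_Kh I hQ h (fun j hj => (hh j hj).1), div_eq_mul_inv, norm_mul, norm_prod]
  have h1 := (invq_bound S.hI S.hN t).2
  calc (∏ j : I, ‖Q (h j * t j)‖) * ‖(ftI (marginal I q) t)⁻¹‖
      ≤ (∏ j : I, ‖Q (h j * t j)‖) * (A * ∏ j : I, (1 + t j ^ 2) ^ (lam ↑j / 2)) :=
        mul_le_mul_of_nonneg_left h1 (Finset.prod_nonneg fun _ _ => norm_nonneg _)
    _ = A * ∏ j : I, (‖Q (h j * t j)‖ * (1 + t j ^ 2) ^ (lam ↑j / 2)) := by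
        rw [Finset.prod_mul_distrib]; ring
    _ ≤ A * ∏ j : I, (C * (h j ^ lam j)⁻¹ * wt 3 (h j * t j)) := by
        refine mul_le_mul_of_nonneg_left (Finset.prod_le_prod (fun j _ => by positivity) fun j _ => ?_) hA.le
        have h2 := jap_le (t := t j) (hh j j.2).1 (hh j j.2).2 (S.hN.2.1 j).le
        have h3 := (hb (h j * t j) (lam j) (lamMax_ge _)).1
        have h4 : 0 < h j ^ (-lam j) := Real.rpow_pos_of_pos (hh j j.2).1 _
        rw [← Real.rpow_neg (hh j j.2).1.le]
        calc _ ≤ ‖Q (h j * t j)‖ * (h j ^ (-lam j) * (1 + |h j * t j|) ^ lam j) :=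
              mul_le_mul_of_nonneg_left h2 (norm_nonneg _)
          _ = h j ^ (-lam j) * (‖Q (h j * t j)‖ * (1 + |h j * t j|) ^ lam j) := by ring
          _ ≤ h j ^ (-lam j) * (C * wt 3 (h j * t j)) := mul_le_mul_of_nonneg_left h3 h4.le
          _ = _ := by ring
    _ = _ := by
        rw [Finset.prod_mul_distrib, Finset.prod_mul_distrib, Finset.prod_const, Finset.card_univ,
          Fintype.card_coe, Finset.prod_inv_distrib, Finset.prod_coe_sort I (fun j => h j ^ lam j)]
        unfold La; ring

lemma G_int (S : Std K q A lam p I) : ∃ C : ℝ, 0 < C ∧ ∀ h, BW I h →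
    Integrable (Gh I K q h) ∧ (∫ t, ‖Gh I K q h t‖) ≤ C * (La lam I h)⁻¹ * (Hp I h)⁻¹ ∧
    ∫⁻ t, ‖Gh I K q h t‖ₑ ^ (2:ℝ) ≤ ENNReal.ofReal (C * (La lam I h)⁻¹ ^ 2 * (Hp I h)⁻¹) ∧
    (∀ t, ‖Gh I K q h t‖ ≤ C * (La lam I h)⁻¹) ∧
    Integrable (fun t => (∏ j : I, (1 + |t j|)) * ‖Gh I K q h t‖) ∧
    ∫ t, (∏ j : I, (1 + |t j|)) * ‖Gh I K q h t‖ ≤ C * (La lam I h)⁻¹ * (Hp I h)⁻¹ ^ 2 := by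
  obtain ⟨C, hC, hb⟩ := G_bound S
  have w0 : ∀ r, 0 ≤ ∫ s, wt r s := fun r => integral_nonneg fun s => (wt_pos r s).le
  set C3 := (∫ s, wt 3 s) ^ I.card with hC3
  set C2 := (∫ s, wt 2 s) ^ I.card with hC2
  have c3 : 0 ≤ C3 := pow_nonneg (w0 _) _
  have c2 : 0 ≤ C2 := pow_nonneg (w0 _) _
  refine ⟨C * C3 + C ^ 2 * C3 + C + C * C2, by positivity, fun h hh => ?_⟩
  have hL := La_pos (lam := lam) hh
  have hH := Hp_pos hh
  have hGm := (G_cont S hh).aestronglyMeasurable (μ := volume)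
  obtain ⟨i3, e3⟩ := prod_int (wt 3) (wt_int (by norm_num)) hh
  obtain ⟨i2, e2⟩ := prod_int (wt 2) (wt_int (by norm_num)) hh
  have hp0 : ∀ t : I → ℝ, 0 ≤ ∏ j : I, wt 3 (h j * t j) := fun t => Finset.prod_nonneg fun j _ => (wt_pos _ _).le
  have hp1 : ∀ t : I → ℝ, ∏ j : I, wt 3 (h j * t j) ≤ 1 := fun t =>
    Finset.prod_le_one (fun j _ => (wt_pos _ _).le) fun j _ => wt_le (by norm_num) _
  have hGi : Integrable (Gh I K q h) := (i3.const_mul _).mono' hGm (ae_of_all _ (hb h hh))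
  have hw : ∀ t : I → ℝ, (∏ j : I, (1 + |t j|)) * ‖Gh I K q h t‖ ≤
      (C * (La lam I h)⁻¹ * (Hp I h)⁻¹) * ∏ j : I, wt 2 (h j * t j) := by
    intro t
    have h0 : 0 ≤ ∏ j : I, (1 + |t j|) := Finset.prod_nonneg fun j _ => by positivity
    refine (mul_le_mul_of_nonneg_left (hb h hh t) h0).trans ?_
    have h1 : (∏ j : I, (1 + |t j|)) * ∏ j : I, wt 3 (h j * t j) ≤ (Hp I h)⁻¹ * ∏ j : I, wt 2 (h j * t j) := by
      unfold Hp
      rw [← Finset.prod_coe_sort I h, ← Finset.prod_inv_distrib, ← Finset.prod_mul_distrib, ← Finset.prod_mul_distrib]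
      refine Finset.prod_le_prod (fun j _ => mul_nonneg (by positivity) (wt_pos _ _).le) fun j _ => ?_
      have hj := hh j j.2
      have e : wt 2 (h j * t j) = (1 + |h j * t j|) * wt 3 (h j * t j) := by
        unfold wt
        nth_rewrite 2 [← Real.rpow_one (1 + |h j * t j|)]
        rw [← Real.rpow_add (by positivity)]; norm_num
      rw [e, ← mul_assoc]
      refine mul_le_mul_of_nonneg_right ?_ (wt_pos _ _).le
      rw [abs_mul, abs_of_pos hj.1, mul_add, ← mul_assoc, inv_mul_cancel₀ hj.1.ne', mul_one, one_mul]
      have := (one_le_inv₀ hj.1).2 hj.2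
      linarith
    calc _ = C * (La lam I h)⁻¹ * ((∏ j : I, (1 + |t j|)) * ∏ j : I, wt 3 (h j * t j)) := by ring
      _ ≤ C * (La lam I h)⁻¹ * ((Hp I h)⁻¹ * ∏ j : I, wt 2 (h j * t j)) :=
        mul_le_mul_of_nonneg_left h1 (by positivity)
      _ = _ := by ring
  have hwi : Integrable (fun t => (∏ j : I, (1 + |t j|)) * ‖Gh I K q h t‖) := by
    refine (i2.const_mul (C * (La lam I h)⁻¹ * (Hp I h)⁻¹)).mono' ?_ (ae_of_all _ fun t => ?_)
    · have : Continuous fun t : I → ℝ => ∏ j : I, (1 + |t j|) := by fun_prop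
      exact (this.mul (G_cont S hh).norm).aestronglyMeasurable
    · rw [Real.norm_of_nonneg (mul_nonneg (Finset.prod_nonneg fun j _ => by positivity) (norm_nonneg _))]
      exact hw t
  have L1 : 0 < (La lam I h)⁻¹ := inv_pos.2 hL
  have H1 : 0 < (Hp I h)⁻¹ := inv_pos.2 hH
  have q1 : 0 ≤ (La lam I h)⁻¹ * (Hp I h)⁻¹ := by positivity
  refine ⟨hGi, ?_, ?_, fun t => ?_, hwi, ?_⟩
  · calc _ ≤ ∫ t : I → ℝ, C * (La lam I h)⁻¹ * ∏ j : I, wt 3 (h j * t j) :=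
          integral_mono hGi.norm (i3.const_mul _) (hb h hh)
      _ = (C * C3) * ((La lam I h)⁻¹ * (Hp I h)⁻¹) := by rw [integral_const_mul, e3]; ring
      _ ≤ (C * C3 + C ^ 2 * C3 + C + C * C2) * ((La lam I h)⁻¹ * (Hp I h)⁻¹) := by
          gcongr
          have : 0 ≤ C ^ 2 * C3 + C + C * C2 := by positivity
          linarith
      _ = _ := by ring
  · calc _ ≤ ∫⁻ t : I → ℝ, ENNReal.ofReal ((C * (La lam I h)⁻¹) ^ 2 * ∏ j : I, wt 3 (h j * t j)) := by
          refine lintegral_mono fun t => ?_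
          rw [enorm_rpow_eq _ (by norm_num)]
          refine ENNReal.ofReal_le_ofReal ?_
          rw [Real.rpow_two]
          refine (pow_le_pow_left₀ (norm_nonneg _) (hb h hh t) 2).trans ?_
          rw [mul_pow]
          refine mul_le_mul_of_nonneg_left ?_ (by positivity)
          nlinarith [hp0 t, hp1 t]
      _ = ENNReal.ofReal ((C ^ 2 * C3) * ((La lam I h)⁻¹ ^ 2 * (Hp I h)⁻¹)) := by
          rw [← ofReal_integral_eq_lintegral_ofReal (i3.const_mul _)
            (ae_of_all _ fun t => mul_nonneg (by positivity) (hp0 t)), integral_const_mul, e3]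
          congr 1; ring
      _ ≤ ENNReal.ofReal ((C * C3 + C ^ 2 * C3 + C + C * C2) * ((La lam I h)⁻¹ ^ 2 * (Hp I h)⁻¹)) := by
          gcongr
          have : 0 ≤ C * C3 + C + C * C2 := by positivity
          linarith
      _ = _ := by congr 1; ring
  · calc _ ≤ C * (La lam I h)⁻¹ * ∏ j : I, wt 3 (h j * t j) := hb h hh t
      _ ≤ C * (La lam I h)⁻¹ := mul_le_of_le_one_right (by positivity) (hp1 t)
      _ ≤ _ := by
          gcongr
          have : 0 ≤ C * C3 + C ^ 2 * C3 + C * C2 := by positivity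
          linarith
  · calc _ ≤ ∫ t : I → ℝ, (C * (La lam I h)⁻¹ * (Hp I h)⁻¹) * ∏ j : I, wt 2 (h j * t j) :=
          integral_mono hwi (i2.const_mul _) hw
      _ = (C * C2) * ((La lam I h)⁻¹ * (Hp I h)⁻¹ ^ 2) := by rw [integral_const_mul, e2]; ring
      _ ≤ (C * C3 + C ^ 2 * C3 + C + C * C2) * ((La lam I h)⁻¹ * (Hp I h)⁻¹ ^ 2) := by
          gcongr
          have : 0 ≤ C * C3 + C ^ 2 * C3 + C := by positivity
          linarith
      _ = _ := by ring

lemma ex_diff {ι : Type} [Fintype ι] (t x y : ι → ℝ) :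
    ‖ex t x - ex t y‖ ≤ (∏ j, (1 + |t j|)) * ‖x - y‖ := by
  have h1 : ‖ex t x - ex t y‖ ≤ |dotp t (x - y)| := by
    have e : ex t x = ex t (x - y) * ex t y := by rw [← ex_add]; simp
    rw [e, ← sub_one_mul, norm_mul, ex_norm, mul_one]
    unfold ex
    exact (Real.norm_exp_I_mul_ofReal_sub_one_le).trans (by rw [Real.norm_eq_abs])
  refine h1.trans ?_
  unfold dotp
  refine (Finset.abs_sum_le_sum_abs _ _).trans ?_
  calc ∑ j, |t j * (x - y) j| ≤ ∑ j, |t j| * ‖x - y‖ := by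
        refine Finset.sum_le_sum fun j _ => ?_
        rw [abs_mul]
        exact mul_le_mul_of_nonneg_left (norm_le_pi_norm (x - y) j) (abs_nonneg _)
    _ = (∑ j, |t j|) * ‖x - y‖ := by rw [Finset.sum_mul]
    _ ≤ _ := by
        refine mul_le_mul_of_nonneg_right ?_ (norm_nonneg _)
        have : ∀ s : Finset ι, 1 + ∑ j ∈ s, |t j| ≤ ∏ j ∈ s, (1 + |t j|) := by
          classical
          intro s
          induction s using Finset.induction_on with
          | empty => simp
          | insert a s ha ih =>
            rw [Finset.sum_insert ha, Finset.prod_insert ha]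
            have h1 := abs_nonneg (t a)
            have h2 : 0 ≤ ∑ j ∈ s, |t j| := Finset.sum_nonneg fun _ _ => abs_nonneg _
            nlinarith
        linarith [this univ]

lemma L_bounds (S : Std K q A lam p I) : ∃ C : ℝ, 0 < C ∧ ∀ h, BW I h →
    Continuous (Lh I K q h) ∧ (∀ x, ‖Lh I K q h x‖ ≤ C * (La lam I h)⁻¹ * (Hp I h)⁻¹) ∧
    ∫⁻ x, ‖Lh I K q h x‖ₑ ^ (2:ℝ) ≤ ENNReal.ofReal (C * (La lam I h)⁻¹ ^ 2 * (Hp I h)⁻¹) ∧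
    ∀ x y, ‖Lh I K q h x - Lh I K q h y‖ ≤ C * (La lam I h)⁻¹ * (Hp I h)⁻¹ ^ 2 * ‖x - y‖ := by
  obtain ⟨C, hC, hb⟩ := G_int S
  set c := (2 * Real.pi) ^ (-(I.card : ℝ)) with hc
  have c0 : 0 < c := by positivity
  have ec : c * (2 * Real.pi) ^ I.card = 1 := by
    rw [hc, Real.rpow_neg (by positivity), Real.rpow_natCast, inv_mul_cancel₀ (by positivity)]
  have ec1 : c ≤ 1 := by
    rw [hc]; exact Real.rpow_le_one_of_one_le_of_nonpos (by linarith [Real.pi_gt_three]) (by simp)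
  have enc : ‖((c : ℝ) : ℂ)‖ = c := by rw [Complex.norm_real, Real.norm_of_nonneg c0.le]
  refine ⟨C, hC, fun h hh => ?_⟩
  obtain ⟨h1, h2, h3, h4, h5, h6⟩ := hb h hh
  have hL : Lh I K q h = fun x => (c : ℂ) * ift (Gh I K q h) x := funext fun x => Lh_eq I K q h x
  rw [hL]
  refine ⟨continuous_const.mul (ift_cont h1), fun x => ?_, ?_, fun x y => ?_⟩
  · rw [norm_mul, enc]
    calc _ ≤ 1 * ‖ift (Gh I K q h) x‖ := by gcongr
      _ ≤ _ := by rw [one_mul]; exact (ift_norm_le _ x).trans h2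
  · have e1 : ∀ x, ‖(c : ℂ) * ift (Gh I K q h) x‖ₑ ^ (2:ℝ) = ENNReal.ofReal (c ^ 2) * ‖ift (Gh I K q h) x‖ₑ ^ (2:ℝ) := by
      intro x
      rw [enorm_mul, ENNReal.mul_rpow_of_nonneg _ _ (by norm_num), enorm_rpow_eq _ (by norm_num), enc, Real.rpow_two]
    simp_rw [e1]
    rw [lintegral_const_mul' _ _ ENNReal.ofReal_ne_top]
    have h7 := plancherel_le h1 (G_cont S hh).measurable
    rw [Fintype.card_coe] at h7
    calc _ ≤ ENNReal.ofReal (c ^ 2) * (ENNReal.ofReal ((2 * Real.pi) ^ I.card) *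
          ENNReal.ofReal (C * (La lam I h)⁻¹ ^ 2 * (Hp I h)⁻¹)) := by gcongr; exact h7.trans (by gcongr)
      _ = ENNReal.ofReal (c * (c * (2 * Real.pi) ^ I.card)) * ENNReal.ofReal (C * (La lam I h)⁻¹ ^ 2 * (Hp I h)⁻¹) := by
          rw [← mul_assoc, ← ENNReal.ofReal_mul (by positivity)]; congr 2; ring
      _ ≤ 1 * ENNReal.ofReal (C * (La lam I h)⁻¹ ^ 2 * (Hp I h)⁻¹) := by
          gcongr; rw [ec, mul_one]; exact ENNReal.ofReal_le_one.2 ec1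
      _ = _ := one_mul _
  · rw [← mul_sub, norm_mul, enc]
    have hi : ∀ x, Integrable fun t => ex (-t) x * Gh I K q h t := fun x => by
      refine h1.norm.mono' ?_ (ae_of_all _ fun t => by rw [norm_mul, ex_norm, one_mul])
      exact (Continuous.mul (by unfold ex dotp; fun_prop) (G_cont S hh)).aestronglyMeasurable
    calc c * ‖ift (Gh I K q h) x - ift (Gh I K q h) y‖ ≤ 1 * ‖ift (Gh I K q h) x - ift (Gh I K q h) y‖ := by gcongr
      _ = ‖∫ t, (ex (-t) x - ex (-t) y) * Gh I K q h t‖ := by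
          unfold ift
          rw [one_mul, ← integral_sub (hi x) (hi y)]; simp_rw [sub_mul]
      _ ≤ ∫ t, ((∏ j : I, (1 + |t j|)) * ‖Gh I K q h t‖) * ‖x - y‖ := by
          refine norm_integral_le_of_norm_le (h5.mul_const _) (ae_of_all _ fun t => ?_)
          rw [norm_mul]
          have := ex_diff (-t) x y
          simp only [Pi.neg_apply, abs_neg] at this
          calc _ ≤ ((∏ j : I, (1 + |t j|)) * ‖x - y‖) * ‖Gh I K q h t‖ := by gcongr
            _ = _ := by ring
      _ ≤ _ := by rw [integral_mul_const]; gcongr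

end

end

section

lemma ift_fub {Y ι : Type} [Fintype ι] [MeasurableSpace Y] (μ : Measure Y) [IsFiniteMeasure μ]
    {φ : Y → ι → ℝ} (hφ : Measurable φ) {F : (ι → ℝ) → ℂ} (hF : Integrable F) (x : ι → ℝ) :
    ∫ y, ift F (x - φ y) ∂μ = ift (fun t => F t * ∫ y, ex t (φ y) ∂μ) x := by
  unfold ift
  rw [integral_integral_swap]
  · congr 1; ext t
    simp only []
    rw [← integral_const_mul, ← integral_const_mul]
    congr 1; ext y
    have : ex (-t) (x - φ y) = ex (-t) x * ex t (φ y) := by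
      have e1 : ex (-t) (-φ y) = ex t (φ y) := by unfold ex dotp; simp
      rw [sub_eq_add_neg, ex_add, e1]
    rw [this]; ring
  · have hi : Integrable (fun z : Y × (ι → ℝ) => F z.2) (μ.prod volume) := hF.comp_snd μ
    refine hi.norm.mono' ?_ (ae_of_all _ fun z => ?_)
    · refine AEStronglyMeasurable.mul ?_ hi.aestronglyMeasurable
      exact (ex_cont.measurable.comp (Measurable.prodMk (measurable_snd.neg)
        (measurable_const.sub (hφ.comp measurable_fst)))).aestronglyMeasurable
    · simp only [Function.uncurry]; rw [norm_mul, ex_norm, one_mul]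

section
variable {d : ℕ} {K : ℝ → ℝ} {q f : (Fin d → ℝ) → ℝ} {A : ℝ} {lam : Fin d → ℝ} {p : ℝ≥0∞}
  {I : Finset (Fin d)} {h : Fin d → ℝ}

lemma Kh_inv {Q : SchwartzMap ℝ ℂ}
    (hQ : ∀ x : ℝ, (K x : ℂ) = ((2 * Real.pi)⁻¹ : ℝ) *
      ∫ s : ℝ, Complex.exp (-(Complex.I * ((s * x : ℝ) : ℂ))) * Q s) (hh : BW I h) (z : I → ℝ) :
    (((2 * Real.pi) ^ (-(I.card : ℝ)) : ℝ) : ℂ) * ift (fun t => ∏ j : I, Q (h j * t j)) z = (Kh I K h z : ℂ) := by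
  unfold ift Kh
  have e1 : ∀ t : I → ℝ, ex (-t) z * ∏ j : I, Q (h j * t j) =
      ∏ j : I, (Complex.exp (-(Complex.I * ((t j * z j : ℝ) : ℂ))) * Q (h j * t j)) := by
    intro t
    rw [Finset.prod_mul_distrib, ex_neg_eq]; unfold dotp
    push_cast
    rw [Finset.mul_sum, ← Finset.sum_neg_distrib, Complex.exp_sum]
  simp_rw [e1]
  rw [integral_fintype_prod_volume_eq_prod (fun (j : I) (s : ℝ) =>
    (Complex.exp (-(Complex.I * ((s * z j : ℝ) : ℂ))) * Q (h j * s)))]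
  have e2 : ∀ j : I, ∫ s : ℝ, (Complex.exp (-(Complex.I * ((s * z j : ℝ) : ℂ))) * Q (h j * s)) =
      ((h j : ℝ) : ℂ)⁻¹ * ((2 * Real.pi : ℝ) * (K (z j / h j) : ℂ)) := by
    intro j
    have hj := (hh j j.2).1
    have := Measure.integral_comp_mul_left (fun s : ℝ =>
      Complex.exp (-(Complex.I * ((s * (z j / h j) : ℝ) : ℂ))) * Q s) (h j)
    have e3 : ∀ s : ℝ, h j * s * (z j / h j) = s * z j := fun s => by field_simp
    simp_rw [e3] at this
    rw [this, hQ, abs_of_pos (inv_pos.2 hj), Complex.real_smul, ← mul_assoc ((2 * Real.pi : ℝ) : ℂ),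
      ← Complex.ofReal_mul (2 * Real.pi), mul_inv_cancel₀ (by positivity)]
    push_cast; ring
  simp_rw [e2]
  rw [Finset.prod_mul_distrib, Finset.prod_mul_distrib, Finset.prod_const, Finset.card_univ,
    Fintype.card_coe, Real.rpow_neg (by positivity), Real.rpow_natCast, ← Finset.prod_coe_sort I h]
  push_cast
  rw [Finset.prod_inv_distrib]
  have : ((2 * (Real.pi:ℂ)) ^ I.card) ≠ 0 := by
    apply pow_ne_zero; simp [Real.pi_ne_zero]
  field_simp

lemma mean_eq (S : Std K q A lam p I) (hf : IsDensity f) (hh : BW I h) (x : I → ℝ) :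
    fHatMean I K f q h x = ∫ u, (Kh I K h (x - u) : ℂ) ∂(Pd (marginal I f)) := by
  obtain ⟨Q, hQ, hQ2⟩ := kern_ex S.hK
  obtain ⟨C, hC, hb⟩ := G_int S
  have := hf.prob
  have := S.hq.prob
  have hfI := (map_res I hf).2
  have := hfI.prob
  set c := (2 * Real.pi) ^ (-(I.card : ℝ)) with hc
  have hGi := (hb h hh).1
  have e1 : fHatMean I K f q h x = (c : ℂ) * ift (fun t => Gh I K q h t *
      (ftI (marginal I q) t * ftI (marginal I f) t)) x := by
    unfold fHatMean
    rw [law_eq hf S.hq]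
    have : ∀ y : Fin d → ℝ, Lh I K q h (fun j : I => x j - y j) = (c : ℂ) * ift (Gh I K q h) (x - res I y) :=
      fun y => Lh_eq I K q h _
    simp_rw [this]
    rw [integral_const_mul, ift_fub _ (res_meas I) hGi]
    simp_rw [cf_law I hf S.hq]
  have e2 : ∀ t, Gh I K q h t * (ftI (marginal I q) t * ftI (marginal I f) t) =
      (∏ j : I, Q (h j * t j)) * ∫ u, ex t (id u) ∂(Pd (marginal I f)) := by
    intro t
    have := (invq_bound S.hI S.hN t).1
    unfold Gh
    rw [ft_Kh I hQ h (fun j hj => (hh j hj).1), ← mul_assoc, div_mul_cancel₀ _ this]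
    simp only [id]
    rw [← ft_pd hfI]
  rw [e1]
  simp_rw [e2]
  have hQi : Integrable (fun t : I → ℝ => ∏ j : I, Q (h j * t j)) :=
    Integrable.fintype_prod (f := fun (j : I) (s : ℝ) => Q (h j * s))
      (fun j => (integrable_comp_mul_left_iff (fun s => Q s) (hh j j.2).1.ne').2 Q.integrable)
  rw [← ift_fub _ measurable_id hQi, ← integral_const_mul]
  simp_rw [hc, Kh_inv hQ2 hh, id]

lemma young_p {ι : Type} [Fintype ι] {k g : (ι → ℝ) → ℝ≥0∞} (hk : Measurable k) (hg : Measurable g)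
    {r : ℝ} (hr : 1 ≤ r) :
    ∫⁻ x, (∫⁻ u, k (x - u) * g u) ^ r ≤ (∫⁻ u, k u) ^ r * ∫⁻ u, g u ^ r := by
  have hr0 : 0 < r := by linarith
  have hm : ∀ x, Measurable fun u => k (x - u) := fun x => hk.comp (by fun_prop)
  have h1 : ∀ x, (∫⁻ u, k (x - u) * g u) ^ r ≤ (∫⁻ u, k u) ^ (r - 1) * ∫⁻ u, k (x - u) * g u ^ r := by
    intro x
    have h2 := ENNReal.lintegral_mul_norm_pow_le (μ := volume) (f := fun u => k (x - u))
      (g := fun u => k (x - u) * g u ^ r) (hm x).aemeasurable ((hm x).mul (hg.pow_const r)).aemeasurable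
      (p := 1 - 1 / r) (q := 1 / r) (sub_nonneg.2 (by rw [div_le_one hr0]; exact hr)) (by positivity) (by ring)
    have e : ∀ u, k (x - u) ^ (1 - 1 / r) * (k (x - u) * g u ^ r) ^ (1 / r) = k (x - u) * g u := by
      intro u
      rw [ENNReal.mul_rpow_of_nonneg _ _ (by positivity), ← mul_assoc,
        ← ENNReal.rpow_add_of_nonneg _ _ (sub_nonneg.2 (by rw [div_le_one hr0]; exact hr)) (by positivity),
        sub_add_cancel, ENNReal.rpow_one, ← ENNReal.rpow_mul, mul_one_div_cancel hr0.ne', ENNReal.rpow_one]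
    simp_rw [e] at h2
    rw [lintegral_sub_left_eq_self k x] at h2
    calc _ ≤ ((∫⁻ u, k u) ^ (1 - 1 / r) * (∫⁻ u, k (x - u) * g u ^ r) ^ (1 / r)) ^ r := by gcongr
      _ = _ := by
        rw [ENNReal.mul_rpow_of_nonneg _ _ hr0.le, ← ENNReal.rpow_mul, ← ENNReal.rpow_mul,
          one_div_mul_cancel hr0.ne', ENNReal.rpow_one]
        congr 2; field_simp
  have hm2 : Measurable (Function.uncurry fun x u : ι → ℝ => k (x - u) * g u ^ r) :=
    (hk.comp (measurable_fst.sub measurable_snd)).mul ((hg.comp measurable_snd).pow_const r)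
  calc _ ≤ ∫⁻ x, (∫⁻ u, k u) ^ (r - 1) * ∫⁻ u, k (x - u) * g u ^ r := lintegral_mono h1
    _ = (∫⁻ u, k u) ^ (r - 1) * ∫⁻ u, ∫⁻ x, k (x - u) * g u ^ r := by
        rw [lintegral_const_mul _ hm2.lintegral_prod_right, lintegral_lintegral_swap hm2.aemeasurable]
    _ = (∫⁻ u, k u) ^ (r - 1) * ((∫⁻ u, k u) * ∫⁻ u, g u ^ r) := by
        congr 1
        rw [← lintegral_const_mul _ (hg.pow_const r)]
        refine lintegral_congr fun u => ?_
        have hmu : Measurable fun x => k (x - u) := hk.comp (by fun_prop)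
        rw [lintegral_mul_const _ hmu, lintegral_sub_right_eq_self k u]
    _ = _ := by
        rw [← mul_assoc]; congr 1
        nth_rewrite 2 [← ENNReal.rpow_one (∫⁻ u, k u)]
        rw [← ENNReal.rpow_add_of_nonneg _ _ (by linarith) zero_le_one, sub_add_cancel]

lemma Kh_norm1 (hK : IsKernel K) (hh : BW I h) :
    ∫⁻ u : I → ℝ, ‖Kh I K h u‖ₑ = ENNReal.ofReal ((∫ z, |K z|) ^ I.card) := by
  have hKi : Integrable K := by obtain ⟨⟨KS, rfl⟩, -, -⟩ := hK; exact KS.integrable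
  have e : ∀ u : I → ℝ, ‖Kh I K h u‖ₑ = ENNReal.ofReal (∏ j : I, ((h j)⁻¹ * |K (u j / h j)|)) := by
    intro u
    rw [← ofReal_norm]; congr 1
    unfold Kh
    rw [Finset.prod_mul_distrib, norm_mul, norm_prod, ← Finset.prod_coe_sort I h, norm_inv, norm_prod,
      Finset.prod_inv_distrib]
    simp_rw [Real.norm_eq_abs]
    congr 2
    exact Finset.prod_congr rfl fun j _ => abs_of_pos (hh j j.2).1
  simp_rw [e]
  rw [lint_prod_real (fun (j : I) (s : ℝ) => (h j)⁻¹ * |K (s / h j)|)]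
  · congr 1
    rw [← Fintype.card_coe, ← Finset.card_univ, ← Finset.prod_const]
    refine Finset.prod_congr rfl fun j _ => ?_
    have hj := (hh j j.2).1
    rw [integral_const_mul, Measure.integral_comp_div (fun s => |K s|), abs_of_pos hj, smul_eq_mul,
      ← mul_assoc, inv_mul_cancel₀ hj.ne', one_mul]
  · exact fun j x => mul_nonneg (inv_pos.2 (hh j j.2).1).le (abs_nonneg _)
  · exact fun j => ((hKi.abs.comp_div (hh j j.2).1.ne').const_mul _)

lemma K_one_le (hK : IsKernel K) : 1 ≤ ∫ z, |K z| := by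
  rw [← hK.2.2]
  have hKi : Integrable K := by obtain ⟨⟨KS, rfl⟩, -, -⟩ := hK; exact KS.integrable
  exact integral_mono hKi hKi.abs fun z => le_abs_self _

lemma mean_norm (S : Std K q A lam p I) (hf : IsDensity f) (hh : BW I h) (hp : 1 < p) :
    eLpNorm (fHatMean I K f q h) p volume ≤
      ENNReal.ofReal ((∫ z, |K z|) ^ d) * eLpNorm (marginal I f) p volume := by
  have hfI := (map_res I hf).2
  have hKc : Continuous K := by obtain ⟨⟨KS, rfl⟩, -, -⟩ := S.hK; exact KS.continuous
  have hkm : Measurable fun u : I → ℝ => ‖Kh I K h u‖ₑ := by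
    have : Continuous (Kh I K h) := by unfold Kh; fun_prop
    exact this.measurable.enorm
  set g := hfI.int.aestronglyMeasurable.mk (marginal I f) with hg
  have hgm : Measurable g := hfI.int.aestronglyMeasurable.stronglyMeasurable_mk.measurable
  have hge : marginal I f =ᵐ[volume] g := hfI.int.aestronglyMeasurable.ae_eq_mk
  have hge2 : ∀ᵐ u ∂(volume : Measure (I → ℝ)), ENNReal.ofReal (marginal I f u) = ‖g u‖ₑ := by
    filter_upwards [hge] with u hu
    rw [← hu, Real.enorm_eq_ofReal (hfI.1 u)]
  have hec : ∀ a : ℝ, ‖(a : ℂ)‖ₑ = ‖a‖ₑ := fun a => by rw [← ofReal_norm, Complex.norm_real, ofReal_norm]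
  have hb : ∀ x, ‖fHatMean I K f q h x‖ₑ ≤ ∫⁻ u, ‖Kh I K h (x - u)‖ₑ * ‖g u‖ₑ := by
    intro x
    rw [mean_eq S hf hh]
    refine (enorm_integral_le_lintegral_enorm _).trans ?_
    unfold Pd
    rw [lintegral_withDensity_eq_lintegral_mul₀ hfI.int.aemeasurable.ennreal_ofReal
      (by simp only [hec]; exact (hkm.comp (by fun_prop : Measurable fun u => x - u)).aemeasurable)]
    refine le_of_eq (lintegral_congr_ae ?_)
    filter_upwards [hge2] with u hu
    simp only [Pi.mul_apply, hu, hec]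
    rw [mul_comm]
  have hcard : ENNReal.ofReal ((∫ z, |K z|) ^ I.card) ≤ ENNReal.ofReal ((∫ z, |K z|) ^ d) :=
    ENNReal.ofReal_le_ofReal (pow_le_pow_right₀ (K_one_le S.hK) (by simpa using Finset.card_le_univ I))
  refine le_trans ?_ (mul_le_mul_left hcard _)
  rw [eLpNorm_congr_ae hge]
  by_cases hpt : p = ⊤
  · subst hpt
    rw [eLpNorm_exponent_top, eLpNorm_exponent_top]
    refine essSup_le_of_ae_le _ (ae_of_all _ fun x => (hb x).trans ?_)
    calc _ ≤ ∫⁻ u, ‖Kh I K h (x - u)‖ₑ * eLpNormEssSup g volume := by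
          refine lintegral_mono_ae ?_
          filter_upwards [ae_le_eLpNormEssSup (f := g) (μ := volume)] with u hu
          gcongr
      _ = _ := by
        simp only []
        have hmu : Measurable fun u => ‖Kh I K h (x - u)‖ₑ := hkm.comp (by fun_prop : Measurable fun u => x - u)
        rw [lintegral_mul_const _ hmu,
          lintegral_sub_left_eq_self (fun u => ‖Kh I K h u‖ₑ) x, Kh_norm1 S.hK hh]
  · have hr : 1 < p.toReal := by
      rw [← ENNReal.toReal_one]; exact (ENNReal.toReal_lt_toReal (by simp) hpt).2 hp
    have h0 : p ≠ 0 := (zero_lt_one.trans hp).ne'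
    rw [eLpNorm_eq_lintegral_rpow_enorm_toReal h0 hpt, eLpNorm_eq_lintegral_rpow_enorm_toReal h0 hpt]
    have := young_p hkm hgm.enorm hr.le
    rw [Kh_norm1 S.hK hh] at this
    calc _ ≤ (ENNReal.ofReal ((∫ z, |K z|) ^ I.card) ^ p.toReal * ∫⁻ u, ‖g u‖ₑ ^ p.toReal) ^ (1 / p.toReal) := by
          gcongr
          refine le_trans (lintegral_mono fun x => ?_) this
          gcongr; exact hb x
      _ = _ := by
        rw [ENNReal.mul_rpow_of_nonneg _ _ (by positivity), ← ENNReal.rpow_mul, mul_one_div_cancel (by positivity),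
          ENNReal.rpow_one]
end

end

section

lemma sing_int {a : ℝ} (ha : 0 < a) (ha1 : a < 1) : Integrable fun y : ℝ => |y| ^ (-a) * wt 2 y := by
  have h := (integrable_fun_norm_addHaar (E := ℝ) (F := ℝ) volume (f := fun y => y ^ (-a) * (1 + y) ^ (-(2:ℝ)))).2 ?_
  · exact h
  · simp only [Module.finrank_self, Nat.sub_self, pow_zero, one_smul]
    have e : Set.Ioi (0:ℝ) = Set.Ioc 0 1 ∪ Set.Ioi 1 := (Set.Ioc_union_Ioi_eq_Ioi zero_le_one).symm
    have hm : ∀ s, AEStronglyMeasurable (fun y : ℝ => y ^ (-a) * (1 + y) ^ (-(2:ℝ))) (volume.restrict s) := fun s =>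
      (by fun_prop : Measurable fun y : ℝ => y ^ (-a) * (1 + y) ^ (-(2:ℝ))).aestronglyMeasurable
    rw [e]
    refine IntegrableOn.union ?_ ?_
    · have h1 := (intervalIntegral.intervalIntegrable_rpow' (a := 0) (b := 1) (r := -a) (by linarith)).1
      refine Integrable.mono' h1 (hm _) ?_
      filter_upwards [ae_restrict_mem measurableSet_Ioc] with y hy
      have h0 : 0 ≤ y ^ (-a) := Real.rpow_nonneg hy.1.le _
      rw [Real.norm_of_nonneg (mul_nonneg h0 (Real.rpow_nonneg (by linarith [hy.1]) _))]
      exact mul_le_of_le_one_right h0 (Real.rpow_le_one_of_one_le_of_nonpos (by linarith [hy.1]) (by norm_num))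
    · have h1 := integrableOn_Ioi_rpow_of_lt (a := -2) (by norm_num) (c := 1) one_pos
      refine Integrable.mono' h1 (hm _) ?_
      filter_upwards [ae_restrict_mem measurableSet_Ioi] with y hy
      have hy' : (1:ℝ) < y := hy
      have h0 : 0 ≤ y ^ (-a) := Real.rpow_nonneg (by linarith) _
      have h2 : 0 ≤ (1 + y) ^ (-(2:ℝ)) := Real.rpow_nonneg (by linarith) _
      rw [Real.norm_of_nonneg (mul_nonneg h0 h2)]
      refine (mul_le_of_le_one_left h2 (Real.rpow_le_one_of_one_le_of_nonpos hy'.le (by linarith))).trans ?_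
      exact Real.rpow_le_rpow_of_nonpos (by linarith) (by linarith) (by norm_num)

lemma wt_mul (r s y : ℝ) : wt (r + s) y = wt r y * wt s y := by
  unfold wt; rw [← Real.rpow_add (by positivity)]; congr 1; ring

lemma wt_half {r : ℝ} (hr : 0 ≤ r) {y z : ℝ} (h : |y| / 2 ≤ |z|) : wt r z ≤ 2 ^ r * wt r y := by
  unfold wt
  have h1 : (1 + |z|) ^ (-r) ≤ ((1 + |y|) / 2) ^ (-r) :=
    Real.rpow_le_rpow_of_nonpos (by positivity) (by linarith [abs_nonneg y]) (by linarith)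
  refine h1.trans (le_of_eq ?_)
  rw [Real.div_rpow (by positivity) (by norm_num), Real.rpow_neg (by norm_num : (0:ℝ) ≤ 2)]
  field_simp

/-- one-dimensional differenced operator -/
def op1 (Q : ℝ → ℂ) (h x : ℝ) (g : ℝ → ℂ) (s : ℝ) : ℂ :=
  if h ≤ |x| then (1/2 : ℂ) * (Q (h * s) * g s - Q (h * (s - Real.pi / x)) * g (s - Real.pi / x))
  else Q (h * s) * g s

lemma oneD (Q : SchwartzMap ℝ ℂ) (lm a : ℝ) (ha : 0 < a) (ha1 : a < 1) : ∃ C : ℝ, 0 < C ∧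
    ∀ (h l x c : ℝ) (g g' : ℝ → ℂ), 0 < h → h ≤ 1 → 0 ≤ l → l ≤ lm → 0 ≤ c →
    (∀ s, ‖g s‖ ≤ c * (1 + s ^ 2) ^ (l / 2)) → (∀ s, HasDerivAt g (g' s) s) →
    (∀ s, ‖g' s‖ * |s| ≤ c * (1 + s ^ 2) ^ (l / 2)) → ∀ s, s ≠ 0 →
    ‖op1 Q h x g s‖ ≤ c * (C * h ^ (-l) * wt a (x / h) * (|h * s| ^ (-a) * wt 2 (h * s))) := by
  obtain ⟨C, hC, hb⟩ := kern_wt (Q := Q) 4 lm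
  set E := (1 + 2 * Real.pi) ^ 2 with hE
  refine ⟨200 * E * C, by positivity, fun h l x c g g' hh hh1 hl hlm hc hg hd hg' s hs => ?_⟩
  have hpi := Real.pi_gt_three
  have hpi4 := Real.pi_le_four
  have hhl : 0 < h ^ (-l) := Real.rpow_pos_of_pos hh _
  set M := C * c * h ^ (-l) with hM
  have hM0 : 0 ≤ M := by positivity
  have hE1 : 1 ≤ E := by rw [hE]; nlinarith
  have gen : ∀ (a b : ℝ) (s : ℝ), 0 ≤ a → b ≤ c * (1 + s ^ 2) ^ (l / 2) → a * (1 + |h * s|) ^ l ≤ C * wt 4 (h * s) →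
      a * b ≤ M * wt 4 (h * s) := by
    intro a b s ha hb' hab
    calc a * b ≤ a * (c * (h ^ (-l) * (1 + |h * s|) ^ l)) := by
          gcongr; exact hb'.trans (mul_le_mul_of_nonneg_left (jap_le hh hh1 hl) hc)
      _ = c * h ^ (-l) * (a * (1 + |h * s|) ^ l) := by ring
      _ ≤ c * h ^ (-l) * (C * wt 4 (h * s)) := by gcongr
      _ = _ := by rw [hM]; ring
  have w34 : ∀ y : ℝ, wt 4 y = wt 1 y * wt 3 y := fun y => by rw [← wt_mul]; norm_num
  have w1 : ∀ y : ℝ, |y| * wt 1 y ≤ 1 := fun y => by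
    unfold wt; rw [Real.rpow_neg_one, ← div_eq_mul_inv, div_le_one (by positivity)]; linarith [abs_nonneg y]
  have wp := fun r y => (wt_pos r y).le
  have w1' := fun y => wt_le (r := 1) zero_le_one y
  set v : ℝ → ℂ := fun s => Q (h * s) * g s with hv
  have v0 : ∀ s, ‖v s‖ ≤ M * wt 4 (h * s) := fun s => by
    rw [hv]; simp only []; rw [norm_mul]; exact gen _ _ s (norm_nonneg _) (hg s) (hb _ l hlm).1
  have v1 : ∀ s, ‖v s‖ ≤ M := fun s => (v0 s).trans (mul_le_of_le_one_right hM0 (wt_le (by norm_num) _))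
  have hvd : ∀ s, HasDerivAt v ((h * deriv Q (h * s)) * g s + Q (h * s) * g' s) s := fun s => by
    have h1 : HasDerivAt (fun s : ℝ => Q (h * s)) (h * deriv Q (h * s)) s := by
      have h2 := (Q.differentiable (h * s)).hasDerivAt
      have h3 : HasDerivAt (fun s : ℝ => h * s) h s := by simpa using (hasDerivAt_id s).const_mul h
      have h4 := h2.scomp s h3
      simpa [Function.comp_def] using h4
    exact h1.mul (hd s)
  have vd : ∀ s, ‖(h * deriv Q (h * s)) * g s + Q (h * s) * g' s‖ * |s| ≤ 2 * M * wt 3 (h * s) := by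
    intro s
    have e1 := gen _ _ s (norm_nonneg _) (hg s) (hb (h * s) l hlm).2
    have e2 := gen _ _ s (norm_nonneg _) (hg' s) (hb (h * s) l hlm).1
    have e3 : |h * s| * (M * wt 4 (h * s)) ≤ M * wt 3 (h * s) := by
      rw [w34]
      calc _ = (|h * s| * wt 1 (h * s)) * (M * wt 3 (h * s)) := by ring
        _ ≤ 1 * (M * wt 3 (h * s)) := mul_le_mul_of_nonneg_right (w1 _) (mul_nonneg hM0 (wp _ _))
        _ = _ := one_mul _
    have e4 : M * wt 4 (h * s) ≤ M * wt 3 (h * s) := by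
      rw [w34]; exact mul_le_mul_of_nonneg_left (mul_le_of_le_one_left (wp _ _) (w1' _)) hM0
    calc _ ≤ (‖(h * deriv Q (h * s)) * g s‖ + ‖Q (h * s) * g' s‖) * |s| := by gcongr; exact norm_add_le _ _
      _ = |h * s| * (‖deriv Q (h * s)‖ * ‖g s‖) + ‖Q (h * s)‖ * (‖g' s‖ * |s|) := by
          rw [norm_mul, norm_mul, norm_mul, Complex.norm_real, Real.norm_of_nonneg hh.le, abs_mul, abs_of_pos hh]; ring
      _ ≤ M * wt 3 (h * s) + M * wt 3 (h * s) := by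
          exact add_le_add ((mul_le_mul_of_nonneg_left e1 (abs_nonneg _)).trans e3) (e2.trans e4)
      _ = _ := by ring
  have hs0 : 0 < |h * s| := abs_pos.2 (mul_ne_zero hh.ne' hs)
  have hsa : 0 < |h * s| ^ (-a) := Real.rpow_pos_of_pos hs0 _
  have w23 : ∀ y : ℝ, wt 3 y = wt 1 y * wt 2 y := fun y => by rw [← wt_mul]; norm_num
  have wx := wt_pos a (x / h)
  have w2 := wt_pos 2 (h * s)
  suffices hkey : ‖op1 Q h x g s‖ ≤ M * (200 * E * (wt a (x / h) * (|h * s| ^ (-a) * wt 2 (h * s)))) by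
    refine hkey.trans (le_of_eq ?_); rw [hM]; ring
  have p1 : (1:ℝ) ≤ E * 1 := by linarith
  unfold op1
  split_ifs with hx
  · have hx0 : 0 < |x| := lt_of_lt_of_le hh hx
    set τ := Real.pi / x with hτ
    have hτa : |τ| = Real.pi / |x| := by rw [hτ, abs_div, abs_of_pos (by linarith : (0:ℝ) < Real.pi)]
    have hτ0 : 0 < |τ| := by rw [hτa]; positivity
    have hsp : 0 < |s| := abs_pos.2 hs
    have ratio : (|τ| / |s|) ^ a ≤ 8 * (wt a (x / h) * |h * s| ^ (-a)) := by
      have e1 : |τ| / |s| = (Real.pi * (h / |x|)) / |h * s| := by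
        rw [hτa, abs_mul, abs_of_pos hh]; field_simp
      have e2 : Real.pi * (h / |x|) ≤ 8 * (1 + |x / h|)⁻¹ := by
        rw [abs_div, abs_of_pos hh, ← div_eq_mul_inv, mul_div_assoc', div_le_div_iff₀ hx0 (by positivity)]
        have : h * (1 + |x| / h) = h + |x| := by field_simp
        calc Real.pi * h * (1 + |x| / h) = Real.pi * (h * (1 + |x| / h)) := by ring
          _ = Real.pi * (h + |x|) := by rw [this]
          _ ≤ 8 * |x| := by nlinarith
      rw [e1]
      calc _ ≤ ((8 * (1 + |x / h|)⁻¹) / |h * s|) ^ a :=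
            Real.rpow_le_rpow (by positivity) (by gcongr) ha.le
        _ = 8 ^ a * (wt a (x / h) * |h * s| ^ (-a)) := by
            unfold wt
            rw [Real.div_rpow (by positivity) (by positivity), Real.mul_rpow (by norm_num) (by positivity),
              Real.inv_rpow (by positivity), Real.rpow_neg (by positivity), Real.rpow_neg (by positivity)]
            rw [div_eq_mul_inv]; ring
        _ ≤ 8 * (wt a (x / h) * |h * s| ^ (-a)) := by
            refine mul_le_mul_of_nonneg_right ?_ (by positivity)
            calc (8:ℝ) ^ a ≤ 8 ^ (1:ℝ) := Real.rpow_le_rpow_of_exponent_le (by norm_num) ha1.le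
              _ = 8 := Real.rpow_one _
    have hsub : ‖v s - v (s - τ)‖ ≤ M * (50 * E * ((|τ| / |s|) ^ a * wt 2 (h * s))) := by
      have hr0 : 0 < |τ| / |s| := by positivity
      by_cases hc1 : 2 * |τ| ≤ |s|
      · have hz : ∀ z ∈ Set.uIcc (s - τ) s, |s| / 2 ≤ |z| := by
          intro z hz
          have : |s - z| ≤ |τ| := by
            have := Set.abs_sub_right_of_mem_uIcc hz
            simpa using this
          have h2 := abs_sub_abs_le_abs_sub s z
          linarith
        have hD : ∀ z ∈ Set.uIcc (s - τ) s, ‖(h * deriv Q (h * z)) * g z + Q (h * z) * g' z‖ ≤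
            32 * M * wt 3 (h * s) / |s| := by
          intro z hz'
          have h1 := hz z hz'
          have h2 := vd z
          have h3 : wt 3 (h * z) ≤ 8 * wt 3 (h * s) := by
            have := wt_half (r := 3) (by norm_num) (y := h * s) (z := h * z) (by
              rw [abs_mul, abs_mul, abs_of_pos hh]; nlinarith)
            norm_num at this; exact this
          rw [le_div_iff₀ hsp]
          have h4 := norm_nonneg ((h * deriv Q (h * z)) * g z + Q (h * z) * g' z)
          nlinarith [mul_le_mul_of_nonneg_left h3 hM0]
        have h5 := Convex.norm_image_sub_le_of_norm_hasDerivWithin_le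
          (fun z _ => (hvd z).hasDerivWithinAt) hD (convex_uIcc (s - τ) s)
          Set.left_mem_uIcc Set.right_mem_uIcc
        refine h5.trans ?_
        rw [_root_.sub_sub_cancel, Real.norm_eq_abs]
        have h6 : |τ| / |s| ≤ (|τ| / |s|) ^ a := by
          calc _ = (|τ| / |s|) ^ (1:ℝ) := (Real.rpow_one _).symm
            _ ≤ _ := Real.rpow_le_rpow_of_exponent_ge hr0 (by rw [div_le_one hsp]; linarith) ha1.le
        calc 32 * M * wt 3 (h * s) / |s| * |τ| = M * (32 * 1 * ((|τ| / |s|) * wt 3 (h * s))) := by ring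
          _ ≤ M * (50 * E * ((|τ| / |s|) ^ a * wt 2 (h * s))) := by
            have q1 : (32:ℝ) * 1 ≤ 50 * E := by linarith
            have q2 : 0 ≤ wt 3 (h * s) := wp _ _
            have q3 : wt 3 (h * s) ≤ wt 2 (h * s) := by
              rw [w23]; exact mul_le_of_le_one_left w2.le (w1' _)
            exact mul_le_mul_of_nonneg_left (mul_le_mul q1 (mul_le_mul h6 q3 q2 (by positivity))
              (by positivity) (by positivity)) hM0
      · push Not at hc1
        have h1 : 1 ≤ 2 * (|τ| / |s|) ^ a := by
          have h2 : 1 ≤ 2 * (|τ| / |s|) := by rw [mul_div_assoc', le_div_iff₀ hsp]; linarith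
          calc (1:ℝ) ≤ (2 * (|τ| / |s|)) ^ a := Real.one_le_rpow h2 ha.le
            _ = 2 ^ a * (|τ| / |s|) ^ a := Real.mul_rpow (by norm_num) hr0.le
            _ ≤ 2 * (|τ| / |s|) ^ a := by
              gcongr
              calc (2:ℝ) ^ a ≤ 2 ^ (1:ℝ) := Real.rpow_le_rpow_of_exponent_le (by norm_num) ha1.le
                _ = 2 := Real.rpow_one _
        have h2 : 1 ≤ E * wt 2 (h * s) := by
          have h3 : |h * s| ≤ 2 * Real.pi := by
            rw [abs_mul, abs_of_pos hh]
            have : h * |τ| ≤ Real.pi := by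
              rw [hτa, mul_div_assoc', div_le_iff₀ hx0]; nlinarith
            nlinarith
          unfold wt
          rw [Real.rpow_neg (by positivity), ← div_eq_mul_inv, le_div_iff₀ (by positivity), one_mul, hE,
            Real.rpow_two]
          gcongr
        calc _ ≤ ‖v s‖ + ‖v (s - τ)‖ := norm_sub_le _ _
          _ ≤ M + M := add_le_add (v1 _) (v1 _)
          _ = M * (2 * (1 * 1)) := by ring
          _ ≤ M * (2 * ((2 * (|τ| / |s|) ^ a) * (E * wt 2 (h * s)))) := by gcongr
          _ = M * (4 * E * ((|τ| / |s|) ^ a * wt 2 (h * s))) := by ring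
          _ ≤ _ := by gcongr; norm_num
    have e0 : ‖(1/2 : ℂ)‖ ≤ 1 / 2 := by norm_num
    calc _ = ‖(1/2 : ℂ)‖ * ‖v s - v (s - τ)‖ := norm_mul _ _
      _ ≤ 1 / 2 * (M * (50 * E * ((8 * (wt a (x / h) * |h * s| ^ (-a))) * wt 2 (h * s)))) := by
          refine mul_le_mul e0 (hsub.trans ?_) (norm_nonneg _) (by norm_num)
          gcongr
      _ = _ := by ring
  · push Not at hx
    have h1 : 1 ≤ 2 * wt a (x / h) := by
      unfold wt
      rw [Real.rpow_neg (by positivity), ← div_eq_mul_inv, le_div_iff₀ (by positivity), one_mul]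
      have h2 : 1 + |x / h| ≤ 2 := by
        rw [abs_div, abs_of_pos hh]
        have : |x| / h ≤ 1 := by rw [div_le_one hh]; exact hx.le
        linarith
      calc _ ≤ (2:ℝ) ^ a := Real.rpow_le_rpow (by positivity) h2 ha.le
        _ ≤ 2 ^ (1:ℝ) := Real.rpow_le_rpow_of_exponent_le (by norm_num) ha1.le
        _ = 2 := Real.rpow_one _
    have h2 : wt 4 (h * s) ≤ |h * s| ^ (-a) * wt 2 (h * s) := by
      have h3 : wt 4 (h * s) = wt 2 (h * s) * wt 2 (h * s) := by rw [← wt_mul]; norm_num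
      rw [h3]
      refine mul_le_mul_of_nonneg_right ?_ w2.le
      calc wt 2 (h * s) ≤ (1 + |h * s|) ^ (-a) :=
            Real.rpow_le_rpow_of_exponent_le (by linarith [hs0]) (by linarith)
        _ ≤ _ := Real.rpow_le_rpow_of_nonpos hs0 (by linarith) (by linarith)
    calc _ ≤ M * wt 4 (h * s) := v0 s
      _ = M * (1 * 1 * (1 * wt 4 (h * s))) := by ring
      _ ≤ M * (2 * E * ((2 * wt a (x / h)) * (|h * s| ^ (-a) * wt 2 (h * s)))) := by
          have q1 : (1:ℝ) * 1 ≤ 2 * E := by linarith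
          have q2 : 0 ≤ wt 4 (h * s) := wp _ _
          exact mul_le_mul_of_nonneg_left (mul_le_mul q1 (mul_le_mul h1 h2 q2 (by positivity))
            (by positivity) (by positivity)) hM0
      _ = M * (4 * E * (wt a (x / h) * (|h * s| ^ (-a) * wt 2 (h * s)))) := by ring
      _ ≤ _ := by gcongr; norm_num

end

section

section
variable {ι : Type} [Fintype ι] [DecidableEq ι]

def Sop (Q : ℝ → ℂ) (h x : ι → ℝ) (j : ι) (ψ : (ι → ℝ) → ℂ) (t : ι → ℝ) : ℂ :=
  op1 Q (h j) (x j) (fun s => ψ (Function.update t j s)) (t j)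

def Sl (Q : ℝ → ℂ) (h x : ι → ℝ) (φ : (ι → ℝ) → ℂ) : List ι → (ι → ℝ) → ℂ
  | [] => φ
  | j :: m => Sop Q h x j (Sl Q h x φ m)

def Tl (h x : ι → ℝ) (F : (ι → ℝ) → ℂ) : List ι → (ι → ℝ) → ℂ
  | [] => F
  | j :: m => fun t => if h j ≤ |x j| then
      (1/2 : ℂ) * (Tl h x F m t - Tl h x F m (t - Pi.single j (Real.pi / x j))) else Tl h x F m t

lemma Sl_deriv (Q : ℝ → ℂ) (h x : ι → ℝ) {φ : (ι → ℝ) → ℂ} (hφ : Differentiable ℝ φ) (j : ι) (m : List ι)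
    (hj : j ∉ m) : ∀ (t : ι → ℝ) (s : ℝ), HasDerivAt (fun s => Sl Q h x φ m (Function.update t j s))
      (Sl Q h x (cpd j φ) m (Function.update t j s)) s := by
  induction m with
  | nil =>
    intro t s
    have h1 := (hφ (Function.update t j s)).hasFDerivAt
    have h2 := hasDerivAt_update t j s
    exact h1.comp_hasDerivAt s h2
  | cons i m ih =>
    rw [List.mem_cons, not_or] at hj
    have ih := ih hj.2
    intro t s
    have hc : ∀ (c s : ℝ), Function.update (Function.update t j s) i c =
        Function.update (Function.update t i c) j s := fun c s => Function.update_comm hj.1 _ _ _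
    have hi : ∀ s, Function.update t j s i = t i := fun s => Function.update_of_ne (Ne.symm hj.1) _ _
    unfold Sl Sop op1
    simp only [hi, hc]
    split_ifs
    · exact (((ih _ s).const_mul _).sub ((ih _ s).const_mul _)).const_mul _
    · exact (ih _ s).const_mul _

lemma Tl_eq (Q : ℝ → ℂ) (h x : ι → ℝ) (φ : (ι → ℝ) → ℂ) (m : List ι) (hm : m.Nodup) :
    ∀ t, Tl h x (fun t => (∏ j, Q (h j * t j)) * φ t) m t =
      (∏ j with j ∉ m, Q (h j * t j)) * Sl Q h x φ m t := by
  induction m with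
  | nil => intro t; simp [Tl, Sl]
  | cons j m ih =>
    rw [List.nodup_cons] at hm
    intro t
    have ih := ih hm.2
    have hu : ∀ (s : ℝ), (∏ i with i ∉ m, Q (h i * Function.update t j s i)) =
        (∏ i with i ∉ j :: m, Q (h i * t i)) * Q (h j * s) := by
      intro s
      have hS : (Finset.univ.filter fun i => i ∉ m) = insert j (Finset.univ.filter fun i => i ∉ j :: m) := by
        ext i; simp only [mem_filter, mem_univ, true_and, List.mem_cons, mem_insert, not_or]
        by_cases hij : i = j
        · subst hij; simp [hm.1]
        · simp [hij]
      rw [hS, Finset.prod_insert (by simp), Function.update_self, mul_comm]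
      congr 1
      refine Finset.prod_congr rfl fun i hi => ?_
      simp only [mem_filter, List.mem_cons, not_or] at hi
      rw [Function.update_of_ne hi.2.1]
    have ht : t - Pi.single j (Real.pi / x j) = Function.update t j (t j - Real.pi / x j) := by
      ext i; by_cases hij : i = j
      · subst hij; simp
      · simp [hij]
    have ht0 : Function.update t j (t j) = t := Function.update_eq_self _ _
    have hu0 := hu (t j)
    rw [ht0] at hu0
    unfold Tl Sl Sop op1
    rw [ih, ih, ht, hu, hu0]
    simp only [ht0]
    split_ifs <;> ring

lemma Tl_full (Q : ℝ → ℂ) (h x : ι → ℝ) (φ : (ι → ℝ) → ℂ) (m : List ι) (hm : m.Nodup) (hf : ∀ i, i ∈ m) (t : ι → ℝ) :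
    Tl h x (fun t => (∏ j, Q (h j * t j)) * φ t) m t = Sl Q h x φ m t := by
  rw [Tl_eq Q h x φ m hm t, Finset.filter_false_of_mem (by intro i _; simp [hf i])]
  simp

lemma Tl_ift (h x : ι → ℝ) {F : (ι → ℝ) → ℂ} (hh : ∀ j, 0 < h j) (hF : Integrable F) (m : List ι) :
    Integrable (Tl h x F m) ∧ ift (Tl h x F m) x = ift F x := by
  induction m with
  | nil => exact ⟨hF, rfl⟩
  | cons j m ih =>
    obtain ⟨i1, i2⟩ := ih
    by_cases hx : h j ≤ |x j|
    · have hx0 : x j ≠ 0 := by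
        intro h0; rw [h0, abs_zero] at hx; linarith [hh j]
      have e : Tl h x F (j :: m) = fun t => (1/2 : ℂ) * (Tl h x F m t - Tl h x F m (t - Pi.single j (Real.pi / x j))) := by
        funext t; simp only [Tl, if_pos hx]
      set σ : ι → ℝ := Pi.single j (Real.pi / x j) with hσ
      have i3 : Integrable fun t => Tl h x F m (t - σ) := i1.comp_sub_right σ
      rw [e]
      refine ⟨(i1.sub i3).const_mul _, ?_⟩
      have mulint : ∀ G : (ι → ℝ) → ℂ, Integrable G → Integrable fun t => ex (-t) x * G t := by
        intro G hG
        refine hG.bdd_mul (c := 1) ?_ (ae_of_all _ fun t => (ex_norm _ _).le)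
        have : Continuous fun t : ι → ℝ => ex (-t) x := by unfold ex dotp; fun_prop
        exact this.aestronglyMeasurable
      have eσ : ex (-σ) x = -1 := by
        rw [ex_neg_eq]
        have : dotp σ x = Real.pi := by
          unfold dotp; rw [Finset.sum_eq_single j]
          · simp [hσ]; field_simp
          · intro i _ hij; simp [hσ, hij]
          · simp
        rw [this, mul_comm, Complex.exp_neg, Complex.exp_pi_mul_I]; norm_num
      have e2 : ∫ t, ex (-t) x * Tl h x F m (t - σ) = - ift (Tl h x F m) x := by
        unfold ift
        rw [← integral_sub_right_eq_self (fun t => ex (-t) x * Tl h x F m t) σ, ← integral_neg]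
        refine integral_congr_ae (ae_of_all _ fun t => ?_)
        simp only []
        have : ex (-t) x = - ex (-(t - σ)) x := by
          have : -t = -(t - σ) + -σ := by abel
          rw [this, ex_add_left, eσ]; ring
        rw [this]; ring
      rw [← i2]
      unfold ift at e2 ⊢
      have e3 : ∀ t, ex (-t) x * ((1/2 : ℂ) * (Tl h x F m t - Tl h x F m (t - σ))) =
        (1/2 : ℂ) * (ex (-t) x * Tl h x F m t - ex (-t) x * Tl h x F m (t - σ)) := fun t => by ring
      simp_rw [e3]
      rw [integral_const_mul, integral_sub (mulint _ i1) (mulint _ i3), e2]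
      ring
    · have e : Tl h x F (j :: m) = Tl h x F m := by funext t; simp only [Tl, if_neg hx]
      rw [e]; exact ⟨i1, i2⟩

def Cls (A : ℝ) (lam : ι → ℝ) : List ι → ((ι → ℝ) → ℂ) → (ι → ℕ) → Prop
  | [], φ, α => ∀ t, ‖φ t‖ * ∏ i, |t i| ^ α i ≤ A * ∏ i, (1 + t i ^ 2) ^ (lam i / 2)
  | j :: m, φ, α => Cls A lam m φ α ∧ Differentiable ℝ φ ∧ Cls A lam m (cpd j φ) (α + Pi.single j 1)

lemma Sl_bound {Q : SchwartzMap ℝ ℂ} {lm a C A : ℝ} (hC : 0 < C) (hA : 0 < A)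
    (hone : ∀ (h l x c : ℝ) (g g' : ℝ → ℂ), 0 < h → h ≤ 1 → 0 ≤ l → l ≤ lm → 0 ≤ c →
    (∀ s, ‖g s‖ ≤ c * (1 + s ^ 2) ^ (l / 2)) → (∀ s, HasDerivAt g (g' s) s) →
    (∀ s, ‖g' s‖ * |s| ≤ c * (1 + s ^ 2) ^ (l / 2)) → ∀ s, s ≠ 0 →
    ‖op1 Q h x g s‖ ≤ c * (C * h ^ (-l) * wt a (x / h) * (|h * s| ^ (-a) * wt 2 (h * s))))
    {h x lam : ι → ℝ} (hh : ∀ j, 0 < h j ∧ h j ≤ 1) (hl : ∀ j, 0 ≤ lam j ∧ lam j ≤ lm) (m : List ι) (hm : m.Nodup) :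
    ∀ (φ : (ι → ℝ) → ℂ) (α : ι → ℕ), (∀ i ∈ m, α i = 0) → Cls A lam m φ α → ∀ t : ι → ℝ, (∀ i ∈ m, t i ≠ 0) →
    ‖Sl Q h x φ m t‖ * ∏ i, |t i| ^ α i ≤ A * ∏ i, if i ∈ m then
      C * h i ^ (-lam i) * wt a (x i / h i) * (|h i * t i| ^ (-a) * wt 2 (h i * t i)) else (1 + t i ^ 2) ^ (lam i / 2) := by
  induction m with
  | nil =>
    intro φ α _ hcls t _
    simpa [Sl] using hcls t
  | cons j m ih =>
    rw [List.nodup_cons] at hm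
    have ih := ih hm.2
    intro φ α hα ⟨c1, c2, c3⟩ t ht
    set B : List ι → ι → ℝ → ℝ := fun m i s => if i ∈ m then
      C * h i ^ (-lam i) * wt a (x i / h i) * (|h i * s| ^ (-a) * wt 2 (h i * s)) else (1 + s ^ 2) ^ (lam i / 2) with hB
    have hB0 : ∀ m i s, 0 ≤ B m i s := by
      intro m i s; simp only [hB]
      have := (hh i).1
      have h1 := wt_pos a (x i / h i)
      have h2 := wt_pos 2 (h i * s)
      split_ifs <;> positivity
    set Pα := ∏ i, |t i| ^ α i with hP
    have hP0 : 0 ≤ Pα := by positivity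
    set R := ∏ i ∈ Finset.univ.erase j, B m i (t i) with hR
    have hR0 : 0 ≤ R := Finset.prod_nonneg fun i _ => hB0 _ _ _
    have hBj : ∀ s, ∏ i, B m i (Function.update t j s i) = (1 + s ^ 2) ^ (lam j / 2) * R := by
      intro s
      rw [← Finset.mul_prod_erase _ _ (Finset.mem_univ j), Function.update_self]
      congr 1
      · simp [hB, hm.1]
      · refine Finset.prod_congr rfl fun i hi => ?_
        rw [Function.update_of_ne (Finset.ne_of_mem_erase hi)]
    have hPj : ∀ (k : ℕ) (s : ℝ), ∏ i, |Function.update t j s i| ^ ((α + Pi.single j k : ι → ℕ) i) = Pα * |s| ^ k := by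
      intro k s
      rw [hP, ← Finset.mul_prod_erase _ _ (Finset.mem_univ j),
        ← Finset.mul_prod_erase _ (fun i => |t i| ^ α i) (Finset.mem_univ j)]
      simp only [Function.update_self, Pi.add_apply, Pi.single_eq_same, hα j (by simp), zero_add, pow_zero, one_mul]
      rw [mul_comm]; congr 1
      refine Finset.prod_congr rfl fun i hi => ?_
      have hi := Finset.ne_of_mem_erase hi
      rw [Function.update_of_ne hi, Pi.single_eq_of_ne hi, add_zero]
    have hnz : ∀ s, ∀ i ∈ m, Function.update t j s i ≠ 0 := by
      intro s i hi
      have : i ≠ j := fun h => hm.1 (h ▸ hi)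
      rw [Function.update_of_ne this]; exact ht i (by simp [hi])
    rcases hP0.eq_or_lt with hP1 | hP1
    · rw [← hP1, mul_zero]
      exact mul_nonneg hA.le (Finset.prod_nonneg fun i _ => hB0 (j :: m) i (t i))
    set c := A * R / Pα with hc
    have g1 : ∀ s, ‖Sl Q h x φ m (Function.update t j s)‖ ≤ c * (1 + s ^ 2) ^ (lam j / 2) := by
      intro s
      have := ih φ α (fun i hi => hα i (by simp [hi])) c1 (Function.update t j s) (hnz s)
      have e1 := hPj 0 s
      rw [Pi.single_zero, add_zero, pow_zero, mul_one] at e1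
      rw [e1] at this
      have e2 := hBj s
      simp only [hB] at e2
      rw [e2] at this
      rw [hc, div_mul_eq_mul_div, le_div_iff₀ hP1]
      exact this.trans (le_of_eq (by ring))
    have g2 : ∀ s, ‖Sl Q h x (cpd j φ) m (Function.update t j s)‖ * |s| ≤ c * (1 + s ^ 2) ^ (lam j / 2) := by
      intro s
      have := ih (cpd j φ) (α + Pi.single j 1) (fun i hi => by
        have : i ≠ j := fun h => hm.1 (h ▸ hi)
        rw [Pi.add_apply, Pi.single_eq_of_ne this, add_zero]; exact hα i (by simp [hi])) c3 (Function.update t j s) (hnz s)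
      rw [hPj 1 s, pow_one] at this
      have e2 := hBj s
      simp only [hB] at e2
      rw [e2] at this
      rw [hc, div_mul_eq_mul_div, le_div_iff₀ hP1]
      exact (le_of_eq (by ring)).trans (this.trans (le_of_eq (by ring)))
    have := hone (h j) (lam j) (x j) c _ _ (hh j).1 (hh j).2 (hl j).1 (hl j).2 (by positivity) g1
      (fun s => Sl_deriv Q h x c2 j m hm.1 t s) g2 (t j) (ht j (by simp))
    have e3 : ∏ i, B (j :: m) i (t i) = B (j :: m) j (t j) * R := by
      rw [← Finset.mul_prod_erase _ _ (Finset.mem_univ j)]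
      congr 1
      refine Finset.prod_congr rfl fun i hi => ?_
      have hi := Finset.ne_of_mem_erase hi
      simp [hB, hi]
    have e4 : B (j :: m) j (t j) = C * h j ^ (-lam j) * wt a (x j / h j) * (|h j * t j| ^ (-a) * wt 2 (h j * t j)) := by
      simp [hB]
    have e5 : (∏ i, if i ∈ j :: m then
      C * h i ^ (-lam i) * wt a (x i / h i) * (|h i * t i| ^ (-a) * wt 2 (h i * t i)) else (1 + t i ^ 2) ^ (lam i / 2)) =
      ∏ i, B (j :: m) i (t i) := rfl
    rw [e5, e3, e4]
    calc _ ≤ c * (C * h j ^ (-lam j) * wt a (x j / h j) * (|h j * t j| ^ (-a) * wt 2 (h j * t j))) * Pα :=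
          mul_le_mul_of_nonneg_right this hP0
      _ = _ := by rw [hc]; field_simp

lemma cpd_cd {k : ℕ} {φ : (ι → ℝ) → ℂ} (j : ι) (h : ContDiff ℝ (k + 1 : ℕ) φ) : ContDiff ℝ k (cpd j φ) := by
  unfold cpd
  exact (h.fderiv_right (m := k) (by norm_cast)).clm_apply contDiff_const

lemma Cls_of (A : ℝ) (lam : ι → ℝ) (φ0 : (ι → ℝ) → ℂ) (L : List ι) (hL : L.Nodup)
    (hB : ∀ α : ι → ℕ, (∀ i, α i ≤ 1) → ∀ t, ‖L.foldr (fun j ψ => (cpd j)^[α j] ψ) φ0 t‖ * ∏ i, |t i| ^ α i ≤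
      A * ∏ i, (1 + t i ^ 2) ^ (lam i / 2)) (l1 : List ι) : ∀ (l2 : List ι) (α : ι → ℕ), L = l1 ++ l2 →
    (∀ i, α i ≤ 1) → (∀ i ∈ l1, α i = 0) →
    ContDiff ℝ l1.length (l2.foldr (fun j ψ => (cpd j)^[α j] ψ) φ0) →
    Cls A lam l1.reverse (l2.foldr (fun j ψ => (cpd j)^[α j] ψ) φ0) α := by
  induction l1 using List.reverseRecOn with
  | nil =>
    intro l2 α hl hα1 _ _
    simp only [List.nil_append] at hl
    subst hl
    simpa [Cls] using hB α hα1
  | append_singleton l' j ih =>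
    intro l2 α hl hα1 hα0 hcd
    have hl2 : L = l' ++ (j :: l2) := by rw [hl]; simp
    have hnd : j ∉ l' ∧ j ∉ l2 := by
      rw [hl2] at hL
      have h1 := List.nodup_middle.1 hL
      rw [List.nodup_cons, List.mem_append, not_or] at h1
      exact h1.1
    have hlen : (l' ++ [j]).length = l'.length + 1 := by simp
    rw [hlen] at hcd
    have hj0 : α j = 0 := hα0 j (by simp)
    rw [List.reverse_append, List.reverse_singleton, List.singleton_append]
    refine ⟨?_, hcd.differentiable (by norm_num), ?_⟩
    · have := ih (j :: l2) α hl2 hα1 (fun i hi => hα0 i (by simp [hi]))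
      simp only [List.foldr_cons, hj0, Function.iterate_zero, id] at this
      exact this (hcd.of_le (by norm_cast; omega))
    · set α' := α + Pi.single j 1 with hα'
      have e1 : ∀ i, i ≠ j → α' i = α i := fun i hi => by simp [hα', Pi.single_eq_of_ne hi]
      have e2 : α' j = 1 := by simp [hα', hj0]
      have e3 : l2.foldr (fun j ψ => (cpd j)^[α' j] ψ) φ0 = l2.foldr (fun j ψ => (cpd j)^[α j] ψ) φ0 := by
        refine List.foldr_ext _ _ _ fun i hi ψ => ?_
        rw [e1 i (fun h => hnd.2 (h ▸ hi))]
      have := ih (j :: l2) α' hl2 (fun i => by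
          by_cases hi : i = j
          · rw [hi, e2]
          · rw [e1 i hi]; exact hα1 i) (fun i hi => by
            rw [e1 i (fun h => hnd.1 (h ▸ hi))]; exact hα0 i (by simp [hi]))
      simp only [List.foldr_cons, e2, Function.iterate_one, e3] at this
      exact this (cpd_cd j hcd)
end

end

section

variable {d : ℕ} {K : ℝ → ℝ} {q : (Fin d → ℝ) → ℝ} {A : ℝ} {lam : Fin d → ℝ} {p : ℝ≥0∞}
  {I : Finset (Fin d)} {h : Fin d → ℝ}

lemma L_pt (S : Std K q A lam p I) (hp2 : p ≠ 2) (hpt : p ≠ ⊤) {a : ℝ} (ha : 0 < a) (ha1 : a < 1) :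
    ∃ C : ℝ, 0 < C ∧ ∀ h, BW I h → ∀ x, ‖Lh I K q h x‖ ≤ C * (La lam I h)⁻¹ * (Hp I h)⁻¹ * ∏ j : I, wt a (x j / h j) := by
  obtain ⟨Q, hQ, -⟩ := kern_ex S.hK
  obtain ⟨C, hC, hone⟩ := oneD Q (∑ i, |lam i|) a ha ha1
  obtain ⟨hA, hl, -, -, hmid, -⟩ := S.hN
  obtain ⟨hq0, hcd, hmb⟩ := hmid hp2 hpt
  obtain ⟨C1, hC1, hGi⟩ := G_int S
  set J := ∫ y : ℝ, |y| ^ (-a) * wt 2 y with hJ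
  have hJ0 : 0 ≤ J := integral_nonneg fun y => mul_nonneg (by positivity) (wt_pos _ _).le
  set c := (2 * Real.pi) ^ (-(I.card : ℝ)) with hc
  have c0 : 0 < c := by positivity
  refine ⟨c * (A * (C ^ I.card * J ^ I.card)) + 1, by positivity, fun h hh x => ?_⟩
  set φ0 : (I → ℝ) → ℂ := fun t => (ftI (marginal I q) t)⁻¹ with hφ0
  set m := (Finset.univ (α := I)).toList with hm
  have hnd : m.Nodup := Finset.nodup_toList _
  have hlen : m.length = I.card := by rw [hm, Finset.length_toList, Finset.card_univ, Fintype.card_coe]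
  have hcls : Cls A (fun j : I => lam j) m.reverse φ0 0 := by
    refine Cls_of A (fun j : I => lam j) φ0 m hnd ?_ m [] 0 (by simp) (by simp) (by simp) ?_
    · intro α hα t
      have := hmb α ((Finset.sum_le_sum fun i _ => hα i).trans (by simp)) t
      rw [norm_mul, norm_prod] at this
      simp only [norm_pow, Complex.norm_real, Real.norm_eq_abs] at this
      exact this
    · rw [hlen]; exact hcd
  have hmem : ∀ i : I, i ∈ m.reverse := by simp [hm]
  have hG : Gh I K q h = fun t => (∏ j : I, Q (h j * t j)) * φ0 t := by
    funext t; unfold Gh; rw [ft_Kh I hQ h (fun j hj => (hh j hj).1)]; rfl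
  have hT := Tl_ift (fun j : I => h j) x (fun j => (hh j j.2).1) (hGi h hh).1 m.reverse
  have hTS : ∀ t, Tl (fun j : I => h j) x (Gh I K q h) m.reverse t = Sl Q (fun j : I => h j) x φ0 m.reverse t := by
    intro t
    rw [hG, Tl_full Q (fun j : I => h j) x φ0 m.reverse (List.nodup_reverse.2 hnd) hmem t]
  set Ω : I → ℝ → ℝ := fun i s => C * h i ^ (-lam i) * wt a (x i / h i) * (|h i * s| ^ (-a) * wt 2 (h i * s)) with hΩ
  have hΩi : ∀ i, Integrable (Ω i) := fun i =>
    ((integrable_comp_mul_left_iff (fun y => |y| ^ (-a) * wt 2 y) (hh i i.2).1.ne').2 (sing_int ha ha1)).const_mul _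
  have hΩe : ∀ i, ∫ s, Ω i s = C * h i ^ (-lam i) * wt a (x i / h i) * ((h i)⁻¹ * J) := by
    intro i
    simp only [hΩ]
    rw [integral_const_mul, Measure.integral_comp_mul_left (fun y => |y| ^ (-a) * wt 2 y), smul_eq_mul,
      abs_of_pos (inv_pos.2 (hh i i.2).1)]
  have hae : ∀ᵐ t : I → ℝ, ∀ i, t i ≠ 0 := by
    rw [ae_all_iff]; intro i
    exact (Measure.tendsto_eval_ae_ae (μ := fun _ : I => (volume : Measure ℝ)) (i := i)).eventually
      (Measure.ae_ne volume 0)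
  have hpt' : ∀ᵐ t : I → ℝ, ‖Tl (fun j : I => h j) x (Gh I K q h) m.reverse t‖ ≤ A * ∏ i, Ω i (t i) := by
    filter_upwards [hae] with t ht
    have := Sl_bound (Q := Q) hC hA hone (h := fun j : I => h j) (x := x) (lam := fun j : I => lam j)
      (fun j => hh j j.2) (fun j => ⟨(hl j).le, lamMax_ge _⟩) m.reverse (List.nodup_reverse.2 hnd) φ0 0 (by simp) hcls t
      (fun i _ => ht i)
    simp only [Pi.zero_apply, pow_zero, Finset.prod_const_one, mul_one, hmem, if_true] at this
    rw [hTS]; exact this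
  have hint : Integrable fun t : I → ℝ => A * ∏ i, Ω i (t i) := (Integrable.fintype_prod hΩi).const_mul _
  have h1 : ‖ift (Gh I K q h) x‖ ≤ A * ∏ i, ∫ s, Ω i s := by
    rw [← hT.2]
    refine (ift_norm_le _ _).trans ?_
    rw [← integral_fintype_prod_volume_eq_prod, ← integral_const_mul]
    exact integral_mono_ae hT.1.norm hint hpt'
  have h2 : ∏ i, ∫ s, Ω i s = C ^ I.card * J ^ I.card * ((La lam I h)⁻¹ * (Hp I h)⁻¹ * ∏ j : I, wt a (x j / h j)) := by
    simp_rw [hΩe]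
    unfold La Hp
    rw [← Finset.prod_coe_sort I h, ← Finset.prod_coe_sort I (fun j => h j ^ lam j), ← Finset.prod_inv_distrib,
      ← Finset.prod_inv_distrib]
    simp only [Finset.prod_mul_distrib, Finset.prod_const, Finset.card_univ, Fintype.card_coe]
    have : ∏ i : I, h i ^ (-lam i) = ∏ i : I, (h i ^ lam i)⁻¹ :=
      Finset.prod_congr rfl fun i _ => Real.rpow_neg (hh i i.2).1.le _
    rw [this]; ring
  have hL := La_pos (lam := lam) hh
  have hH := Hp_pos hh
  have hw : 0 ≤ ∏ j : I, wt a (x j / h j) := Finset.prod_nonneg fun j _ => (wt_pos _ _).le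
  rw [Lh_eq, norm_mul, Complex.norm_real, Real.norm_of_nonneg c0.le]
  calc _ ≤ c * (A * (C ^ I.card * J ^ I.card * ((La lam I h)⁻¹ * (Hp I h)⁻¹ * ∏ j : I, wt a (x j / h j)))) := by
        rw [← h2]; gcongr
    _ = (c * (A * (C ^ I.card * J ^ I.card))) * ((La lam I h)⁻¹ * (Hp I h)⁻¹ * ∏ j : I, wt a (x j / h j)) := by ring
    _ ≤ (c * (A * (C ^ I.card * J ^ I.card)) + 1) * ((La lam I h)⁻¹ * (Hp I h)⁻¹ * ∏ j : I, wt a (x j / h j)) := by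
        gcongr; linarith
    _ = _ := by ring

/-- `L_s` bound of the kernel -/
lemma L_decay (S : Std K q A lam p I) (hp2 : p ≠ 2) (hpt : p ≠ ⊤) {s : ℝ} (hs : 1 < s) :
    ∃ C : ℝ, 0 < C ∧ ∀ h, BW I h → ∫⁻ x, ‖Lh I K q h x‖ₑ ^ s ≤
      ENNReal.ofReal ((C * (La lam I h)⁻¹ * Hp I h ^ (-1 + 1 / s)) ^ s) := by
  have hs0 : 0 < s := by linarith
  set a := (1 + 1 / s) / 2 with ha
  have h1s : 0 < 1 / s ∧ 1 / s < 1 := ⟨by positivity, by rw [div_lt_one hs0]; exact hs⟩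
  have has : 1 < a * s := by rw [ha]; field_simp; linarith
  obtain ⟨C, hC, hb⟩ := L_pt S hp2 hpt (a := a) (by rw [ha]; linarith) (by rw [ha]; linarith)
  set J := ∫ y, wt (a * s) y with hJ
  have hJ0 : 0 ≤ J := integral_nonneg fun y => (wt_pos _ _).le
  refine ⟨C * ((J + 1) ^ I.card) ^ (1 / s), by positivity, fun h hh => ?_⟩
  have hL := La_pos (lam := lam) hh
  have hH := Hp_pos hh
  have hi : ∀ i : I, Integrable fun y : ℝ => wt (a * s) (y / h i) := fun i => by
    simpa [div_eq_inv_mul] using (integrable_comp_mul_left_iff (wt (a * s)) (inv_ne_zero (hh i i.2).1.ne')).2 (wt_int has)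
  have he : ∀ i : I, ∫ y : ℝ, wt (a * s) (y / h i) = h i * J := fun i => by
    rw [Measure.integral_comp_div, smul_eq_mul, abs_of_pos (hh i i.2).1]
  set D := C * (La lam I h)⁻¹ * (Hp I h)⁻¹ with hD
  have hD0 : 0 < D := by positivity
  calc ∫⁻ x, ‖Lh I K q h x‖ₑ ^ s ≤ ∫⁻ x : I → ℝ, ENNReal.ofReal (D ^ s) * ENNReal.ofReal (∏ j : I, wt (a * s) (x j / h j)) := by
        refine lintegral_mono fun x => ?_
        rw [enorm_rpow_eq _ hs0.le, ← ENNReal.ofReal_mul (by positivity)]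
        refine ENNReal.ofReal_le_ofReal ?_
        have hw : 0 ≤ ∏ j : I, wt a (x j / h j) := Finset.prod_nonneg fun j _ => (wt_pos _ _).le
        refine (Real.rpow_le_rpow (norm_nonneg _) (hb h hh x) hs0.le).trans (le_of_eq ?_)
        rw [Real.mul_rpow hD0.le hw, ← Real.finsetProd_rpow _ _ fun j _ => (wt_pos _ _).le]
        congr 1
        refine Finset.prod_congr rfl fun j _ => ?_
        unfold wt; rw [← Real.rpow_mul (by positivity)]; congr 1; ring
    _ = ENNReal.ofReal (D ^ s * (Hp I h * J ^ I.card)) := by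
        rw [lintegral_const_mul' _ _ ENNReal.ofReal_ne_top,
          lint_prod_real (fun (j : I) y => wt (a * s) (y / h j)) (fun _ _ => (wt_pos _ _).le) hi,
          ← ENNReal.ofReal_mul (by positivity)]
        congr 2
        simp_rw [he]
        rw [Finset.prod_mul_distrib, Finset.prod_const, Finset.card_univ, Fintype.card_coe]
        unfold Hp; rw [← Finset.prod_coe_sort I h]
    _ ≤ _ := by
        refine ENNReal.ofReal_le_ofReal ?_
        have e : (C * ((J + 1) ^ I.card) ^ (1 / s) * (La lam I h)⁻¹ * Hp I h ^ (-1 + 1 / s)) ^ s =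
            D ^ s * (Hp I h * (J + 1) ^ I.card) := by
          have : C * ((J + 1) ^ I.card) ^ (1 / s) * (La lam I h)⁻¹ * Hp I h ^ (-1 + 1 / s) =
            D * (Hp I h * (J + 1) ^ I.card) ^ (1 / s) := by
            rw [Real.mul_rpow hH.le (by positivity), Real.rpow_add hH, Real.rpow_neg_one, hD]; ring
          rw [this, Real.mul_rpow hD0.le (by positivity), ← Real.rpow_mul (by positivity), one_div_mul_cancel hs0.ne',
            Real.rpow_one]
        rw [e]
        gcongr; linarith

end

section

variable {d : ℕ} {K : ℝ → ℝ} {q f : (Fin d → ℝ) → ℝ} {A : ℝ} {lam : Fin d → ℝ} {p : ℝ≥0∞}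
  {I : Finset (Fin d)} {h : Fin d → ℝ}

/-- tail control of the stochastic error at level `γ U` -/
def TailW (p : ℝ≥0∞) (I : Finset (Fin d)) (K : ℝ → ℝ) (f q : (Fin d → ℝ) → ℝ) (h : Fin d → ℝ) (n : ℕ)
    (U : ℝ≥0∞) (γ ρ e : ℝ) : Prop :=
  ∃ W : (Fin n → Fin d → ℝ) → ℝ≥0∞, Measurable W ∧
    (∀ y, ENNReal.ofReal γ * U < eLpNorm (xiProc I K f q h y) p volume →
      eLpNorm (xiProc I K f q h y) p volume ^ ρ ≤ W y) ∧
    ∫⁻ y, W y ∂obsMeasure d n f q ≤ ENNReal.ofReal e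

lemma TailW.mono {n : ℕ} {U U' : ℝ≥0∞} {γ ρ e e' : ℝ} (H : TailW p I K f q h n U γ ρ e) (hU : U ≤ U')
    (he : e ≤ e') : TailW p I K f q h n U' γ ρ e' := by
  obtain ⟨W, h1, h2, h3⟩ := H
  exact ⟨W, h1, fun y hy => h2 y (lt_of_le_of_lt (by gcongr) hy), h3.trans (ENNReal.ofReal_le_ofReal he)⟩

/-- variance-type conditions for the kernel -/
structure KC (I : Finset (Fin d)) (K : ℝ → ℝ) (f q : (Fin d → ℝ) → ℝ) (h : Fin d → ℝ) (P b σ v : ℝ) : Prop where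
  b0 : 0 ≤ b
  σ0 : 0 ≤ σ
  v0 : 0 ≤ v
  hb : Fp volume P (Lh I K q h) ≤ ENNReal.ofReal (b ^ P)
  hσ : ∀ g : (I → ℝ) → ℂ, Measurable g → ∫⁻ x, ‖g x‖ₑ ^ (P / (P - 1)) ≠ ⊤ →
      ∫⁻ y, ‖∫ x, g x * Lh I K q h (x - res I y)‖ₑ ^ (2 : ℝ) ∂(Pd q ∗ Pd f) ≤
        ENNReal.ofReal σ * (∫⁻ x, ‖g x‖ₑ ^ (P / (P - 1))) ^ (2 * (P - 1) / P)
  hv : 2 < P → ∫⁻ x, (∫⁻ y, ‖Lh I K q h (x - res I y)‖ₑ ^ (2 : ℝ) ∂(Pd q ∗ Pd f)) ^ (P / 2) ≤ ENNReal.ofReal (v ^ (P / 2))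

lemma xi_eq (hf : IsDensity f) (hq : IsDensity q) {n : ℕ} (hn : 1 ≤ n) (y : Fin n → Fin d → ℝ) (x : I → ℝ) :
    xiProc I K f q h y x = (n:ℂ)⁻¹ * (∑ k, fun x => (Lh I K q h (x - res I (y k)) -
      ∫ y', Lh I K q h (x - res I y') ∂(Pd q ∗ Pd f))) x := by
  have hn0 : (n:ℂ) ≠ 0 := by norm_cast; omega
  unfold xiProc fHat fHatMean
  rw [law_eq hf hq, Finset.sum_apply, Finset.sum_sub_distrib, mul_sub]
  congr 1
  rw [Finset.sum_const, Finset.card_univ, Fintype.card_fin, nsmul_eq_mul, ← mul_assoc, inv_mul_cancel₀ hn0, one_mul]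
  rfl

lemma pow_tail {X a : ℝ≥0∞} {ρ m : ℝ} (hρ : 0 < ρ) (hm : ρ ≤ m) (ha0 : a ≠ 0) (ha : a ≠ ⊤) (h : a < X) :
    X ^ ρ ≤ X ^ m * a ^ (ρ - m) := by
  have hm0 : 0 < m := by linarith
  by_cases hX : X = ⊤
  · rw [hX, ENNReal.top_rpow_of_pos hρ, ENNReal.top_rpow_of_pos hm0, ENNReal.top_mul]
    exact (ENNReal.rpow_pos (pos_iff_ne_zero.2 ha0) ha).ne'
  · have hX0 : X ≠ 0 := (lt_of_le_of_lt bot_le h).ne'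
    calc X ^ ρ = X ^ m * X ^ (ρ - m) := by rw [← ENNReal.rpow_add _ _ hX0 hX]; congr 1; ring
      _ ≤ _ := by
        refine mul_le_mul_right ?_ _
        rw [show ρ - m = -(m - ρ) by ring, ENNReal.rpow_neg, ENNReal.rpow_neg, ENNReal.inv_le_inv]
        exact ENNReal.rpow_le_rpow h.le (by linarith)

lemma log_one_le {n : ℕ} (hn : 3 ≤ n) : 1 ≤ Real.log n := by
  rw [Real.le_log_iff_exp_le (by positivity)]
  have : (3:ℝ) ≤ n := by exact_mod_cast hn
  linarith [Real.exp_one_lt_d9]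

lemma Fp_sum_meas {X Ω : Type} [MeasurableSpace X] [MeasurableSpace Ω] (ν : Measure X) [SFinite ν] (P : ℝ)
    {Z : Ω → X → ℂ} (hZ : Measurable (Function.uncurry Z)) (n : ℕ) :
    Measurable fun y : Fin n → Ω => Fp ν P (∑ k, Z (y k)) := by
  have h2 : Measurable fun z : (Fin n → Ω) × X => ∑ k, Z (z.1 k) z.2 := by
    refine Finset.measurable_sum _ fun k _ => ?_
    have : Measurable fun z : (Fin n → Ω) × X => (z.1 k, z.2) := by fun_prop
    exact hZ.comp this
  have h3 := (h2.enorm.pow_const P).lintegral_prod_right' (ν := ν)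
  unfold Fp
  simp only [Finset.sum_apply]
  exact h3

set_option maxHeartbeats 1000000 in
lemma tail_core (P : ℝ) (hP : 1 < P) (C0 U0 ρ β : ℝ) (hC0 : 1 ≤ C0) (hU0 : 0 < U0) (hρ : 0 < ρ) : ∃ γ C : ℝ, 1 ≤ γ ∧ 0 < C ∧
    ∀ (K : ℝ → ℝ) (q f : (Fin d → ℝ) → ℝ) (I : Finset (Fin d)) (h : Fin d → ℝ) (n : ℕ) (U b σ v : ℝ), IsDensity f → IsDensity q →
    3 ≤ n → 0 < U → U ≤ U0 → Continuous (Lh I K q h) → (∃ c, ∀ x, ‖Lh I K q h x‖ ≤ c) → KC I K f q h P b σ v →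
    n * (2 * b) ^ P ≤ (C0 * (n * U)) ^ P → (2 < P → n * (4 * v) ≤ (C0 * (n * U)) ^ 2) →
    Real.log n * b ≤ C0 * (n * U) → Real.log n * n * σ ≤ C0 * (n * U) ^ 2 →
    TailW (ENNReal.ofReal P) I K f q h n (ENNReal.ofReal U) γ ρ (C * (n:ℝ) ^ (-β)) := by
  set κ := max 1 (ρ / P) with hκ
  have hκ1 : 1 ≤ κ := le_max_left _ _
  have hP0 : 0 < P := by linarith
  obtain ⟨c, hc⟩ := core_moment P (4 * κ) hP
  set γ := C0 * Real.exp ((|c| + |β|) / P) with hγ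
  have hγ1 : 1 ≤ γ := by
    rw [hγ]; exact one_le_mul_of_one_le_of_one_le hC0 (Real.one_le_exp (by positivity))
  refine ⟨γ, (γ * U0) ^ ρ, hγ1, by positivity, ?_⟩
  intro K q f I h n U b σ v hf hq hn hU hUU hLc ⟨cL, hLb⟩ hkc A1 A2 A3 A4
  have hlog := log_one_le hn
  have hn0 : (0:ℝ) < n := by positivity
  set M := κ * Real.log n with hM
  have hM0 : 0 < M := by positivity
  have hPM : ρ ≤ P * M := by
    calc ρ = P * (ρ / P) := by field_simp
      _ ≤ P * κ := by gcongr; exact le_max_right _ _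
      _ ≤ P * M := by gcongr; rw [hM]; exact le_mul_of_one_le_right (by linarith) hlog
  have := hf.prob
  have := hq.prob
  set μ := Pd q ∗ Pd f with hμ
  set ζ : (Fin d → ℝ) → (I → ℝ) → ℂ := fun y x => Lh I K q h (x - res I y) with hζ
  have hres : Continuous (res I) := by unfold res; fun_prop
  have hζm : Measurable (Function.uncurry ζ) := by
    have : Continuous (Function.uncurry ζ) := by
      simp only [hζ, Function.uncurry_def]; fun_prop
    exact this.measurable
  have hcore := core_center volume μ P hP ζ b σ v hζm hkc.b0 hkc.σ0 hkc.v0 (fun y => by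
      refine le_trans (le_of_eq ?_) hkc.hb
      unfold Fp
      exact lintegral_sub_right_eq_self (fun x => ‖Lh I K q h x‖ₑ ^ P) (res I y))
    (fun x => by
      refine Integrable.of_bound (hζm.of_uncurry_right).aestronglyMeasurable cL (ae_of_all _ fun y => hLb _))
    hkc.hσ hkc.hv
  set R := C0 * (n * U) with hR
  have hR0 : 0 < R := by positivity
  have hmom := hc volume μ _ _ _ _ hcore R M n hR0 hM0.le (by omega) A1 A2
    (by
      rw [mul_div_assoc', div_le_iff₀ hR0, hM]
      calc κ * Real.log n * (2 * b) = 2 * κ * (Real.log n * b) := by ring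
        _ ≤ 2 * κ * R := by gcongr
        _ ≤ 4 * κ * R := by gcongr; norm_num)
    (by
      rw [mul_div_assoc', div_le_div_iff₀ (by positivity) hn0, hM]
      calc κ * Real.log n * (4 * σ) * n = 4 * κ * (Real.log n * n * σ) := by ring
        _ ≤ 4 * κ * (C0 * (n * U) ^ 2) := by gcongr
        _ ≤ 4 * κ * R ^ 2 := by
          rw [hR, mul_pow]; gcongr; nlinarith)
  set T : (Fin n → Fin d → ℝ) → ℝ≥0∞ := fun y => Fp volume P (∑ k, fun x => ζ (y k) x - ∫ y', ζ y' x ∂μ) with hT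
  have hTm : Measurable T := Fp_sum_meas volume P hcore.meas n
  have hXT : ∀ y, eLpNorm (xiProc I K f q h y) (ENNReal.ofReal P) volume ^ P = ENNReal.ofReal ((n:ℝ)⁻¹ ^ P) * T y := by
    intro y
    rw [eLpNorm_eq_lintegral_rpow_enorm_toReal (by simpa using hP0) ENNReal.ofReal_ne_top, ENNReal.toReal_ofReal hP0.le,
      ← ENNReal.rpow_mul, one_div_mul_cancel hP0.ne', ENNReal.rpow_one]
    simp only [hT, Fp]
    rw [← lintegral_const_mul' _ _ ENNReal.ofReal_ne_top]
    refine lintegral_congr fun x => ?_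
    rw [xi_eq hf hq (by omega), enorm_mul, ENNReal.mul_rpow_of_nonneg _ _ hP0.le, enorm_rpow_eq _ hP0.le]
    simp
    rfl
  have hXM : ∀ y, eLpNorm (xiProc I K f q h y) (ENNReal.ofReal P) volume ^ (P * M) =
      ENNReal.ofReal ((n:ℝ)⁻¹ ^ (P * M)) * T y ^ M := by
    intro y
    rw [ENNReal.rpow_mul, hXT, ENNReal.mul_rpow_of_nonneg _ _ hM0.le, ENNReal.ofReal_rpow_of_nonneg (by positivity) hM0.le,
      ← Real.rpow_mul (by positivity)]
  have ha : ENNReal.ofReal γ * ENNReal.ofReal U = ENNReal.ofReal (γ * U) := (ENNReal.ofReal_mul (by positivity)).symm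
  have hγU : 0 < γ * U := by positivity
  refine ⟨fun y => ENNReal.ofReal ((n:ℝ)⁻¹ ^ (P * M)) * T y ^ M * ENNReal.ofReal ((γ * U) ^ (ρ - P * M)),
    ((hTm.pow_const M).const_mul _).mul_const _, fun y hy => ?_, ?_⟩
  · rw [ha] at hy
    have := pow_tail hρ hPM (by simpa using hγU) ENNReal.ofReal_ne_top hy
    rwa [hXM, ENNReal.ofReal_rpow_of_pos hγU] at this
  · rw [lintegral_mul_const' _ _ ENNReal.ofReal_ne_top, lintegral_const_mul' _ _ ENNReal.ofReal_ne_top]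
    have e1 : obsMeasure d n f q = Measure.pi fun _ => μ := by unfold obsMeasure; rw [law_eq hf hq]
    rw [e1]
    refine (mul_le_mul_left (mul_le_mul_right hmom _) _).trans ?_
    rw [← ENNReal.ofReal_mul (by positivity), ← ENNReal.ofReal_mul (by positivity)]
    refine ENNReal.ofReal_le_ofReal ?_
    have e2 : (n:ℝ)⁻¹ ^ (P * M) * (R ^ (P * M) * Real.exp (c * M)) * (γ * U) ^ (ρ - P * M) =
        (γ * U) ^ ρ * ((C0 / γ) ^ (P * M) * Real.exp (c * M)) := by
      rw [Real.rpow_sub hγU, hR, Real.mul_rpow (by positivity) (by positivity), Real.mul_rpow (by positivity) hU.le,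
        Real.inv_rpow hn0.le, Real.mul_rpow (x := γ) (y := U) (by positivity) hU.le, Real.div_rpow (by positivity) (by positivity),
        Real.mul_rpow (x := γ) (y := U) (by positivity) hU.le]
      have : U ^ (P * M) ≠ 0 := (Real.rpow_pos_of_pos hU _).ne'
      have : (n:ℝ) ^ (P * M) ≠ 0 := (Real.rpow_pos_of_pos hn0 _).ne'
      field_simp
    rw [e2]
    have e3 : (C0 / γ) ^ (P * M) = Real.exp (-(|c| + |β|) * M) := by
      have : C0 / γ = Real.exp (-((|c| + |β|) / P)) := by
        rw [hγ, Real.exp_neg]; field_simp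
      rw [this, ← Real.exp_mul]; congr 1; field_simp
    rw [e3, ← Real.exp_add, Real.rpow_def_of_pos hn0]
    have e4 : Real.exp (-(|c| + |β|) * M + c * M) ≤ Real.exp (Real.log n * -β) := by
      refine Real.exp_le_exp.2 ?_
      have h1 : c * M ≤ |c| * M := by gcongr; exact le_abs_self _
      have h2 : β * Real.log n ≤ |β| * M := by
        calc β * Real.log n ≤ |β| * Real.log n := by gcongr; exact le_abs_self _
          _ ≤ |β| * M := by gcongr; rw [hM]; exact le_mul_of_one_le_left (by linarith) hκ1
      nlinarith
    gcongr

end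

section

variable {d : ℕ} {K : ℝ → ℝ} {q f : (Fin d → ℝ) → ℝ} {A : ℝ} {lam : Fin d → ℝ} {p : ℝ≥0∞}
  {I : Finset (Fin d)} {h : Fin d → ℝ}

lemma KC.mono {P b σ v b' σ' v' : ℝ} (H : KC I K f q h P b σ v) (hP : 1 < P) (hb : b ≤ b') (hσ : σ ≤ σ') (hv : v ≤ v') :
    KC I K f q h P b' σ' v' where
  b0 := H.b0.trans hb
  σ0 := H.σ0.trans hσ
  v0 := H.v0.trans hv
  hb := H.hb.trans (ENNReal.ofReal_le_ofReal (Real.rpow_le_rpow H.b0 hb (by linarith)))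
  hσ := fun g hg hgt => (H.hσ g hg hgt).trans (by gcongr)
  hv := fun h2 => (H.hv h2).trans (ENNReal.ofReal_le_ofReal (Real.rpow_le_rpow H.v0 hv (by linarith)))

lemma KC_holder {P b : ℝ} (hP : 1 < P) (hP2 : P ≤ 2) (hf : IsDensity f) (hq : IsDensity q) (hL : Continuous (Lh I K q h))
    (hb0 : 0 ≤ b) (hb : Fp volume P (Lh I K q h) ≤ ENNReal.ofReal (b ^ P)) : KC I K f q h P b (b ^ 2) 0 := by
  have := hf.prob
  have := hq.prob
  refine ⟨hb0, by positivity, le_rfl, hb, fun g hg _ => ?_, fun h => by linarith⟩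
  refine sigma_holder volume (Pd q ∗ Pd f) P hP (fun y x => Lh I K q h (x - res I y)) b
    (fun y => by have : Continuous fun x => Lh I K q h (x - res I y) := by fun_prop
                 exact this.measurable) hb0 (fun y => ?_) g hg
  refine le_trans (le_of_eq ?_) hb
  unfold Fp
  exact lintegral_sub_right_eq_self (fun x => ‖Lh I K q h x‖ₑ ^ P) (res I y)

lemma young2 {ι : Type} [Fintype ι] {P : ℝ} (hP : 2 ≤ P) {g k : (ι → ℝ) → ℝ≥0∞} (hg : Measurable g) (hk : Measurable k) :
    ∫⁻ u, (∫⁻ x, g x * k (x - u)) ^ (2:ℝ) ≤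
      (∫⁻ x, g x ^ (P / (P - 1))) ^ (2 * (P - 1) / P) * (∫⁻ x, k x ^ (2 * P / (P + 2))) ^ ((P + 2) / P) := by
  have hP0 : 0 < P := by linarith
  have hP1 : 0 < P - 1 := by linarith
  set r := P / (P - 1) with hr
  set s := 2 * P / (P + 2) with hs
  have hr0 : 0 < r := by positivity
  have hs0 : 0 < s := by positivity
  set a := 1 / r - 1 / 2 with ha
  set b := 1 / s - 1 / 2 with hb
  have ha0 : 0 ≤ a := by rw [ha, hr]; field_simp; linarith
  have hb0 : 0 ≤ b := by rw [hb, hs]; field_simp; linarith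
  have hab : 1 / 2 + a + b = 1 := by rw [ha, hb, hr, hs]; field_simp; ring
  set Gg := ∫⁻ x, g x ^ r with hG
  set Kk := ∫⁻ x, k x ^ s with hKk
  have hku : ∀ u, Measurable fun x => k (x - u) := fun u => hk.comp (measurable_id.sub_const u)
  have key : ∀ u, (∫⁻ x, g x * k (x - u)) ^ (2:ℝ) ≤ (∫⁻ x, g x ^ r * k (x - u) ^ s) * (Gg ^ (2 * a) * Kk ^ (2 * b)) := by
    intro u
    have h3 := ENNReal.lintegral_prod_norm_pow_le (μ := (volume : Measure (ι → ℝ))) (Finset.univ : Finset (Fin 3))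
      (f := ![fun x => g x ^ r * k (x - u) ^ s, fun x => g x ^ r, fun x => k (x - u) ^ s])
      (fun i _ => by
        fin_cases i
        · exact ((hg.pow_const r).mul ((hku u).pow_const s)).aemeasurable
        · exact (hg.pow_const r).aemeasurable
        · exact ((hku u).pow_const s).aemeasurable) (p := ![1/2, a, b])
      (by simp [Fin.sum_univ_three]; linarith)
      (fun i _ => by
        fin_cases i
        · simp
        · exact ha0
        · exact hb0)
    simp only [Fin.prod_univ_three, Matrix.cons_val_zero, Matrix.cons_val_one, Matrix.cons_val] at h3
    have e1 : ∀ x, (g x ^ r * k (x - u) ^ s) ^ (1/2 : ℝ) * (g x ^ r) ^ a * (k (x - u) ^ s) ^ b = g x * k (x - u) := by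
      intro x
      have c1 : r * (1/2) + r * a = 1 := by rw [ha]; field_simp; ring
      have c2 : s * (1/2) + s * b = 1 := by rw [hb]; field_simp; ring
      rw [ENNReal.mul_rpow_of_nonneg _ _ (by norm_num : (0:ℝ) ≤ 1/2), ← ENNReal.rpow_mul, ← ENNReal.rpow_mul, ← ENNReal.rpow_mul,
        ← ENNReal.rpow_mul]
      calc _ = (g x ^ (r * (1/2)) * g x ^ (r * a)) * (k (x - u) ^ (s * (1/2)) * k (x - u) ^ (s * b)) := by ring
        _ = _ := by
          rw [← ENNReal.rpow_add_of_nonneg _ _ (by positivity) (by positivity),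
            ← ENNReal.rpow_add_of_nonneg _ _ (by positivity) (by positivity), c1, c2, ENNReal.rpow_one, ENNReal.rpow_one]
    simp_rw [e1] at h3
    have e2 : ∫⁻ x, k (x - u) ^ s = Kk := lintegral_sub_right_eq_self (fun x => k x ^ s) u
    rw [e2] at h3
    refine (ENNReal.rpow_le_rpow h3 (by norm_num : (0:ℝ) ≤ 2)).trans (le_of_eq ?_)
    rw [ENNReal.mul_rpow_of_nonneg _ _ (by norm_num), ENNReal.mul_rpow_of_nonneg _ _ (by norm_num), ← ENNReal.rpow_mul,
      ← ENNReal.rpow_mul, ← ENNReal.rpow_mul]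
    rw [mul_assoc, mul_comm a, mul_comm b, hG]; norm_num
  have hjm : Measurable fun z : (ι → ℝ) × (ι → ℝ) => g z.2 ^ r * k (z.2 - z.1) ^ s :=
    ((hg.comp measurable_snd).pow_const r).mul ((hk.comp (measurable_snd.sub measurable_fst)).pow_const s)
  calc _ ≤ ∫⁻ u, (∫⁻ x, g x ^ r * k (x - u) ^ s) * (Gg ^ (2 * a) * Kk ^ (2 * b)) := lintegral_mono key
    _ = (∫⁻ u, ∫⁻ x, g x ^ r * k (x - u) ^ s) * (Gg ^ (2 * a) * Kk ^ (2 * b)) :=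
        lintegral_mul_const _ hjm.lintegral_prod_right'
    _ = (Gg * Kk) * (Gg ^ (2 * a) * Kk ^ (2 * b)) := by
        congr 1
        rw [lintegral_lintegral_swap hjm.aemeasurable]
        have : ∀ x, ∫⁻ u, g x ^ r * k (x - u) ^ s = g x ^ r * Kk := by
          intro x
          have hm : Measurable fun u => k (x - u) ^ s := (hk.comp (measurable_id.const_sub x)).pow_const s
          rw [lintegral_const_mul _ hm]
          congr 1
          exact lintegral_sub_left_eq_self (fun u => k u ^ s) x
        simp_rw [this]
        rw [lintegral_mul_const _ (hg.pow_const r)]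
    _ = _ := by
        have e3 : 2 * (P - 1) / P = 1 + 2 * a := by rw [ha, hr]; field_simp; ring
        have e4 : (P + 2) / P = 1 + 2 * b := by rw [hb, hs]; field_simp; ring
        rw [e3, e4, ENNReal.rpow_add_of_nonneg _ _ (by norm_num) (by positivity), ENNReal.rpow_add_of_nonneg _ _ (by norm_num) (by positivity),
          ENNReal.rpow_one, ENNReal.rpow_one]; ring

lemma KC_gt2 {P Nq b2 bs b : ℝ} (hP : 2 ≤ P) (hf : IsDensity f) (hq : IsDensity q) (hL : Continuous (Lh I K q h)) (hNq0 : 0 ≤ Nq)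
    (hN : eLpNorm (marginal I q) ⊤ volume ≤ ENNReal.ofReal Nq) (hb0 : 0 ≤ b) (hbs0 : 0 ≤ bs) (hb20 : 0 ≤ b2)
    (hb : Fp volume P (Lh I K q h) ≤ ENNReal.ofReal (b ^ P))
    (hbs : Fp volume (2 * P / (P + 2)) (Lh I K q h) ≤ ENNReal.ofReal (bs ^ (2 * P / (P + 2))))
    (hb2 : Fp volume 2 (Lh I K q h) ≤ ENNReal.ofReal b2) : KC I K f q h P b (Nq * bs ^ 2) ((Nq + 1) * b2) := by
  have hP0 : 0 < P := by linarith
  have := hf.prob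
  have := hq.prob
  have hLm := hL.measurable
  have hres := res_meas I
  refine ⟨hb0, by positivity, by positivity, hb, fun g hg _ => ?_, fun h2 => ?_⟩
  · have hjm : Measurable fun z : (I → ℝ) × (I → ℝ) => ‖g z.2‖ₑ * ‖Lh I K q h (z.2 - z.1)‖ₑ := by fun_prop
    set Φ : (I → ℝ) → ℝ≥0∞ := fun u => (∫⁻ x, ‖g x‖ₑ * ‖Lh I K q h (x - u)‖ₑ) ^ (2:ℝ) with hΦ
    have hΦm : Measurable Φ := (hjm.lintegral_prod_right').pow_const _
    calc _ ≤ ∫⁻ y, Φ (res I y) ∂(Pd q ∗ Pd f) := by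
          refine lintegral_mono fun y => ENNReal.rpow_le_rpow ?_ (by norm_num)
          refine (enorm_integral_le_lintegral_enorm _).trans (le_of_eq ?_)
          simp_rw [enorm_mul]
      _ ≤ eLpNorm (marginal I q) ⊤ volume * ∫⁻ u, Φ u := law_le I hq hf Φ hΦm
      _ ≤ ENNReal.ofReal Nq * ((∫⁻ x, ‖g x‖ₑ ^ (P / (P - 1))) ^ (2 * (P - 1) / P) * ENNReal.ofReal (bs ^ 2)) := by
          refine mul_le_mul' hN ((young2 hP hg.enorm hLm.enorm).trans ?_)
          refine mul_le_mul_right ?_ _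
          refine (ENNReal.rpow_le_rpow hbs (by positivity)).trans (le_of_eq ?_)
          rw [ENNReal.ofReal_rpow_of_nonneg (by positivity) (by positivity), ← Real.rpow_mul hbs0]
          congr 1
          rw [← Real.rpow_two]; congr 1; field_simp
      _ = _ := by rw [ENNReal.ofReal_mul hNq0]; ring
  · set Ψ : (I → ℝ) → ℝ≥0∞ := fun x => ∫⁻ y, ‖Lh I K q h (x - res I y)‖ₑ ^ (2:ℝ) ∂(Pd q ∗ Pd f) with hΨ
    have hjm : Measurable fun z : (I → ℝ) × (Fin d → ℝ) => ‖Lh I K q h (z.1 - res I z.2)‖ₑ ^ (2:ℝ) := by fun_prop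
    have h1 : ∀ x, Ψ x ≤ ENNReal.ofReal (Nq * b2) := by
      intro x
      have hm : Measurable fun u : I → ℝ => ‖Lh I K q h (x - u)‖ₑ ^ (2:ℝ) := by fun_prop
      refine (law_le I hq hf _ hm).trans ?_
      rw [ENNReal.ofReal_mul hNq0]
      refine mul_le_mul' hN (le_trans (le_of_eq ?_) hb2)
      exact lintegral_sub_left_eq_self (fun u => ‖Lh I K q h u‖ₑ ^ (2:ℝ)) x
    have h3 : ∫⁻ x, Ψ x ≤ ENNReal.ofReal b2 := by
      rw [hΨ, lintegral_lintegral_swap hjm.aemeasurable]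
      refine le_trans (lintegral_mono (g := fun _ => ENNReal.ofReal b2) fun y => ?_) (by simp)
      refine le_trans (le_of_eq ?_) hb2
      exact lintegral_sub_right_eq_self (fun u => ‖Lh I K q h u‖ₑ ^ (2:ℝ)) (res I y)
    calc ∫⁻ x, Ψ x ^ (P / 2) ≤ ∫⁻ x, ENNReal.ofReal ((Nq * b2) ^ (P / 2 - 1)) * Ψ x := by
          refine lintegral_mono fun x => ?_
          have e : Ψ x ^ (P / 2) = Ψ x ^ (P / 2 - 1) * Ψ x := by
            nth_rw 3 [← ENNReal.rpow_one (Ψ x)]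
            rw [← ENNReal.rpow_add_of_nonneg _ _ (by linarith) (by norm_num)]; congr 1; ring
          rw [e, ← ENNReal.ofReal_rpow_of_nonneg (by positivity) (by linarith)]
          exact mul_le_mul_left (ENNReal.rpow_le_rpow (h1 x) (by linarith)) _
      _ ≤ ENNReal.ofReal ((Nq * b2) ^ (P / 2 - 1)) * ENNReal.ofReal b2 := by
          rw [lintegral_const_mul' _ _ ENNReal.ofReal_ne_top]; gcongr
      _ ≤ _ := by
          rw [← ENNReal.ofReal_mul (by positivity)]
          refine ENNReal.ofReal_le_ofReal ?_
          have e : ((Nq + 1) * b2) ^ (P / 2) = ((Nq + 1) * b2) ^ (P / 2 - 1) * ((Nq + 1) * b2) := by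
            nth_rw 3 [← Real.rpow_one ((Nq + 1) * b2)]
            rw [← Real.rpow_add_of_nonneg (by positivity) (by linarith) (by norm_num)]; congr 1; ring
          rw [e]
          have : Nq * b2 ≤ (Nq + 1) * b2 := by nlinarith
          have := Real.rpow_le_rpow (by positivity) this (by linarith : 0 ≤ P / 2 - 1)
          exact mul_le_mul this (by nlinarith) hb20 (by positivity)

end

section

variable {d : ℕ} {K : ℝ → ℝ} {q f : (Fin d → ℝ) → ℝ} {A : ℝ} {lam : Fin d → ℝ} {p : ℝ≥0∞}
  {I : Finset (Fin d)} {h : Fin d → ℝ}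

lemma quad_int {ι : Type} [Fintype ι] (μ : Measure (ι → ℝ)) [IsFiniteMeasure μ] {G g : (ι → ℝ) → ℂ} {M : ℝ}
    (hG : Integrable G) (hGc : Continuous G) (hM : ∀ t, ‖G t‖ ≤ M) (hg : Measurable g) (hgi : Integrable g) :
    ∫⁻ u, ‖∫ x, g x * ift G (x - u)‖ₑ ^ (2:ℝ) ∂μ ≤ (∫⁻ t : ι → ℝ, ‖∫ x, ex t x ∂μ‖ₑ) *
      (ENNReal.ofReal (M ^ 2) * (ENNReal.ofReal ((2 * Real.pi) ^ Fintype.card ι) * ∫⁻ x, ‖g x‖ₑ ^ (2:ℝ))) := by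
  have hM0 : 0 ≤ M := (norm_nonneg _).trans (hM 0)
  have hsym : ∀ s x : ι → ℝ, ex (-s) x = ex (-x) s := by
    intro s x; unfold ex dotp; simp [mul_comm]
  set F : (ι → ℝ) → ℂ := fun t => ift g (-t) * G (-t) with hF
  have hic : Continuous (ift g) := ift_cont hgi
  have hFc : Continuous F := (hic.comp continuous_neg).mul (hGc.comp continuous_neg)
  have hFi : Integrable F := by
    refine Integrable.bdd_mul (c := ∫ t, ‖g t‖) (hG.comp_neg) (hic.comp continuous_neg).aestronglyMeasurable ?_
    exact ae_of_all _ fun t => ift_norm_le g (-t)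
  have key : ∀ u, ∫ x, g x * ift G (x - u) = ift F u := by
    intro u
    unfold ift
    calc ∫ x, g x * ∫ t, ex (-t) (x - u) * G t = ∫ x, ∫ t, g x * (ex (-t) (x - u) * G t) := by
          simp_rw [integral_const_mul]
      _ = ∫ t, ∫ x, g x * (ex (-t) (x - u) * G t) := by
          refine integral_integral_swap ?_
          have h1 : Integrable (fun z : (ι → ℝ) × (ι → ℝ) => g z.1 * G z.2) (volume.prod volume) := hgi.mul_prod hG
          have h2 : Continuous fun z : (ι → ℝ) × (ι → ℝ) => ex (-z.2) (z.1 - u) := by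
            unfold ex dotp; fun_prop
          have h3 := Integrable.bdd_mul (c := 1) h1 h2.aestronglyMeasurable (ae_of_all _ fun z => (ex_norm _ _).le)
          refine h3.congr (ae_of_all _ fun z => ?_)
          simp only [Function.uncurry]; ring
      _ = ∫ t, ex t u * (ift g t * G t) := by
          congr 1; ext t
          have : ∀ x, g x * (ex (-t) (x - u) * G t) = (ex t u * G t) * (ex (-x) t * g x) := by
            intro x
            have : ex (-t) (x - u) = ex (-t) x * ex t u := by
              unfold ex dotp; rw [← Complex.exp_add]; congr 1
              push_cast
              simp only [Pi.neg_apply, Pi.sub_apply, Complex.ofReal_neg, Complex.ofReal_sub]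
              rw [← mul_add, ← Finset.sum_add_distrib]; congr 1
              refine Finset.sum_congr rfl fun j _ => by ring
            rw [this, hsym t x]; ring
          simp_rw [this]
          rw [integral_const_mul]; unfold ift; ring
      _ = ∫ t, ex (-t) u * (ift g (-t) * G (-t)) := (integral_neg_eq_self (fun t => ex t u * (ift g t * G t)) volume).symm
  simp_rw [key]
  refine (quad_le μ hFi hFc.measurable).trans (mul_le_mul_right ?_ _)
  calc ∫⁻ t, ‖F t‖ₑ ^ (2:ℝ) ≤ ∫⁻ t, ENNReal.ofReal (M ^ 2) * ‖ift g (-t)‖ₑ ^ (2:ℝ) := by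
        refine lintegral_mono fun t => ?_
        rw [hF]; simp only
        rw [enorm_mul, ENNReal.mul_rpow_of_nonneg _ _ (by norm_num), mul_comm]
        refine mul_le_mul_left ?_ _
        rw [← Real.rpow_two, ← ENNReal.ofReal_rpow_of_nonneg hM0 (by norm_num), ← ofReal_norm]
        gcongr; exact hM _
    _ = ENNReal.ofReal (M ^ 2) * ∫⁻ t, ‖ift g t‖ₑ ^ (2:ℝ) := by
        rw [lintegral_const_mul' _ _ ENNReal.ofReal_ne_top, lintegral_neg_eq_self (fun t => ‖ift g t‖ₑ ^ (2:ℝ))]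
    _ ≤ _ := mul_le_mul_right (plancherel_le hgi hg) _

lemma quad_gen {ι : Type} [Fintype ι] (μ : Measure (ι → ℝ)) [IsFiniteMeasure μ] {G g : (ι → ℝ) → ℂ} {M : ℝ}
    (hG : Integrable G) (hGc : Continuous G) (hM : ∀ t, ‖G t‖ ≤ M) (hL : ∫⁻ x, ‖ift G x‖ₑ ^ (2:ℝ) ≠ ⊤) (hg : Measurable g)
    (hg2 : ∫⁻ x, ‖g x‖ₑ ^ (2:ℝ) ≠ ⊤) :
    ∫⁻ u, ‖∫ x, g x * ift G (x - u)‖ₑ ^ (2:ℝ) ∂μ ≤ (∫⁻ t : ι → ℝ, ‖∫ x, ex t x ∂μ‖ₑ) *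
      (ENNReal.ofReal (M ^ 2) * (ENNReal.ofReal ((2 * Real.pi) ^ Fintype.card ι) * ∫⁻ x, ‖g x‖ₑ ^ (2:ℝ))) := by
  have hc := ift_cont hG
  have mem2 : ∀ {k : (ι → ℝ) → ℂ}, Measurable k → ∫⁻ x, ‖k x‖ₑ ^ (2:ℝ) ≠ ⊤ → MemLp k 2 volume := by
    intro k hk h2
    refine ⟨hk.aestronglyMeasurable, ?_⟩
    rw [eLpNorm_lt_top_iff_lintegral_rpow_enorm_lt_top (by norm_num) (by norm_num)]
    simpa using h2.lt_top
  have hgm := mem2 hg hg2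
  set gk : ℕ → (ι → ℝ) → ℂ := fun k => (Metric.ball (0 : ι → ℝ) k).indicator g with hgk
  have hgkm : ∀ k, Measurable (gk k) := fun k => hg.indicator measurableSet_ball
  have hle : ∀ k x, ‖gk k x‖ₑ ≤ ‖g x‖ₑ := fun k x => by
    rw [hgk]; simp only [enorm_indicator_eq_indicator_enorm]
    exact Set.indicator_le_self _ _ _
  have hgki : ∀ k, Integrable (gk k) := by
    intro k
    rw [hgk, integrable_indicator_iff measurableSet_ball]
    have : IsFiniteMeasure ((volume : Measure (ι → ℝ)).restrict (Metric.ball 0 k)) :=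
      ⟨by rw [Measure.restrict_apply_univ]; exact measure_ball_lt_top⟩
    exact (hgm.restrict _).integrable (by norm_num)
  have hlim : ∀ u, Tendsto (fun k => ∫ x, gk k x * ift G (x - u)) atTop (𝓝 (∫ x, g x * ift G (x - u))) := by
    intro u
    have hmu : Measurable fun x => ift G (x - u) := (hc.comp (continuous_id.sub continuous_const)).measurable
    have hi : Integrable fun x => g x * ift G (x - u) := by
      refine hgm.integrable_mul (mem2 hmu ?_)
      rw [lintegral_sub_right_eq_self (fun x => ‖ift G x‖ₑ ^ (2:ℝ)) u]; exact hL
    refine tendsto_integral_of_dominated_convergence (fun x => ‖g x * ift G (x - u)‖)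
      (fun k => ((hgkm k).mul hmu).aestronglyMeasurable) hi.norm (fun k => ae_of_all _ fun x => ?_) (ae_of_all _ fun x => ?_)
    · rw [norm_mul, norm_mul]
      have := hle k x
      rw [enorm_le_iff_norm_le] at this
      gcongr
    · refine tendsto_const_nhds.congr' ?_
      obtain ⟨N, hN⟩ := exists_nat_gt ‖x‖
      filter_upwards [eventually_ge_atTop N] with k hk
      rw [hgk]; simp only
      rw [Set.indicator_of_mem]
      rw [mem_ball_zero_iff]
      exact hN.trans_le (by exact_mod_cast hk)
  have hlim2 : ∀ u, ‖∫ x, g x * ift G (x - u)‖ₑ ^ (2:ℝ) = liminf (fun k => ‖∫ x, gk k x * ift G (x - u)‖ₑ ^ (2:ℝ)) atTop := by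
    intro u
    exact (((ENNReal.continuous_rpow_const (y := 2)).tendsto _).comp (hlim u).enorm).liminf_eq.symm
  simp_rw [hlim2]
  refine (lintegral_liminf_le' fun k => ?_).trans ?_
  · have hm : Measurable fun z : (ι → ℝ) × (ι → ℝ) => gk k z.2 * ift G (z.2 - z.1) :=
      ((hgkm k).comp measurable_snd).mul (hc.measurable.comp (measurable_snd.sub measurable_fst))
    exact ((hm.stronglyMeasurable.integral_prod_right').measurable.enorm.pow_const _).aemeasurable
  · refine liminf_le_of_le (by isBoundedDefault) fun b hb => ?_
    obtain ⟨k, hk⟩ := hb.exists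
    refine hk.trans ((quad_int μ hG hGc hM (hgkm k) (hgki k)).trans ?_)
    gcongr
    exact hle k _

lemma KC_two (S : Std K q A lam 2 I) : ∃ C : ℝ, 0 < C ∧ ∀ f h, IsDensity f → BW I h →
    KC I K f q h 2 (C * (La lam I h)⁻¹ * Hp I h ^ (-(1:ℝ)/2)) (C * (La lam I h)⁻¹ ^ 2) 0 := by
  obtain ⟨C1, hC1, h1⟩ := G_int S
  obtain ⟨C2, hC2, h2⟩ := L_bounds S
  have hqi := (S.hN.2.2.1 rfl).1
  set B := ∫ t, ‖ftI (marginal I q) t‖ with hB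
  have hB0 : 0 ≤ B := integral_nonneg fun _ => norm_nonneg _
  set m := Fintype.card I
  refine ⟨1 + C2 + B * (C1 ^ 2 * (2 * Real.pi) ^ m), by positivity, fun f h hf hh => ?_⟩
  set C := 1 + C2 + B * (C1 ^ 2 * (2 * Real.pi) ^ m) with hC
  have hCb : 0 ≤ B * (C1 ^ 2 * (2 * Real.pi) ^ m) := by positivity
  have hL0 := La_pos (lam := lam) hh
  have hH0 := Hp_pos hh
  obtain ⟨hGi, -, -, hGb, -⟩ := h1 h hh
  obtain ⟨hLc, -, hL2, -⟩ := h2 h hh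
  have := hf.prob
  have := S.hq.prob
  refine ⟨by positivity, by positivity, le_rfl, ?_, fun g hg hgt => ?_, fun h => by norm_num at h⟩
  · refine hL2.trans (ENNReal.ofReal_le_ofReal ?_)
    rw [Real.rpow_two, mul_pow, mul_pow, ← Real.rpow_natCast (Hp I h ^ _), ← Real.rpow_mul hH0.le]
    norm_num
    rw [Real.rpow_neg_one]
    gcongr
    nlinarith
  · norm_num at hgt ⊢
    have hc1 : ((2 * Real.pi) ^ (-(I.card : ℝ)) : ℝ) ≤ 1 :=
      Real.rpow_le_one_of_one_le_of_nonpos (by linarith [Real.pi_gt_three]) (by simp)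
    have hc0 : 0 < ((2 * Real.pi) ^ (-(I.card : ℝ)) : ℝ) := by positivity
    set c := ((2 * Real.pi) ^ (-(I.card : ℝ)) : ℝ)
    have hLe : ∀ x, Lh I K q h x = (c:ℂ) * ift (Gh I K q h) x := Lh_eq I K q h
    have hic := ift_cont hGi
    have hift : ∫⁻ x, ‖ift (Gh I K q h) x‖ₑ ^ (2:ℝ) ≠ ⊤ := by
      have : ∀ x, ‖ift (Gh I K q h) x‖ₑ ^ (2:ℝ) = (‖(c:ℂ)‖ₑ ^ (2:ℝ))⁻¹ * ‖Lh I K q h x‖ₑ ^ (2:ℝ) := by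
        intro x
        have hce : ‖(c:ℂ)‖ₑ ≠ 0 := by simpa using hc0.ne'
        rw [hLe, enorm_mul, ENNReal.mul_rpow_of_nonneg _ _ (by norm_num), ← mul_assoc, ENNReal.inv_mul_cancel, one_mul]
        · simpa using hc0.ne'
        · simp
      simp_rw [this]
      rw [lintegral_const_mul' _ _ (by simpa using hc0.ne')]
      exact ENNReal.mul_ne_top (by simpa using hc0.ne') (hL2.trans_lt ENNReal.ofReal_lt_top).ne
    have hrm : Measurable (res I : (Fin d → ℝ) → _) := res_meas I
    set μ := (Pd q ∗ Pd f).map (res I) with hμ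
    have : IsFiniteMeasure μ := by rw [hμ]; infer_instance
    have hq := quad_gen μ hGi (G_cont S hh) hGb hift hg (by simpa using hgt)
    have hcf : ∫⁻ t : I → ℝ, ‖∫ x, ex t x ∂μ‖ₑ ≤ ENNReal.ofReal B := by
      rw [hB, ofReal_integral_norm_eq_lintegral_enorm hqi]
      refine lintegral_mono fun t => ?_
      rw [hμ, integral_map hrm.aemeasurable (f := fun x => ex t x) (by unfold ex dotp; fun_prop : Continuous fun x : I → ℝ => ex t x).aestronglyMeasurable, cf_law I hf S.hq t, enorm_mul]
      refine mul_le_of_le_one_right' ?_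
      rw [← ofReal_norm, ENNReal.ofReal_le_one]
      exact ft_norm_le (map_res I hf).2 t
    calc _ ≤ ∫⁻ y, ‖∫ x, g x * ift (Gh I K q h) (x - res I y)‖ₑ ^ (2:ℝ) ∂(Pd q ∗ Pd f) := by
          simp only [ENNReal.rpow_ofNat]
          refine lintegral_mono fun y => ?_
          have : ∀ x, g x * Lh I K q h (x - res I y) = c * (g x * ift (Gh I K q h) (x - res I y)) := fun x => by rw [hLe]; ring
          simp_rw [this]
          rw [integral_const_mul, enorm_mul]
          gcongr
          refine mul_le_of_le_one_left' ?_
          rw [← ofReal_norm, ENNReal.ofReal_le_one]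
          simpa [abs_of_pos hc0] using hc1
      _ = ∫⁻ u, ‖∫ x, g x * ift (Gh I K q h) (x - u)‖ₑ ^ (2:ℝ) ∂μ := by
          rw [hμ, lintegral_map _ hrm]
          have hm : Measurable fun z : (I → ℝ) × (I → ℝ) => g z.2 * ift (Gh I K q h) (z.2 - z.1) :=
            (hg.comp measurable_snd).mul (hic.measurable.comp (measurable_snd.sub measurable_fst))
          exact ((hm.stronglyMeasurable.integral_prod_right').measurable.enorm.pow_const _)
      _ ≤ _ := hq
      _ ≤ ENNReal.ofReal B * (ENNReal.ofReal ((C1 * (La lam I h)⁻¹) ^ 2) * (ENNReal.ofReal ((2 * Real.pi) ^ m) *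
            ∫⁻ x, ‖g x‖ₑ ^ (2:ℝ))) := by gcongr
      _ = ENNReal.ofReal (B * (C1 ^ 2 * (2 * Real.pi) ^ m) * ((La lam I h)⁻¹) ^ 2) * ∫⁻ x, ‖g x‖ₑ ^ (2:ℝ) := by
          rw [← mul_assoc, ← mul_assoc, ← ENNReal.ofReal_mul hB0, ← ENNReal.ofReal_mul (by positivity)]
          congr 2; ring
      _ ≤ _ := by
          simp only [ENNReal.rpow_ofNat]
          rw [← inv_pow]
          gcongr
          rw [hC]; linarith

end

section

variable {d : ℕ} {K : ℝ → ℝ} {q f : (Fin d → ℝ) → ℝ} {A : ℝ} {lam : Fin d → ℝ} {p : ℝ≥0∞}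
  {I : Finset (Fin d)} {h : Fin d → ℝ}

lemma TailW.weak {n : ℕ} {U U' : ℝ≥0∞} {γ γ' ρ e e' : ℝ} (H : TailW p I K f q h n U γ ρ e)
    (hU : ENNReal.ofReal γ * U ≤ ENNReal.ofReal γ' * U') (he : e ≤ e') : TailW p I K f q h n U' γ' ρ e' := by
  obtain ⟨W, h1, h2, h3⟩ := H
  exact ⟨W, h1, fun y hy => h2 y (lt_of_le_of_lt hU hy), h3.trans (ENNReal.ofReal_le_ofReal he)⟩

def TailAll (K : ℝ → ℝ) (q : (Fin d → ℝ) → ℝ) (lam : Fin d → ℝ) (p : ℝ≥0∞) (I : Finset (Fin d)) : Prop :=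
  ∀ ρ β : ℝ, 0 < ρ → ∃ γ C : ℝ, 1 ≤ γ ∧ 0 < C ∧ ∀ n f h, 3 ≤ n → IsDensity f →
    (memGrid lam p n I h → TailW p I K f q h n (Up K q lam p n I h) γ ρ (C * (n:ℝ) ^ (-β))) ∧
    ∀ I', I ⊆ I' → memGrid lam p n I' h → TailW p I K f q h n 1 γ ρ (C * (n:ℝ) ^ (-β))

lemma memGrid.bw {n : ℕ} (H : memGrid lam p n I h) : BW I h := by
  intro j hj
  obtain ⟨k, -, hk⟩ := H.1 j hj
  rw [hk]
  exact ⟨by positivity, Real.rpow_le_one_of_one_le_of_nonpos (by norm_num) (by simp)⟩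

lemma sub_mono {I' : Finset (Fin d)} (hII : I ⊆ I') (hl : ∀ j, 0 < lam j) (hh : BW I' h) :
    BW I h ∧ Hp I' h ≤ Hp I h ∧ La lam I' h ≤ La lam I h := by
  have key : ∀ u : Fin d → ℝ, (∀ j ∈ I', 0 ≤ u j ∧ u j ≤ 1) → ∏ j ∈ I', u j ≤ ∏ j ∈ I, u j := by
    intro u hu
    rw [← Finset.prod_sdiff hII]
    exact mul_le_of_le_one_left (Finset.prod_nonneg fun j hj => (hu j (hII hj)).1)
      (Finset.prod_le_one (fun j hj => (hu j (Finset.mem_sdiff.1 hj).1).1) fun j hj => (hu j (Finset.mem_sdiff.1 hj).1).2)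
  refine ⟨fun j hj => hh j (hII hj), ?_, ?_⟩
  · exact key _ fun j hj => ⟨(hh j hj).1.le, (hh j hj).2⟩
  · exact key _ fun j hj => ⟨Real.rpow_nonneg (hh j hj).1.le _, Real.rpow_le_one (hh j hj).1.le (hh j hj).2 (hl j).le⟩

lemma KC_all (S : Std K q A lam p I) (hp : 2 ≤ p) (hpt : p ≠ ⊤) : ∃ C : ℝ, 1 ≤ C ∧ ∀ f h, IsDensity f → BW I h →
    KC I K f q h p.toReal (C * (La lam I h)⁻¹ * Hp I h ^ (-1 + 1 / p.toReal))
      (C * (La lam I h)⁻¹ ^ 2 * Hp I h ^ (-1 + 2 / p.toReal)) (C * (La lam I h)⁻¹ ^ 2 * (Hp I h)⁻¹) := by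
  by_cases h2 : p = 2
  · subst h2
    obtain ⟨C, hC, hk⟩ := KC_two S
    refine ⟨1 + C, by linarith, fun f h hf hh => ?_⟩
    have hL0 := La_pos (lam := lam) hh
    have hH0 := Hp_pos hh
    refine (hk f h hf hh).mono (by norm_num) ?_ ?_ (by positivity)
    · norm_num; gcongr; linarith
    · norm_num; gcongr; linarith
  · have hP : 2 < p.toReal := by
      have := (ENNReal.toReal_lt_toReal (by norm_num) hpt).2 (lt_of_le_of_ne hp (Ne.symm h2))
      simpa using this
    set P := p.toReal with hPd
    have hs1 : 1 < 2 * P / (P + 2) := by rw [lt_div_iff₀ (by linarith)]; linarith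
    obtain ⟨C1, hC1, b1⟩ := L_decay S h2 hpt (s := P) (by linarith)
    obtain ⟨C2, hC2, b2⟩ := L_decay S h2 hpt hs1
    obtain ⟨C3, hC3, b3⟩ := L_bounds S
    have hNq := S.hN.2.2.2.1 (lt_of_le_of_ne hp (Ne.symm h2))
    set Nq := (eLpNorm (marginal I q) ⊤ volume).toReal
    have hN0 : 0 ≤ Nq := ENNReal.toReal_nonneg
    refine ⟨1 + C1 + Nq * C2 ^ 2 + (Nq + 1) * C3, by nlinarith [mul_nonneg hN0 (sq_nonneg C2)], fun f h hf hh => ?_⟩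
    have hL0 := La_pos (lam := lam) hh
    have hH0 := Hp_pos hh
    have hx : 0 ≤ Nq * C2 ^ 2 := by positivity
    have hy : 0 ≤ (Nq + 1) * C3 := by positivity
    refine (KC_gt2 hP.le hf S.hq (b3 h hh).1 hN0 (ENNReal.ofReal_toReal hNq.ne).symm.le (by positivity) (by positivity)
      (by positivity) (b1 h hh) (b2 h hh) (b3 h hh).2.2.1).mono (by linarith) ?_ ?_ ?_
    · gcongr; linarith
    · rw [mul_pow, mul_pow, ← Real.rpow_natCast (Hp I h ^ _), ← Real.rpow_mul hH0.le,
        show (-1 + 1 / (2 * P / (P + 2))) * ((2:ℕ):ℝ) = -1 + 2 / P by field_simp; push_cast; ring]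
      rw [← mul_assoc, ← mul_assoc]
      gcongr; linarith
    · rw [← mul_assoc, ← mul_assoc]
      gcongr; linarith

lemma cp_pos (hl : ∀ j, 0 < lam j) (hp : 1 < p) (hpt : p ≠ ⊤) : 0 < cpGrid lam p ∧ cpGrid lam p ≤ 1 := by
  have h0 : 0 < p.toReal := ENNReal.toReal_pos (by positivity) hpt
  have : 0 ≤ lamMax lam := Real.sSup_nonneg (by rintro _ ⟨j, rfl⟩; exact (hl j).le)
  refine ⟨lt_min one_pos (Real.rpow_pos_of_pos ?_ _), min_le_left _ _⟩
  have : 0 ≤ lamMax lam * max 2 (p.toReal / (p.toReal - 1)) := mul_nonneg this (le_max_of_le_left (by norm_num))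
  positivity

lemma Up_prod (hh : BW I h) : ∏ j ∈ I, h j ^ (-lam j - 1 / 2) = (La lam I h)⁻¹ * Hp I h ^ (-(1:ℝ)/2) := by
  unfold La Hp
  rw [← Finset.prod_inv_distrib, ← Real.finsetProd_rpow _ _ fun j hj => (hh j hj).1.le, ← Finset.prod_mul_distrib]
  refine Finset.prod_congr rfl fun j hj => ?_
  rw [← Real.rpow_neg (hh j hj).1.le, ← Real.rpow_add (hh j hj).1]; congr 1; ring

lemma H_hmax {n : ℕ} (hn : 3 ≤ n) (hI : I.Nonempty) (hpt : p ≠ ⊤) (hp0 : 0 < p.toReal) (H : memGrid lam p n I h) :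
    Hp I h ^ (1 / p.toReal) ≤ (Real.log n)⁻¹ := by
  have hl := log_one_le hn
  have hm : (0:ℝ) < I.card := by exact_mod_cast hI.card_pos
  have h1 : Hp I h ≤ (Real.log n) ^ (-p.toReal) := by
    calc Hp I h ≤ ∏ j ∈ I, (Real.log n) ^ (-(p.toReal / I.card)) := by
          refine Finset.prod_le_prod (fun j hj => (H.bw j hj).1.le) fun j hj => ?_
          have := (H.2.1 j hj).2
          rwa [hmaxG, if_neg hpt] at this
      _ = _ := by
          rw [Finset.prod_const, ← Real.rpow_natCast, ← Real.rpow_mul (by linarith)]; congr 1; field_simp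
  calc _ ≤ ((Real.log n) ^ (-p.toReal)) ^ (1 / p.toReal) := Real.rpow_le_rpow (Hp_pos H.bw).le h1 (by positivity)
    _ = _ := by rw [← Real.rpow_mul (by linarith), ← Real.rpow_neg_one]; congr 1; field_simp

lemma ineqs {N l Λ H c P C : ℝ} (hN : 0 < N) (hl : 1 ≤ l) (hΛ : 0 < Λ) (hΛ1 : Λ ≤ 1) (hH : 0 < H) (hc : 0 < c) (hc1 : c ≤ 1)
    (hP : 2 ≤ P) (hC : 1 ≤ C) (hg : c ≤ (N * H) ^ (1/2 : ℝ) * Λ) (hw : H ^ (1 / P) ≤ l⁻¹) :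
    let U := N ^ (-(1:ℝ)/2) * (Λ⁻¹ * H ^ (-(1:ℝ)/2))
    let C0 := 4 * C / c
    U ≤ c⁻¹ ∧ N * (2 * (C * Λ⁻¹ * H ^ (-1 + 1 / P))) ^ P ≤ (C0 * (N * U)) ^ P ∧
    N * (4 * (C * Λ⁻¹ ^ 2 * H⁻¹)) ≤ (C0 * (N * U)) ^ 2 ∧
    l * (C * Λ⁻¹ * H ^ (-1 + 1 / P)) ≤ C0 * (N * U) ∧ l * N * (C * Λ⁻¹ ^ 2 * H ^ (-1 + 2 / P)) ≤ C0 * (N * U) ^ 2 := by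
  intro U C0
  have hP0 : 0 < P := by linarith
  obtain ⟨a, ha, ha2⟩ : ∃ a : ℝ, 0 < a ∧ N ^ (1/2:ℝ) = a := ⟨_, Real.rpow_pos_of_pos hN _, rfl⟩
  obtain ⟨η, hη, hη2⟩ : ∃ a : ℝ, 0 < a ∧ H ^ (1/2:ℝ) = a := ⟨_, Real.rpow_pos_of_pos hH _, rfl⟩
  obtain ⟨w, hw0, hwd⟩ : ∃ a : ℝ, 0 < a ∧ H ^ (1 / P) = a := ⟨_, Real.rpow_pos_of_pos hH _, rfl⟩
  have hNa : N = a ^ 2 := by rw [← ha2, ← Real.rpow_natCast, ← Real.rpow_mul hN.le]; norm_num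
  have hHη : H = η ^ 2 := by rw [← hη2, ← Real.rpow_natCast, ← Real.rpow_mul hH.le]; norm_num
  have e1 : H ^ (-1 + 1 / P) = w / η ^ 2 := by rw [Real.rpow_add hH, hwd, Real.rpow_neg_one, hHη]; ring
  have e2 : H ^ (-1 + 2 / P) = w ^ 2 / η ^ 2 := by
    rw [Real.rpow_add hH, show 2 / P = 1 / P + 1 / P by ring, Real.rpow_add hH, hwd, Real.rpow_neg_one, hHη]; ring
  have eU : U = (a * η * Λ)⁻¹ := by
    simp only [U, show -(1:ℝ)/2 = -(1/2) by norm_num]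
    rw [Real.rpow_neg hN.le, Real.rpow_neg hH.le, ha2, hη2]; field_simp
  have eX : N * U = a / (Λ * η) := by rw [eU, hNa]; field_simp
  rw [Real.mul_rpow hN.le hH.le, ha2, hη2] at hg
  have hg2 : c ≤ a * η := hg.trans (mul_le_of_le_one_right (by positivity) hΛ1)
  have hlw : l * w ≤ 1 := by
    rw [hwd] at hw
    calc l * w ≤ l * l⁻¹ := by gcongr
      _ = 1 := mul_inv_cancel₀ (by linarith)
  have hw1 : w ≤ 1 := by nlinarith
  have h1c : 1 ≤ a * η / c := by rwa [le_div_iff₀ hc, one_mul]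
  have hCc : C ≤ C / c := by rw [le_div_iff₀ hc]; nlinarith
  refine ⟨?_, ?_, ?_, ?_, ?_⟩
  · rw [eU]; gcongr
  · have hz : (N * H) ^ (1 / P) ≤ a * η / c := by
      have hz0 : N * H = (a * η) ^ 2 := by rw [hNa, hHη]; ring
      rcases le_total 1 (N * H) with h | h
      · calc (N * H) ^ (1 / P) ≤ (N * H) ^ (1 / 2 : ℝ) :=
              Real.rpow_le_rpow_of_exponent_le h (by gcongr)
          _ = a * η := by rw [Real.mul_rpow hN.le hH.le, ha2, hη2]
          _ ≤ _ := by rw [le_div_iff₀ hc]; nlinarith [mul_pos ha hη]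
      · exact (Real.rpow_le_one (by positivity) h (by positivity)).trans h1c
    rw [Real.mul_rpow hN.le hH.le, hwd] at hz
    have : N = (N ^ (1 / P)) ^ P := by rw [← Real.rpow_mul hN.le]; field_simp; simp
    rw [e1, eX]
    nth_rw 1 [this]
    rw [← Real.mul_rpow (by positivity) (by positivity)]
    refine Real.rpow_le_rpow (by positivity) ?_ hP0.le
    calc N ^ (1 / P) * (2 * (C * Λ⁻¹ * (w / η ^ 2))) = (N ^ (1 / P) * w) * (2 * C / (Λ * η ^ 2)) := by field_simp
      _ ≤ (a * η / c) * (2 * C / (Λ * η ^ 2)) := by gcongr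
      _ = (2 * C / c) * (a / (Λ * η)) := by field_simp
      _ ≤ _ := by simp only [C0]; gcongr; norm_num
  · rw [eX, hNa, hHη]
    calc a ^ 2 * (4 * (C * Λ⁻¹ ^ 2 * (η ^ 2)⁻¹)) = (4 * C) * (a / (Λ * η)) ^ 2 := by field_simp
      _ ≤ C0 ^ 2 * (a / (Λ * η)) ^ 2 := by
          gcongr
          have h4 : 4 * C ≤ C0 := by simp only [C0]; rw [mul_div_assoc]; linarith
          nlinarith
      _ = _ := by ring
  · rw [e1, eX]
    calc l * (C * Λ⁻¹ * (w / η ^ 2)) = (l * w) * (C / (Λ * η ^ 2)) := by field_simp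
      _ ≤ (a * η / c) * (C / (Λ * η ^ 2)) := by gcongr; exact hlw.trans h1c
      _ = (C / c) * (a / (Λ * η)) := by field_simp
      _ ≤ _ := by simp only [C0]; gcongr; linarith
  · rw [e2, eX, hNa]
    have : l * w ^ 2 ≤ 1 := by nlinarith
    calc l * a ^ 2 * (C * Λ⁻¹ ^ 2 * (w ^ 2 / η ^ 2)) = (l * w ^ 2) * (C * (a / (Λ * η)) ^ 2) := by field_simp
      _ ≤ 1 * (C * (a / (Λ * η)) ^ 2) := by gcongr
      _ ≤ _ := by rw [one_mul]; gcongr; simp only [C0]; rw [mul_div_assoc]; linarith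

lemma tail_ge2 (S : Std K q A lam p I) (hp : 2 ≤ p) (hpt : p ≠ ⊤) : TailAll K q lam p I := by
  intro ρ β hρ
  have hl := S.hN.2.1
  have hp1 : 1 < p := lt_of_lt_of_le (by norm_num) hp
  obtain ⟨hc, hc1⟩ := cp_pos hl hp1 hpt
  set c := cpGrid lam p with hcd
  obtain ⟨CK, hCK, hk⟩ := KC_all S hp hpt
  obtain ⟨CL, hCL, hL⟩ := L_bounds S
  set P := p.toReal with hPd
  have hP : 2 ≤ P := by simpa using (ENNReal.toReal_le_toReal (by norm_num) hpt).2 hp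
  have hpP : p = ENNReal.ofReal P := (ENNReal.ofReal_toReal hpt).symm
  have hC0 : 1 ≤ 4 * CK / c := by rw [le_div_iff₀ hc]; linarith
  obtain ⟨γ, C, hγ, hC, hT⟩ := tail_core (d := d) P (by linarith) (4 * CK / c) c⁻¹ ρ β hC0 (by positivity) hρ
  have hγ2 : γ ≤ γ * c⁻¹ := le_mul_of_one_le_right (by linarith) (one_le_inv_iff₀.2 ⟨hc, hc1⟩)
  have main : ∀ n f h I', 3 ≤ n → IsDensity f → I ⊆ I' → memGrid lam p n I' h →
      (n:ℝ) ^ (-(1:ℝ)/2) * ((La lam I' h)⁻¹ * Hp I' h ^ (-(1:ℝ)/2)) ≤ c⁻¹ ∧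
      TailW p I K f q h n (ENNReal.ofReal ((n:ℝ) ^ (-(1:ℝ)/2) * ((La lam I' h)⁻¹ * Hp I' h ^ (-(1:ℝ)/2)))) γ ρ (C * (n:ℝ) ^ (-β)) := by
    intro n f h I' hn hf hII hg
    have hb' := hg.bw
    obtain ⟨hb, hHH, hLL⟩ := sub_mono hII hl hb'
    have hn0 : (0:ℝ) < n := by positivity
    have hL0 := La_pos (lam := lam) hb'
    have hH0 := Hp_pos hb'
    have hL00 := La_pos (lam := lam) hb
    have hH00 := Hp_pos hb
    have hgr := hg.2.2
    rw [if_neg hpt, bp, ← hPd, min_eq_left (by rw [le_sub_comm]; norm_num; rw [inv_le_comm₀ (by linarith) (by norm_num)]; linarith)] at hgr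
    obtain ⟨i1, i2, i3, i4, i5⟩ := ineqs hn0 (log_one_le hn) hL0 (La_le hl hb') hH0 hc hc1 hP hCK hgr
      (H_hmax hn (S.hI.mono hII) hpt (by linarith) hg)
    refine ⟨i1, ?_⟩
    have hkc := (hk f h hf hb).mono (b' := CK * (La lam I' h)⁻¹ * Hp I' h ^ (-1 + 1 / P))
      (σ' := CK * (La lam I' h)⁻¹ ^ 2 * Hp I' h ^ (-1 + 2 / P)) (v' := CK * (La lam I' h)⁻¹ ^ 2 * (Hp I' h)⁻¹) (by linarith)
      (by
        have : -1 + 1 / P ≤ 0 := by rw [neg_add_nonpos_iff, div_le_one (by linarith)]; linarith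
        have := Real.rpow_le_rpow_of_nonpos hH0 hHH this
        gcongr)
      (by
        have : -1 + 2 / P ≤ 0 := by rw [neg_add_nonpos_iff, div_le_one (by linarith)]; linarith
        have := Real.rpow_le_rpow_of_nonpos hH0 hHH this
        gcongr) (by gcongr)
    rw [hpP]
    exact hT K q f I h n _ _ _ _ hf S.hq hn (by positivity) i1 (hL h hb).1 ⟨_, (hL h hb).2.1⟩ hkc i2 (fun _ => i3) i4 i5
  refine ⟨γ * c⁻¹, C, by linarith, hC, fun n f h hn hf => ⟨fun hg => ?_, fun I' hII hg => ?_⟩⟩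
  · refine (main n f h I hn hf (Finset.Subset.refl I) hg).2.weak (mul_le_mul' (ENNReal.ofReal_le_ofReal hγ2) ?_) le_rfl
    unfold Up
    rw [if_neg hpt, Up_prod hg.bw]
    split_ifs with h2 h3
    · exact le_rfl
    · exfalso; rw [← hPd] at h3; linarith
    · rw [ENNReal.ofReal_mul (by positivity)]
      exact mul_le_mul_right le_self_add _
  · obtain ⟨h1, h2⟩ := main n f h I' hn hf hII hg
    refine h2.weak ?_ le_rfl
    rw [mul_one, ← ENNReal.ofReal_mul (by linarith)]
    exact ENNReal.ofReal_le_ofReal (by gcongr)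

end

section

variable {d : ℕ} {K : ℝ → ℝ} {q f : (Fin d → ℝ) → ℝ} {A : ℝ} {lam : Fin d → ℝ} {p : ℝ≥0∞}
  {I : Finset (Fin d)} {h : Fin d → ℝ}

lemma tail_lt2 (S : Std K q A lam p I) (hp1 : 1 < p) (hp : p < 2) : TailAll K q lam p I := by
  intro ρ β hρ
  have hl := S.hN.2.1
  have hpt : p ≠ ⊤ := (hp.trans ENNReal.ofNat_lt_top).ne
  obtain ⟨hc, hc1⟩ := cp_pos hl hp1 hpt
  set c := cpGrid lam p with hcd
  set P := p.toReal with hPd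
  have hP1 : 1 < P := by simpa using (ENNReal.toReal_lt_toReal (by norm_num) hpt).2 hp1
  have hP2 : P < 2 := by simpa using (ENNReal.toReal_lt_toReal hpt (by norm_num)).2 hp
  have hpP : p = ENNReal.ofReal P := (ENNReal.ofReal_toReal hpt).symm
  obtain ⟨CD, hCD, hD⟩ := L_decay S hp.ne hpt hP1
  obtain ⟨CL, hCL, hL⟩ := L_bounds S
  have he1 : 0 < 2 / P - 1 := by rw [sub_pos, lt_div_iff₀ (by linarith)]; linarith
  set C0 := 2 + P + (2 / P - 1)⁻¹ with hC0
  have hC0i : 0 < (2 / P - 1)⁻¹ := by positivity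
  set U0 := CD * c⁻¹
  obtain ⟨γ, C, hγ, hC, hT⟩ := tail_core (d := d) P hP1 C0 U0 ρ β (by linarith) (by positivity) hρ
  have core : ∀ (n : ℕ) f h (b : ℝ), 3 ≤ n → IsDensity f → BW I h → 0 < b → Fp volume P (Lh I K q h) ≤ ENNReal.ofReal (b ^ P) →
      (n:ℝ) ^ (1 / P - 1) * b ≤ U0 → TailW p I K f q h n (ENNReal.ofReal ((n:ℝ) ^ (1 / P - 1) * b)) γ ρ (C * (n:ℝ) ^ (-β)) := by
    intro n f h b hn hf hh hb0 hb hU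
    have hn0 : (0:ℝ) < n := by positivity
    have hnU : (n:ℝ) * ((n:ℝ) ^ (1 / P - 1) * b) = (n:ℝ) ^ (1 / P) * b := by
      rw [← mul_assoc]; congr 1
      nth_rw 1 [← Real.rpow_one (n:ℝ)]
      rw [← Real.rpow_add hn0]; congr 1; ring
    rw [hpP]
    refine hT K q f I h n _ b (b ^ 2) 0 hf S.hq hn (by positivity) hU (hL h hh).1 ⟨_, (hL h hh).2.1⟩
      (KC_holder hP1 hP2.le hf S.hq (hL h hh).1 hb0.le hb) ?_ (fun h => by linarith) ?_ ?_
    · rw [hnU, ← mul_assoc, mul_comm C0, mul_assoc, Real.mul_rpow (x := (n:ℝ) ^ (1 / P)) (by positivity) (by positivity), ← Real.rpow_mul hn0.le,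
        one_div_mul_cancel (by linarith), Real.rpow_one]
      gcongr; linarith
    · rw [hnU, ← mul_assoc]
      gcongr
      have := Real.log_le_rpow_div hn0.le (by positivity : 0 < 1 / P)
      refine this.trans ?_
      rw [div_div_eq_mul_div, div_one, mul_comm]
      gcongr; linarith
    · rw [hnU, mul_pow, ← mul_assoc]
      refine mul_le_mul_of_nonneg_right ?_ (by positivity)
      have := Real.log_le_rpow_div hn0.le he1
      calc Real.log n * n ≤ ((n:ℝ) ^ (2 / P - 1) / (2 / P - 1)) * n := by gcongr
        _ = (2 / P - 1)⁻¹ * ((n:ℝ) ^ (2 / P - 1) * (n:ℝ) ^ (1:ℝ)) := by rw [Real.rpow_one]; ring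
        _ = (2 / P - 1)⁻¹ * ((n:ℝ) ^ (1 / P)) ^ 2 := by
            rw [← Real.rpow_add hn0, ← Real.rpow_natCast _ 2, ← Real.rpow_mul hn0.le]; congr 2; push_cast; ring
        _ ≤ C0 * ((n:ℝ) ^ (1 / P)) ^ 2 := by gcongr; linarith
  have grid : ∀ (n : ℕ) h I', 3 ≤ n → memGrid lam p n I' h → (n:ℝ) ^ (1 / P - 1) * (CD * (La lam I' h)⁻¹ * Hp I' h ^ (-1 + 1 / P)) ≤ U0 := by
    intro n h I' hn hg
    have hn0 : (0:ℝ) < n := by positivity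
    have hL0 := La_pos (lam := lam) hg.bw
    have hH0 := Hp_pos hg.bw
    have hgr := hg.2.2
    rw [if_neg hpt, bp, ← hPd, min_eq_right (by rw [sub_le_comm]; norm_num; rw [le_inv_comm₀ (by norm_num) (by linarith)]; linarith)] at hgr
    change c ≤ (n * Hp I' h) ^ (1 - 1 / P) * La lam I' h at hgr
    calc _ = CD * ((n * Hp I' h) ^ (1 - 1 / P) * La lam I' h)⁻¹ := by
          rw [Real.mul_rpow hn0.le hH0.le, show 1 / P - 1 = -(1 - 1 / P) by ring, show -1 + 1 / P = -(1 - 1 / P) by ring,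
            Real.rpow_neg hn0.le, Real.rpow_neg hH0.le]
          field_simp
      _ ≤ _ := by simp only [U0]; gcongr
  refine ⟨γ * (1 + U0), C, by nlinarith [show 0 < U0 by positivity], hC, fun n f h hn hf => ⟨fun hg => ?_, fun I' hII hg => ?_⟩⟩
  · have hb := hg.bw
    have hn0 : (0:ℝ) < n := by positivity
    have hL0 := La_pos (lam := lam) hb
    have hH0 := Hp_pos hb
    have hUp : Up K q lam p n I h = ENNReal.ofReal ((n : ℝ) ^ (1 / P - 1)) * eLpNorm (Lh I K q h) p volume := by
      unfold Up; rw [if_neg hpt, if_neg hp.ne, if_pos hP2]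
    have heq : eLpNorm (Lh I K q h) p volume = (Fp volume P (Lh I K q h)) ^ (1 / P) := by
      rw [eLpNorm_eq_lintegral_rpow_enorm_toReal (by positivity) hpt]; rfl
    have hfin : Fp volume P (Lh I K q h) ≠ ⊤ := ((hD h hb).trans_lt ENNReal.ofReal_lt_top).ne
    by_cases h0 : Fp volume P (Lh I K q h) = 0
    · have hz : Lh I K q h = 0 := by
        have := heq
        rw [h0, ENNReal.zero_rpow_of_pos (by positivity), eLpNorm_eq_zero_iff (hL h hb).1.aestronglyMeasurable (by positivity)] at this
        exact (Continuous.ae_eq_iff_eq volume (hL h hb).1 continuous_const).1 this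
      refine ⟨fun _ => 0, measurable_const, fun y hy => ?_, by simp⟩
      have : xiProc I K f q h y = 0 := by
        ext x; simp [xiProc, fHat, fHatMean, hz]
      rw [this, eLpNorm_zero] at hy
      exact absurd hy (by simp)
    · set b := ((Fp volume P (Lh I K q h)) ^ (1 / P)).toReal with hbd
      have hfr : (Fp volume P (Lh I K q h)) ^ (1 / P) ≠ ⊤ := ENNReal.rpow_ne_top_of_nonneg (by positivity) hfin
      have hb0 : 0 < b := ENNReal.toReal_pos (by simp [h0, hfin]) hfr
      have hbF : ENNReal.ofReal (b ^ P) = Fp volume P (Lh I K q h) := by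
        rw [← ENNReal.ofReal_rpow_of_pos hb0, hbd, ENNReal.ofReal_toReal hfr, ← ENNReal.rpow_mul, one_div_mul_cancel (by linarith),
          ENNReal.rpow_one]
      have hbD : b ≤ CD * (La lam I h)⁻¹ * Hp I h ^ (-1 + 1 / P) := by
        have := hD h hb
        change Fp volume P (Lh I K q h) ≤ _ at this
        rw [← hbF, ENNReal.ofReal_le_ofReal_iff (by positivity)] at this
        exact (Real.rpow_le_rpow_iff hb0.le (by positivity) (by linarith)).1 this
      refine (core n f h b hn hf hb hb0 hbF.ge ((mul_le_mul_of_nonneg_left hbD (by positivity)).trans (grid n h I hn hg))).weak ?_ le_rfl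
      rw [hUp, heq, ENNReal.ofReal_mul (by positivity), ENNReal.ofReal_toReal hfr]
      gcongr
      nlinarith [show 0 < U0 by positivity]
  · have hb' := hg.bw
    obtain ⟨hb, hHH, hLL⟩ := sub_mono hII hl hb'
    have hL0 := La_pos (lam := lam) hb'
    have hH0 := Hp_pos hb'
    have hL00 := La_pos (lam := lam) hb
    have hH00 := Hp_pos hb
    have hU := grid n h I' hn hg
    refine (core n f h _ hn hf hb (by positivity) ((hD h hb).trans (ENNReal.ofReal_le_ofReal ?_)) hU).weak ?_ le_rfl
    · have : -1 + 1 / P ≤ 0 := by rw [neg_add_nonpos_iff, div_le_one (by linarith)]; linarith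
      have := Real.rpow_le_rpow_of_nonpos hH0 hHH this
      gcongr
    · rw [mul_one, ← ENNReal.ofReal_mul (by linarith)]
      exact ENNReal.ofReal_le_ofReal (by gcongr; linarith)

end

section

lemma exp_two (x : ℝ) : Real.exp x ≤ 1 + x + x ^ 2 * Real.exp |x| := by
  have h := Complex.norm_exp_sub_sum_le_norm_mul_exp (x : ℂ) 2
  have e : Complex.exp x - ∑ m ∈ range 2, (x:ℂ) ^ m / m.factorial = ((Real.exp x - (1 + x) : ℝ) : ℂ) := by
    simp [Finset.sum_range_succ]
  rw [e, Complex.norm_real, Complex.norm_real, Real.norm_eq_abs, Real.norm_eq_abs, sq_abs] at h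
  linarith [le_abs_self (Real.exp x - (1 + x))]

lemma mgf_le {Ω : Type} [MeasurableSpace Ω] (μ : Measure Ω) [IsProbabilityMeasure μ] {X : Ω → ℝ} (hX : Measurable X) {B w : ℝ}
    (hB : ∀ y, |X y| ≤ B) (hw : ∫ y, X y ^ 2 ∂μ ≤ w) (t : ℝ) :
    Integrable (fun y => Real.exp (t * (X y - ∫ y, X y ∂μ))) μ ∧
    ∫ y, Real.exp (t * (X y - ∫ y, X y ∂μ)) ∂μ ≤ Real.exp (t ^ 2 * w * Real.exp (|t| * (2 * B))) := by
  set m := ∫ y, X y ∂μ with hm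
  have hXi : Integrable X μ := Integrable.of_bound hX.aestronglyMeasurable B (ae_of_all _ hB)
  have hX2i : Integrable (fun y => X y ^ 2) μ := Integrable.of_bound (hX.pow_const 2).aestronglyMeasurable (B ^ 2)
    (ae_of_all _ fun y => by rw [norm_pow]; exact pow_le_pow_left₀ (norm_nonneg _) (hB y) 2)
  have hmB : |m| ≤ B := by
    have := norm_integral_le_of_norm_le_const (μ := μ) (f := X) (C := B) (ae_of_all _ hB)
    simpa using this
  have hZ : ∀ y, |t * (X y - m)| ≤ |t| * (2 * B) := by
    intro y; rw [abs_mul]; gcongr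
    exact (abs_sub _ _).trans (by linarith [hB y])
  have hi : Integrable (fun y => Real.exp (t * (X y - m))) μ := by
    refine Integrable.of_bound (by fun_prop) (Real.exp (|t| * (2 * B))) (ae_of_all _ fun y => ?_)
    rw [Real.norm_eq_abs, Real.abs_exp]
    exact Real.exp_le_exp.2 ((le_abs_self _).trans (hZ y))
  refine ⟨hi, ?_⟩
  set E := Real.exp (|t| * (2 * B))
  have hvar : ∫ y, (X y - m) ^ 2 ∂μ ≤ w := by
    have : ∀ y, (X y - m) ^ 2 = X y ^ 2 - 2 * m * X y + m ^ 2 := fun y => by ring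
    simp_rw [this]
    have hi' : Integrable (fun y => X y ^ 2 - 2 * m * X y) μ := hX2i.sub (hXi.const_mul _)
    rw [integral_add hi' (integrable_const _), integral_sub hX2i (hXi.const_mul _), integral_const_mul, ← hm]
    simp
    nlinarith [sq_nonneg m]
  have hZi : Integrable (fun y => X y - m) μ := hXi.sub (integrable_const m)
  have hZ2i : Integrable (fun y => (X y - m) ^ 2) μ := by
    have : ∀ y, (X y - m) ^ 2 = X y ^ 2 - 2 * m * X y + m ^ 2 := fun y => by ring
    simp_rw [this]
    exact (hX2i.sub (hXi.const_mul _)).add (integrable_const _)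
  calc ∫ y, Real.exp (t * (X y - m)) ∂μ ≤ ∫ y, (1 + t * (X y - m) + t ^ 2 * E * (X y - m) ^ 2) ∂μ := by
        refine integral_mono hi (((integrable_const _).add (hZi.const_mul _)).add (hZ2i.const_mul _)) fun y => ?_
        refine (exp_two _).trans ?_
        have : Real.exp |t * (X y - m)| ≤ E := Real.exp_le_exp.2 (hZ y)
        nlinarith [mul_le_mul_of_nonneg_left this (sq_nonneg (t * (X y - m)))]
    _ = 1 + t ^ 2 * E * ∫ y, (X y - m) ^ 2 ∂μ := by
        have hi' : Integrable (fun y => 1 + t * (X y - m)) μ := (integrable_const _).add (hZi.const_mul _)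
        rw [integral_add hi' (hZ2i.const_mul _), integral_add (integrable_const _) (hZi.const_mul _),
          integral_const_mul, integral_const_mul, integral_sub hXi (integrable_const _)]
        simp [hm]
    _ ≤ 1 + t ^ 2 * E * w := by gcongr
    _ ≤ _ := by
        have := Real.add_one_le_exp (t ^ 2 * w * E)
        linarith

lemma cosh_mom {Ω : Type} [MeasurableSpace Ω] (μ : Measure Ω) [IsProbabilityMeasure μ] {X : Ω → ℝ} (hX : Measurable X) {B w θ z0 : ℝ}
    (hB : ∀ y, |X y| ≤ B) (hw : ∫ y, X y ^ 2 ∂μ ≤ w) (hθ : 0 ≤ θ) (n : ℕ) (hz : n * θ ^ 2 * Real.exp (θ * (2 * B)) * w ≤ z0) :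
    ∫⁻ y : Fin n → Ω, ENNReal.ofReal (Real.cosh (θ * ∑ k, (X (y k) - ∫ y, X y ∂μ)) - 1) ∂(Measure.pi fun _ => μ) ≤
      ENNReal.ofReal (n * θ ^ 2 * Real.exp (θ * (2 * B)) * Real.exp z0) * ENNReal.ofReal w := by
  set m := ∫ y, X y ∂μ with hm
  set z := n * θ ^ 2 * Real.exp (θ * (2 * B)) * w with hzd
  have hw0 : 0 ≤ w := (integral_nonneg fun y => sq_nonneg _).trans hw
  have hz0 : 0 ≤ z := by positivity
  have key : ∀ t, |t| = θ → Integrable (fun y : Fin n → Ω => Real.exp (t * ∑ k, (X (y k) - m))) (Measure.pi fun _ => μ) ∧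
      ∫ y : Fin n → Ω, Real.exp (t * ∑ k, (X (y k) - m)) ∂(Measure.pi fun _ => μ) ≤ Real.exp z := by
    intro t ht
    obtain ⟨h1, h2⟩ := mgf_le μ hX hB hw t
    rw [← hm] at h1 h2
    simp_rw [Finset.mul_sum, Real.exp_sum]
    refine ⟨Integrable.fintype_prod fun _ => h1, ?_⟩
    rw [integral_fintype_prod_eq_pow (fun y => Real.exp (t * (X y - m)))]
    refine (pow_le_pow_left₀ (integral_nonneg fun y => (Real.exp_pos _).le) h2 _).trans ?_
    rw [← Real.exp_nat_mul, Fintype.card_fin, ht, ← sq_abs t, ht]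
    exact Real.exp_le_exp.2 (by rw [hzd]; exact le_of_eq (by ring))
  obtain ⟨i1, b1⟩ := key θ (abs_of_nonneg hθ)
  obtain ⟨i2, b2⟩ := key (-θ) (by rw [abs_neg, abs_of_nonneg hθ])
  have hce : ∀ y : Fin n → Ω, Real.cosh (θ * ∑ k, (X (y k) - m)) - 1 =
      (Real.exp (θ * ∑ k, (X (y k) - m)) + Real.exp (-θ * ∑ k, (X (y k) - m))) / 2 - 1 := fun y => by
    rw [Real.cosh_eq, neg_mul]
  simp_rw [hce]
  have j1 : Integrable (fun y : Fin n → Ω => (Real.exp (θ * ∑ k, (X (y k) - m)) + Real.exp (-θ * ∑ k, (X (y k) - m))) / 2)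
    (Measure.pi fun _ => μ) := (i1.add i2).div_const 2
  have j2 : Integrable (fun y : Fin n → Ω => (Real.exp (θ * ∑ k, (X (y k) - m)) + Real.exp (-θ * ∑ k, (X (y k) - m))) / 2 - 1)
    (Measure.pi fun _ => μ) := j1.sub (integrable_const 1)
  rw [← ofReal_integral_eq_lintegral_ofReal j2
    (ae_of_all _ fun y => by
      have := hce y
      simp only [Pi.zero_apply]
      rw [← this]; linarith [Real.one_le_cosh (θ * ∑ k, (X (y k) - m))]),
    ← ENNReal.ofReal_mul (by positivity)]
  refine ENNReal.ofReal_le_ofReal ?_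
  rw [integral_sub j1 (integrable_const 1), integral_div, integral_add i1 i2]
  simp only [integral_const, probReal_univ, smul_eq_mul, mul_one]
  have h1 : Real.exp z * (1 - z) ≤ 1 := by
    have := Real.add_one_le_exp (-z)
    rw [Real.exp_neg] at this
    calc Real.exp z * (1 - z) ≤ Real.exp z * (Real.exp z)⁻¹ := by gcongr; linarith
      _ = 1 := mul_inv_cancel₀ (Real.exp_pos _).ne'
  have h2 : z * Real.exp z ≤ z * Real.exp z0 := by gcongr
  have h3 : z * Real.exp z0 = n * θ ^ 2 * Real.exp (θ * (2 * B)) * Real.exp z0 * w := by rw [hzd]; ring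
  nlinarith

lemma cosh_low {u s : ℝ} (hu : 0 ≤ u) (hs : u ≤ |s|) : Real.cosh u - 1 ≤ Real.cosh s - 1 := by
  have := Real.cosh_le_cosh.2 (show |u| ≤ |s| by rwa [abs_of_nonneg hu])
  linarith

lemma sup_lower {ι : Type} [Fintype ι] {s : (ι → ℝ) → ℂ} {Lp T δ θ : ℝ} (hL : ∀ x y, ‖s x - s y‖ ≤ Lp * ‖x - y‖) (hLp : 0 ≤ Lp)
    (hδ : 0 < δ) (hLδ : Lp * δ ≤ 1 / 4) (hT : 1 ≤ T) (hθ : 0 ≤ θ) {x0 : ι → ℝ} (hx : T < ‖s x0‖) :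
    ENNReal.ofReal (Real.cosh (θ * (T / 4)) - 1) * ENNReal.ofReal ((2 * δ) ^ Fintype.card ι) ≤
      ∫⁻ x, (ENNReal.ofReal (Real.cosh (θ * (s x).re) - 1) + ENNReal.ofReal (Real.cosh (θ * (s x).im) - 1)) := by
  rw [← Real.volume_pi_ball x0 hδ, ← setLIntegral_const]
  refine (setLIntegral_mono' measurableSet_ball fun x hx' => ?_).trans (setLIntegral_le_lintegral _ _)
  have h1 : ‖s x0 - s x‖ ≤ 1 / 4 := by
    refine (hL x0 x).trans (le_trans ?_ hLδ)
    rw [Metric.mem_ball, dist_comm, dist_eq_norm] at hx'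
    gcongr
  have h2 := Complex.norm_le_abs_re_add_abs_im (s x0)
  have h3 := (Complex.abs_re_le_norm (s x0 - s x)).trans h1
  have h4 := (Complex.abs_im_le_norm (s x0 - s x)).trans h1
  rw [Complex.sub_re] at h3
  rw [Complex.sub_im] at h4
  have h5 := abs_sub_abs_le_abs_sub (s x0).re (s x).re
  have h6 := abs_sub_abs_le_abs_sub (s x0).im (s x).im
  rcases le_total (T / 2) |(s x0).re| with h | h
  · refine le_trans (ENNReal.ofReal_le_ofReal (cosh_low (by positivity) ?_)) le_self_add
    rw [abs_mul, abs_of_nonneg hθ]; gcongr; linarith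
  · refine le_trans (ENNReal.ofReal_le_ofReal (cosh_low (by positivity) ?_)) le_add_self
    rw [abs_mul, abs_of_nonneg hθ]; gcongr; linarith

end

section

variable {d : ℕ} {K : ℝ → ℝ} {q f : (Fin d → ℝ) → ℝ} {A : ℝ} {lam : Fin d → ℝ} {p : ℝ≥0∞}
  {I : Finset (Fin d)} {h : Fin d → ℝ}

lemma sup_int {L : (I → ℝ) → ℂ} (hLc : Continuous L) {B w0 w1 θ z0 : ℝ} (hB : ∀ x, ‖L x‖ ≤ B) (μ : Measure (Fin d → ℝ))
    [IsProbabilityMeasure μ] (hw00 : 0 ≤ w0) (hw0 : ∀ x, ∫⁻ y, ‖L (x - res I y)‖ₑ ^ (2:ℝ) ∂μ ≤ ENNReal.ofReal w0)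
    (hw1 : ∫⁻ x, ‖L x‖ₑ ^ (2:ℝ) ≤ ENNReal.ofReal w1) (hθ : 0 ≤ θ) (n : ℕ) (hz : n * θ ^ 2 * Real.exp (θ * (2 * B)) * w0 ≤ z0)
    {s : (Fin n → Fin d → ℝ) → (I → ℝ) → ℂ} (hs : ∀ y x, s y x = ∑ k, (L (x - res I (y k)) - ∫ y', L (x - res I y') ∂μ))
    {J : (Fin n → Fin d → ℝ) → ℝ≥0∞} (hJ : ∀ y, J y = ∫⁻ x, (ENNReal.ofReal (Real.cosh (θ * (s y x).re) - 1) +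
      ENNReal.ofReal (Real.cosh (θ * (s y x).im) - 1))) :
    Measurable J ∧ ∫⁻ y, J y ∂(Measure.pi fun _ => μ) ≤
      2 * ENNReal.ofReal (n * θ ^ 2 * Real.exp (θ * (2 * B)) * Real.exp z0) * ENNReal.ofReal w1 := by
  have hres : Continuous (res I) := by unfold res; fun_prop
  have hm0 : Measurable fun z : (I → ℝ) × (Fin d → ℝ) => L (z.1 - res I z.2) := by
    have : Continuous fun z : (I → ℝ) × (Fin d → ℝ) => L (z.1 - res I z.2) := by fun_prop
    exact this.measurable
  have hmm : Measurable fun x => ∫ y', L (x - res I y') ∂μ := (hm0.stronglyMeasurable.integral_prod_right' (ν := μ)).measurable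
  have hsm : Measurable (Function.uncurry s) := by
    simp only [Function.uncurry_def, hs]
    refine Finset.measurable_sum _ fun k _ => Measurable.sub ?_ (hmm.comp measurable_snd)
    have : Measurable fun z : (Fin n → Fin d → ℝ) × (I → ℝ) => (z.2, z.1 k) := by fun_prop
    exact hm0.comp this
  have hFm : Measurable fun z : (Fin n → Fin d → ℝ) × (I → ℝ) => (ENNReal.ofReal (Real.cosh (θ * (s z.1 z.2).re) - 1) +
      ENNReal.ofReal (Real.cosh (θ * (s z.1 z.2).im) - 1)) := by
    have h1 : Measurable fun z : (Fin n → Fin d → ℝ) × (I → ℝ) => s z.1 z.2 := hsm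
    have h2 := Complex.measurable_re.comp h1
    have h3 := Complex.measurable_im.comp h1
    have h4 := Real.continuous_cosh.measurable
    exact (((h4.comp (h2.const_mul θ)).sub_const 1).ennreal_ofReal).add (((h4.comp (h3.const_mul θ)).sub_const 1).ennreal_ofReal)
  have hJ' : J = fun y => _ := funext hJ
  refine ⟨by rw [hJ']; exact hFm.lintegral_prod_right', ?_⟩
  rw [hJ', lintegral_lintegral_swap hFm.aemeasurable]
  set E := ENNReal.ofReal (n * θ ^ 2 * Real.exp (θ * (2 * B)) * Real.exp z0) with hE
  have key : ∀ (x : I → ℝ) (ℓ : ℂ →L[ℝ] ℝ), (∀ z, |ℓ z| ≤ ‖z‖) →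
      ∫⁻ y : Fin n → Fin d → ℝ, ENNReal.ofReal (Real.cosh (θ * ℓ (s y x)) - 1) ∂(Measure.pi fun _ => μ) ≤
        E * ∫⁻ y, ‖L (x - res I y)‖ₑ ^ (2:ℝ) ∂μ := by
    intro x ℓ hℓ
    have hLm : Measurable fun y => L (x - res I y) := by
      have : Continuous fun y => L (x - res I y) := by fun_prop
      exact this.measurable
    have hLi : Integrable (fun y => L (x - res I y)) μ := Integrable.of_bound hLm.aestronglyMeasurable B (ae_of_all _ fun y => hB _)
    have hX : Measurable fun y => ℓ (L (x - res I y)) := ℓ.continuous.measurable.comp hLm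
    have hfin : ∫⁻ y, ‖L (x - res I y)‖ₑ ^ (2:ℝ) ∂μ ≠ ⊤ := ((hw0 x).trans_lt ENNReal.ofReal_lt_top).ne
    have hw : ∫ y, ℓ (L (x - res I y)) ^ 2 ∂μ ≤ (∫⁻ y, ‖L (x - res I y)‖ₑ ^ (2:ℝ) ∂μ).toReal := by
      rw [integral_eq_lintegral_of_nonneg_ae (ae_of_all _ fun y => sq_nonneg _) (hX.pow_const 2).aestronglyMeasurable]
      refine ENNReal.toReal_mono hfin (lintegral_mono fun y => ?_)
      rw [← ofReal_norm_eq_enorm, ENNReal.ofReal_rpow_of_nonneg (norm_nonneg _) (by norm_num)]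
      refine ENNReal.ofReal_le_ofReal ?_
      rw [← sq_abs, Real.rpow_two]
      exact pow_le_pow_left₀ (abs_nonneg _) (hℓ _) 2
    have hw' : (∫⁻ y, ‖L (x - res I y)‖ₑ ^ (2:ℝ) ∂μ).toReal ≤ w0 := ENNReal.toReal_le_of_le_ofReal hw00 (hw0 x)
    have := cosh_mom μ hX (B := B) (θ := θ) (z0 := z0) (fun y => (hℓ _).trans (hB _)) hw hθ n
      ((mul_le_mul_of_nonneg_left hw' (by positivity)).trans hz)
    rw [ENNReal.ofReal_toReal hfin] at this
    refine le_trans (le_of_eq ?_) this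
    refine lintegral_congr fun y => ?_
    rw [hs, map_sum, ℓ.integral_comp_comm hLi]
    simp only [map_sub]
  have step : ∀ x, ∫⁻ y : Fin n → Fin d → ℝ, (ENNReal.ofReal (Real.cosh (θ * (s y x).re) - 1) +
      ENNReal.ofReal (Real.cosh (θ * (s y x).im) - 1)) ∂(Measure.pi fun _ => μ) ≤
        2 * E * ∫⁻ y, ‖L (x - res I y)‖ₑ ^ (2:ℝ) ∂μ := by
    intro x
    have h1 : Measurable fun y => s y x := hsm.of_uncurry_right
    have h2 := Complex.measurable_re.comp h1
    have h4 := Real.continuous_cosh.measurable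
    have h5 : Measurable fun y => ENNReal.ofReal (Real.cosh (θ * (s y x).re) - 1) := ((h4.comp (h2.const_mul θ)).sub_const 1).ennreal_ofReal
    rw [lintegral_add_left h5]
    refine (add_le_add (key x Complex.reCLM Complex.abs_re_le_norm) (key x Complex.imCLM Complex.abs_im_le_norm)).trans (le_of_eq ?_)
    ring
  refine (lintegral_mono step).trans ?_
  rw [lintegral_const_mul' _ _ (by finiteness)]
  refine mul_le_mul_right ?_ _
  rw [lintegral_lintegral_swap (hm0.enorm.pow_const 2).aemeasurable]
  refine le_trans (lintegral_mono fun y => le_of_eq (lintegral_sub_right_eq_self (fun x => ‖L x‖ₑ ^ (2:ℝ)) (res I y))) ?_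
  simpa using hw1

lemma top_arith {N l Λ H C D : ℝ} (hN : 1 ≤ N) (hl : 1 ≤ l) (hΛ : 0 < Λ) (hΛ1 : Λ ≤ 1) (hH : 0 < H) (hH1 : H ≤ 1) (hC : 0 < C)
    (hg : √l ≤ (N * H) ^ (1/2:ℝ) * Λ) :
    ∃ θ, 0 < θ ∧ ∃ V, V = N ^ (-(1:ℝ)/2) * √l * (Λ⁻¹ * H ^ (-(1:ℝ)/2)) ∧ V ≤ 1 ∧ 1 ≤ N * V ∧ θ * (N * V) = l ∧
      θ * (C * Λ⁻¹ * H⁻¹) ≤ C ∧ N * θ ^ 2 * (D * Λ⁻¹ ^ 2 * H⁻¹) = D * l ∧ C * Λ⁻¹ * H⁻¹ ≤ C * N ∧ C * Λ⁻¹ * H⁻¹ ^ 2 ≤ C * N ^ 2 := by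
  have hN0 : 0 < N := by linarith
  have hHs : H ^ (-(1:ℝ)/2) = (√H)⁻¹ := by rw [neg_div, Real.rpow_neg hH.le, Real.sqrt_eq_rpow]
  have hNs : N ^ (-(1:ℝ)/2) = (√N)⁻¹ := by rw [neg_div, Real.rpow_neg hN0.le, Real.sqrt_eq_rpow]
  rw [← Real.sqrt_eq_rpow, Real.sqrt_mul hN0.le] at hg
  rw [hHs, hNs]
  have s1 := Real.one_le_sqrt.2 hl
  have x1 := Real.one_le_sqrt.2 hN
  have e0 := Real.sqrt_pos.2 hH
  have e1 := Real.sqrt_le_one.2 hH1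
  have eN := Real.sq_sqrt hN0.le
  have el := Real.sq_sqrt (by linarith : 0 ≤ l)
  have eH := Real.sq_sqrt hH.le
  generalize √N = x at *
  generalize √l = s at *
  generalize √H = e at *
  subst eN el eH
  have hxe : s ≤ x * e := hg.trans (mul_le_of_le_one_right (by positivity) hΛ1)
  have hi : 1 ≤ x * (e * Λ) := by nlinarith
  have hu : (e * Λ)⁻¹ ≤ x := by rw [inv_le_iff_one_le_mul₀ (by positivity)]; linarith
  have hΛi : 1 ≤ Λ⁻¹ := (one_le_inv₀ hΛ).2 hΛ1
  refine ⟨s * Λ * e / x, by positivity, _, rfl, ?_, ?_, ?_, ?_, ?_, ?_, ?_⟩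
  · rw [show x⁻¹ * s * (Λ⁻¹ * e⁻¹) = s / (x * e * Λ) by field_simp]
    exact div_le_one_of_le₀ hg (by positivity)
  · rw [show x ^ 2 * (x⁻¹ * s * (Λ⁻¹ * e⁻¹)) = x * s * (e * Λ)⁻¹ by field_simp]
    have : 1 ≤ (e * Λ)⁻¹ := (one_le_inv₀ (by positivity)).2 (by nlinarith)
    exact one_le_mul_of_one_le_of_one_le (one_le_mul_of_one_le_of_one_le x1 s1) this
  · field_simp
  · rw [show s * Λ * e / x * (C * Λ⁻¹ * (e ^ 2)⁻¹) = C * (s / (x * e)) by field_simp]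
    exact mul_le_of_le_one_right hC.le (div_le_one_of_le₀ hxe (by positivity))
  · field_simp
  · rw [mul_assoc]; gcongr
    calc Λ⁻¹ * (e ^ 2)⁻¹ ≤ Λ⁻¹ ^ 2 * (e ^ 2)⁻¹ := by gcongr; nlinarith
      _ = (e * Λ)⁻¹ ^ 2 := by field_simp
      _ ≤ _ := by gcongr
  · rw [mul_assoc]; gcongr
    calc Λ⁻¹ * (e ^ 2)⁻¹ ^ 2 ≤ Λ⁻¹ ^ 4 * (e ^ 2)⁻¹ ^ 2 := by gcongr; exact le_self_pow₀ hΛi (by norm_num)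
      _ = ((e * Λ)⁻¹ ^ 2) ^ 2 := by field_simp
      _ ≤ _ := by gcongr

lemma cosh_exp {u : ℝ} (hu : 2 ≤ u) : Real.exp u / 4 ≤ Real.cosh u - 1 := by
  rw [Real.cosh_eq]
  have h1 := Real.add_one_le_exp 1
  have h2 : Real.exp 1 * Real.exp 1 ≤ Real.exp u := by rw [← Real.exp_add]; exact Real.exp_le_exp.2 (by linarith)
  have := Real.exp_pos (-u)
  nlinarith

end

section

variable {d : ℕ} {K : ℝ → ℝ} {q f : (Fin d → ℝ) → ℝ} {A : ℝ} {lam : Fin d → ℝ} {p : ℝ≥0∞}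
  {I : Finset (Fin d)} {h : Fin d → ℝ}

set_option maxHeartbeats 1000000 in
lemma top_core (hq : IsDensity q) (C D ρ β : ℝ) (hC : 0 < C) (hD : 0 < D) (hρ : 0 < ρ) : ∃ γ C' : ℝ, 1 ≤ γ ∧ 0 < C' ∧
    ∀ (n : ℕ) f h (Λ H : ℝ), 3 ≤ n → IsDensity f → 0 < Λ → Λ ≤ 1 → 0 < H → H ≤ 1 →
    √(Real.log n) ≤ ((n:ℝ) * H) ^ (1/2:ℝ) * Λ → Continuous (Lh I K q h) → (∀ x, ‖Lh I K q h x‖ ≤ C * Λ⁻¹ * H⁻¹) →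
    ∫⁻ x, ‖Lh I K q h x‖ₑ ^ (2:ℝ) ≤ ENNReal.ofReal (C * Λ⁻¹ ^ 2 * H⁻¹) →
    (∀ x y, ‖Lh I K q h x - Lh I K q h y‖ ≤ C * Λ⁻¹ * H⁻¹ ^ 2 * ‖x - y‖) →
    (∀ x, ∫⁻ y, ‖Lh I K q h (x - res I y)‖ₑ ^ (2:ℝ) ∂(Pd q ∗ Pd f) ≤ ENNReal.ofReal (D * Λ⁻¹ ^ 2 * H⁻¹)) →
    ∃ V, V = (n:ℝ) ^ (-(1:ℝ)/2) * √(Real.log n) * (Λ⁻¹ * H ^ (-(1:ℝ)/2)) ∧ V ≤ 1 ∧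
    TailW ⊤ I K f q h n (ENNReal.ofReal V) γ ρ (C' * (n:ℝ) ^ (-β)) := by
  set D' := D * Real.exp (2 * C) with hD'
  set m := Fintype.card I with hm
  set κ := ρ + 1 + D' + 3 * m + |β| + 2 with hκ
  have hκ1 : 1 ≤ κ := by have := abs_nonneg β; have : 0 < D' := by positivity
                         have : (0:ℝ) ≤ m := by positivity
                         linarith
  refine ⟨4 * κ, (2 * C) ^ ρ * (4 * (4 * C) ^ m) * (2 * (C * Real.exp (2 * C))), by linarith, by positivity, ?_⟩
  intro n f h Λ H hn hf hΛ hΛ1 hH hH1 hg hLc hLb hL2 hLl hw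
  have hlog := log_one_le hn
  have hn1 : (1:ℝ) ≤ n := by exact_mod_cast (by omega : 1 ≤ n)
  have hn0 : (0:ℝ) < n := by positivity
  obtain ⟨θ, hθ, V, hV, hV1, hNV, hθV, hθB, hvar, hBN, hLN⟩ := top_arith (D := D) hn1 hlog hΛ hΛ1 hH hH1 hC hg
  refine ⟨V, hV, hV1, ?_⟩
  have hvarC : n * θ ^ 2 * (C * Λ⁻¹ ^ 2 * H⁻¹) = C * Real.log n := by
    have : n * θ ^ 2 * (C * Λ⁻¹ ^ 2 * H⁻¹) * D = C * (n * θ ^ 2 * (D * Λ⁻¹ ^ 2 * H⁻¹)) := by ring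
    rw [hvar] at this
    exact mul_right_cancel₀ hD.ne' (this.trans (by ring))
  have := hf.prob
  have := hq.prob
  set μ := Pd q ∗ Pd f with hμ
  set L := Lh I K q h with hL
  set B := C * Λ⁻¹ * H⁻¹ with hBd
  have hB0 : 0 < B := by positivity
  have hV0 : 0 < V := by nlinarith
  have hLi : ∀ x, Integrable (fun y => L (x - res I y)) μ := fun x => by
    have hres : Continuous (res I) := by unfold res; fun_prop
    have : Continuous fun y => L (x - res I y) := by fun_prop
    exact Integrable.of_bound this.aestronglyMeasurable B (ae_of_all _ fun y => hLb _)
  set s : (Fin n → Fin d → ℝ) → (I → ℝ) → ℂ := fun y x => ∑ k, (L (x - res I (y k)) - ∫ y', L (x - res I y') ∂μ) with hs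
  set J : (Fin n → Fin d → ℝ) → ℝ≥0∞ := fun y => ∫⁻ x, (ENNReal.ofReal (Real.cosh (θ * (s y x).re) - 1) +
      ENNReal.ofReal (Real.cosh (θ * (s y x).im) - 1)) with hJ
  have hexp : Real.exp (θ * (2 * B)) ≤ Real.exp (2 * C) := Real.exp_le_exp.2 (by linarith)
  obtain ⟨hJm, hJi⟩ := sup_int (I := I) hLc hLb μ (by positivity) hw hL2 hθ.le n (z0 := D' * Real.log n) (by
    calc _ = (n * θ ^ 2 * (D * Λ⁻¹ ^ 2 * H⁻¹)) * Real.exp (θ * (2 * B)) := by ring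
      _ ≤ D * Real.log n * Real.exp (2 * C) := by rw [hvar]; gcongr
      _ = _ := by rw [hD']; ring) (s := s) (fun _ _ => rfl) (J := J) (fun _ => rfl)
  have hxi : ∀ y x, xiProc I K f q h y x = (n:ℂ)⁻¹ * s y x := fun y x => by
    rw [xi_eq hf hq (by omega), Finset.sum_apply]
  have hnx : ∀ y x, ‖xiProc I K f q h y x‖ = (n:ℝ)⁻¹ * ‖s y x‖ := fun y x => by
    rw [hxi, norm_mul]; simp
  have hmean : ∀ x, ‖∫ y', L (x - res I y') ∂μ‖ ≤ B := fun x => by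
    simpa using norm_integral_le_of_norm_le_const (μ := μ) (f := fun y' => L (x - res I y')) (C := B) (ae_of_all _ fun y => hLb _)
  have hsB : ∀ y x, ‖s y x‖ ≤ n * (2 * B) := fun y x => by
    refine le_trans (norm_sum_le_of_le _ (n := fun _ => 2 * B) fun k _ => ?_) (by simp)
    exact (norm_sub_le _ _).trans (by linarith [hLb (x - res I (y k)), hmean x])
  have hsup : ∀ y, eLpNorm (xiProc I K f q h y) ⊤ volume ≤ ENNReal.ofReal (2 * B) := fun y => by
    rw [eLpNorm_exponent_top]
    refine eLpNormEssSup_le_of_ae_bound (ae_of_all _ fun x => ?_)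
    rw [hnx, inv_mul_le_iff₀ hn0]; exact hsB y x
  set Lp := (n:ℝ) * (2 * (C * n ^ 2)) with hLp
  have hlip : ∀ y x x', ‖s y x - s y x'‖ ≤ Lp * ‖x - x'‖ := fun y x x' => by
    simp only [hs]
    rw [← Finset.sum_sub_distrib]
    refine le_trans (norm_sum_le_of_le _ (n := fun _ => 2 * (C * n ^ 2) * ‖x - x'‖) fun k _ => ?_) (by simp [hLp, mul_assoc])
    have h1 : ∀ u, ‖L (x - u) - L (x' - u)‖ ≤ C * n ^ 2 * ‖x - x'‖ := fun u => by
      refine (hLl _ _).trans ?_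
      rw [show x - u - (x' - u) = x - x' by abel]
      gcongr
    have h2 : ‖∫ y', L (x - res I y') ∂μ - ∫ y', L (x' - res I y') ∂μ‖ ≤ C * n ^ 2 * ‖x - x'‖ := by
      rw [← integral_sub (hLi x) (hLi x')]
      simpa using norm_integral_le_of_norm_le_const (μ := μ) (f := fun y' => L (x - res I y') - L (x' - res I y'))
        (ae_of_all _ fun y => h1 _)
    rw [sub_sub_sub_comm]
    exact (norm_sub_le _ _).trans (by linarith [h1 (res I (y k))])
  set δ := (8 * C * (n:ℝ) ^ 3)⁻¹ with hδ
  have hδ0 : 0 < δ := by positivity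
  set T := n * (4 * κ * V) with hT
  have hT1 : 1 ≤ T := by
    calc 1 ≤ n * V := hNV
      _ ≤ n * V * (4 * κ) := le_mul_of_one_le_right (by positivity) (by linarith)
      _ = T := by rw [hT]; ring
  have hθT : θ * (T / 4) = κ * Real.log n := by rw [hT, ← hθV]; ring
  have hk2 : 2 ≤ κ := by
    have := abs_nonneg β; have : 0 < D' := by positivity
    have : (0:ℝ) ≤ m := by positivity
    linarith
  have hce := cosh_exp (u := κ * Real.log n) (by nlinarith)
  set α := (Real.cosh (θ * (T / 4)) - 1) * (2 * δ) ^ m with hα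
  have hα1 : Real.exp (κ * Real.log n) / 4 * (2 * δ) ^ m ≤ α := by rw [hα, hθT]; gcongr
  have hα0 : 0 < α := lt_of_lt_of_le (by positivity) hα1
  have hlow : ∀ y, ENNReal.ofReal (4 * κ) * ENNReal.ofReal V < eLpNorm (xiProc I K f q h y) ⊤ volume → ENNReal.ofReal α ≤ J y := by
    intro y hy
    have : ∃ x0, T < ‖s y x0‖ := by
      by_contra! hcon
      refine absurd hy (not_lt.2 ?_)
      rw [eLpNorm_exponent_top, ← ENNReal.ofReal_mul (by positivity)]
      refine eLpNormEssSup_le_of_ae_bound (ae_of_all _ fun x => ?_)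
      rw [hnx, inv_mul_le_iff₀ hn0]; exact hcon x
    obtain ⟨x0, hx0⟩ := this
    have := sup_lower (hlip y) (by positivity) hδ0 (by rw [hLp, hδ]; apply le_of_eq; field_simp; norm_num) hT1 hθ.le hx0
    rw [← ENNReal.ofReal_mul' (by positivity)] at this
    exact this
  refine ⟨fun y => ENNReal.ofReal ((2 * B) ^ ρ * α⁻¹) * J y, hJm.const_mul _, fun y hy => ?_, ?_⟩
  · calc eLpNorm (xiProc I K f q h y) ⊤ volume ^ ρ ≤ ENNReal.ofReal (2 * B) ^ ρ := by gcongr; exact hsup y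
      _ = ENNReal.ofReal ((2 * B) ^ ρ * α⁻¹) * ENNReal.ofReal α := by
        rw [← ENNReal.ofReal_mul (by positivity), ENNReal.ofReal_rpow_of_pos (by positivity), inv_mul_cancel_right₀ hα0.ne']
      _ ≤ _ := mul_le_mul_right (hlow y hy) _
  · have e1 : obsMeasure d n f q = Measure.pi fun _ => μ := by unfold obsMeasure; rw [law_eq hf hq]
    rw [lintegral_const_mul' _ _ ENNReal.ofReal_ne_top, e1]
    refine (mul_le_mul_right hJi _).trans ?_
    rw [show (2:ℝ≥0∞) = ENNReal.ofReal 2 by simp, ← ENNReal.ofReal_mul (by norm_num), ← ENNReal.ofReal_mul (by positivity),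
      ← ENNReal.ofReal_mul (by positivity)]
    refine ENNReal.ofReal_le_ofReal ?_
    have a1 : (2 * B) ^ ρ ≤ (2 * C) ^ ρ * (n:ℝ) ^ ρ := by
      rw [← Real.mul_rpow (by positivity) (by positivity)]
      exact Real.rpow_le_rpow (by positivity) (by linarith) hρ.le
    have a2 : α⁻¹ ≤ 4 * (4 * C) ^ m * ((n:ℝ) ^ (3 * m:ℝ) * (n:ℝ) ^ (-κ)) := by
      refine (inv_anti₀ (by positivity) hα1).trans (le_of_eq ?_)
      have : 2 * δ = (4 * C * (n:ℝ) ^ 3)⁻¹ := by rw [hδ]; field_simp; norm_num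
      rw [this, Real.rpow_neg hn0.le, Real.rpow_def_of_pos hn0 κ, mul_comm κ, Real.rpow_mul hn0.le, inv_pow, mul_pow]
      norm_cast
      field_simp
    have a3 : 2 * (n * θ ^ 2 * Real.exp (θ * (2 * B)) * Real.exp (D' * Real.log n)) * (C * Λ⁻¹ ^ 2 * H⁻¹) ≤
        2 * (C * Real.exp (2 * C)) * ((n:ℝ) ^ (1:ℝ) * (n:ℝ) ^ D') := by
      rw [Real.rpow_def_of_pos hn0 D', mul_comm (Real.log n) D', Real.rpow_one]
      calc _ = 2 * (n * θ ^ 2 * (C * Λ⁻¹ ^ 2 * H⁻¹)) * Real.exp (θ * (2 * B)) * Real.exp (D' * Real.log n) := by ring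
        _ ≤ 2 * (C * n) * Real.exp (2 * C) * Real.exp (D' * Real.log n) := by
          rw [hvarC]; gcongr; exact (Real.log_le_sub_one_of_pos hn0).trans (by linarith)
        _ = _ := by ring
    have a4 : (n:ℝ) ^ ρ * ((n:ℝ) ^ (3 * m:ℝ) * (n:ℝ) ^ (-κ)) * ((n:ℝ) ^ (1:ℝ) * (n:ℝ) ^ D') ≤ (n:ℝ) ^ (-β) := by
      simp only [← Real.rpow_add hn0]
      refine Real.rpow_le_rpow_of_exponent_le hn1 ?_
      rw [hκ]
      linarith [le_abs_self β]
    rw [mul_assoc 2] at a3 ⊢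
    calc _ ≤ (2 * C) ^ ρ * (n:ℝ) ^ ρ * (4 * (4 * C) ^ m * ((n:ℝ) ^ (3 * m:ℝ) * (n:ℝ) ^ (-κ))) *
          (2 * ((C * Real.exp (2 * C))) * ((n:ℝ) ^ (1:ℝ) * (n:ℝ) ^ D')) := by
            rw [mul_assoc 2 (C * Real.exp (2 * C))]
            refine mul_le_mul (mul_le_mul a1 a2 (by positivity) (by positivity)) ?_ (by positivity) (by positivity)
            linarith
      _ = (2 * C) ^ ρ * (4 * (4 * C) ^ m) * (2 * (C * Real.exp (2 * C))) *
          ((n:ℝ) ^ ρ * ((n:ℝ) ^ (3 * m:ℝ) * (n:ℝ) ^ (-κ)) * ((n:ℝ) ^ (1:ℝ) * (n:ℝ) ^ D')) := by ring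
      _ ≤ _ := by gcongr

lemma tail_top (S : Std K q A lam ⊤ I) : TailAll K q lam ⊤ I := by
  intro ρ β hρ
  have hl := S.hN.2.1
  obtain ⟨C, hC, hL⟩ := L_bounds S
  set Q := (eLpNorm (marginal I q) ⊤ volume).toReal with hQ
  have hQf := S.hN.2.2.2.1 ENNReal.ofNat_lt_top
  obtain ⟨γ, C', hγ, hC', hT⟩ := top_core (K := K) (I := I) S.hq C ((Q + 1) * C) ρ β hC (by positivity) hρ
  have core : ∀ (n : ℕ) f h I', 3 ≤ n → IsDensity f → I ⊆ I' → memGrid lam ⊤ n I' h →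
      ∃ V, V = (n:ℝ) ^ (-(1:ℝ)/2) * √(Real.log n) * ((La lam I' h)⁻¹ * Hp I' h ^ (-(1:ℝ)/2)) ∧ V ≤ 1 ∧
      TailW ⊤ I K f q h n (ENNReal.ofReal V) γ ρ (C' * (n:ℝ) ^ (-β)) := by
    intro n f h I' hn hf hII hg
    have hb' := hg.bw
    obtain ⟨hb, hHH, hLL⟩ := sub_mono hII hl hb'
    have hL0 := La_pos (lam := lam) hb'
    have hH0 := Hp_pos hb'
    have hL00 := La_pos (lam := lam) hb
    have hH00 := Hp_pos hb
    obtain ⟨b1, b2, b3, b4⟩ := hL h hb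
    have hgr := hg.2.2
    rw [if_pos rfl, bp] at hgr
    norm_num at hgr
    have b3' : ∫⁻ x, ‖Lh I K q h x‖ₑ ^ (2:ℝ) ≤ ENNReal.ofReal (C * (La lam I' h)⁻¹ ^ 2 * (Hp I' h)⁻¹) :=
      b3.trans (ENNReal.ofReal_le_ofReal (by gcongr))
    refine hT n f h _ _ hn hf hL0 (La_le hl hb') hH0 (Hp_le hb') (by rw [one_div]; convert hgr using 2 <;> simp [Hp, La]) b1
      (fun x => (b2 x).trans (by gcongr)) b3' (fun x y => (b4 x y).trans (by gcongr)) fun x => ?_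
    refine (law_le I S.hq hf (fun u => ‖Lh I K q h (x - u)‖ₑ ^ (2:ℝ))
      ((b1.measurable.comp (measurable_const.sub measurable_id)).enorm.pow_const _)).trans ?_
    rw [lintegral_sub_left_eq_self (fun u => ‖Lh I K q h u‖ₑ ^ (2:ℝ)) x, ← ENNReal.ofReal_toReal hQf.ne, ← hQ, mul_assoc, mul_assoc,
      ENNReal.ofReal_mul (p := Q + 1) (by positivity), ← mul_assoc C]
    exact mul_le_mul' (ENNReal.ofReal_le_ofReal (by linarith)) b3'
  refine ⟨γ, C', hγ, hC', fun n f h hn hf => ⟨fun hg => ?_, fun I' hII hg => ?_⟩⟩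
  · obtain ⟨V, hV, -, H⟩ := core n f h I hn hf subset_rfl hg
    rw [Up, if_pos rfl, Up_prod hg.bw, ← hV]
    exact H
  · obtain ⟨V, hV, hV1, H⟩ := core n f h I' hn hf hII hg
    exact H.mono (by simpa using hV1) le_rfl

end

section

variable {d : ℕ} {K : ℝ → ℝ} {q f : (Fin d → ℝ) → ℝ} {A : ℝ} {lam : Fin d → ℝ} {p : ℝ≥0∞}
  {I : Finset (Fin d)} {h : Fin d → ℝ} {𝔓 : Set (Part d)}

lemma tail_all (S : Std K q A lam p I) (hp : 1 < p) : TailAll K q lam p I := by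
  by_cases h1 : p = ⊤
  · subst h1; exact tail_top S
  · rcases lt_or_ge p 2 with h2 | h2
    · exact tail_lt2 S hp h2
    · exact tail_ge2 S h2 h1

def hk {m : ℕ} (κ : Fin d → Fin m) : Fin d → ℝ := fun j => 2 ^ (-((κ j : ℕ) : ℝ))

lemma Lh_congr {h' : Fin d → ℝ} (H : ∀ j ∈ I, h j = h' j) : Lh I K q h = Lh I K q h' := by
  have : Kh I K h = Kh I K h' := by
    ext x; unfold Kh
    rw [Finset.prod_congr rfl H]
    congr 1
    exact Finset.prod_congr rfl fun j _ => by rw [H j j.2]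
  ext x; unfold Lh; rw [this]

lemma xi_congr {h' : Fin d → ℝ} (H : ∀ j ∈ I, h j = h' j) {n : ℕ} (y : Fin n → Fin d → ℝ) :
    xiProc I K f q h y = xiProc I K f q h' y := by
  ext x; simp only [xiProc, fHat, fHatMean, Lh_congr (K := K) (q := q) H]

lemma Up_congr {h' : Fin d → ℝ} (H : ∀ j ∈ I, h j = h' j) {n : ℕ} : Up K q lam p n I h = Up K q lam p n I h' := by
  have : ∏ j ∈ I, h j ^ (-lam j - 1 / 2) = ∏ j ∈ I, h' j ^ (-lam j - 1 / 2) := Finset.prod_congr rfl fun j hj => by rw [H j hj]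
  simp only [Up, Lh_congr (K := K) (q := q) H, this]

lemma memGrid_congr {h' : Fin d → ℝ} (H : ∀ j ∈ I, h j = h' j) {n : ℕ} (hg : memGrid lam p n I h) : memGrid lam p n I h' := by
  obtain ⟨h1, h2, h3⟩ := hg
  have e1 : ∏ j ∈ I, h j ^ lam j = ∏ j ∈ I, h' j ^ lam j := Finset.prod_congr rfl fun j hj => by rw [H j hj]
  refine ⟨fun j hj => by rw [← H j hj]; exact h1 j hj, fun j hj => by rw [← H j hj]; exact h2 j hj, ?_⟩
  rwa [← e1, ← Finset.prod_congr rfl H]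

lemma grid_idx (p : ℝ≥0∞) : ∃ R : ℕ, ∀ {d : ℕ} {lam : Fin d → ℝ} {I : Finset (Fin d)} {h : Fin d → ℝ} (n : ℕ), 3 ≤ n → memGrid lam p n I h →
    ∀ j ∈ I, ∃ k : Fin (R * n + 1), h j = 2 ^ (-((k : ℕ) : ℝ)) := by
  set M := max 1 p.toReal with hM
  have hM1 : 1 ≤ M := le_max_left _ _
  refine ⟨⌈2 * M⌉₊, fun {d lam I h} n hn hg j hj => ?_⟩
  obtain ⟨k, -, hk⟩ := hg.1 j hj
  have hn1 : (1:ℝ) ≤ n := by exact_mod_cast (by omega : 1 ≤ n)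
  have hn0 : (0:ℝ) < n := by positivity
  have h1 : (n:ℝ) ^ (-M) ≤ h j := by
    refine le_trans ?_ (hg.2.1 j hj).1
    unfold hminG
    split_ifs with hp
    · rw [← Real.rpow_neg_one]
      exact Real.rpow_le_rpow_of_exponent_le hn1 (by linarith)
    · refine Real.rpow_le_rpow_of_exponent_le hn1 (neg_le_neg (max_le_max le_rfl ?_))
      have : (1:ℝ) ≤ I.card := by exact_mod_cast Finset.card_pos.2 ⟨j, hj⟩
      exact div_le_self ENNReal.toReal_nonneg this
  have h2 : (k:ℝ) ≤ 2 * M * n := by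
    rw [hk] at h1
    have := Real.log_le_log (by positivity) h1
    rw [Real.log_rpow hn0, Real.log_rpow (by norm_num)] at this
    have hl2 := Real.log_two_gt_d9
    have hln := Real.log_le_sub_one_of_pos hn0
    have h3 : (k:ℝ) * Real.log 2 ≤ M * n := by nlinarith
    nlinarith [Nat.cast_nonneg (α := ℝ) k]
  refine ⟨⟨k, Nat.lt_succ_of_le ?_⟩, hk⟩
  have : (k:ℝ) ≤ ⌈2 * M⌉₊ * n := h2.trans (by gcongr; exact Nat.le_ceil _)
  exact_mod_cast this

lemma sum_tail {Ω ι : Type} [MeasurableSpace Ω] [Fintype ι] (μ : Measure Ω) (Q : ι → Ω → ℝ≥0∞ → Prop) {e : ℝ} (he : 0 ≤ e)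
    (hW : ∀ i, ∃ W : Ω → ℝ≥0∞, Measurable W ∧ (∀ y x, Q i y x → x ≤ W y) ∧ ∫⁻ y, W y ∂μ ≤ ENNReal.ofReal e) :
    ∃ W : Ω → ℝ≥0∞, Measurable W ∧ (∀ i y x, Q i y x → x ≤ W y) ∧ ∫⁻ y, W y ∂μ ≤ ENNReal.ofReal (Fintype.card ι * e) := by
  choose W h1 h2 h3 using hW
  refine ⟨fun y => ∑ i, W i y, Finset.measurable_sum _ fun i _ => h1 i,
    fun i y x hx => (h2 i y x hx).trans (Finset.single_le_sum (f := fun i => W i y) (fun _ _ => zero_le) (Finset.mem_univ i)), ?_⟩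
  rw [lintegral_finsetSum _ fun i _ => h1 i]
  refine (Finset.sum_le_sum fun i _ => h3 i).trans (le_of_eq ?_)
  simp [ENNReal.ofReal_mul]

lemma unif (hT : ∀ I ∈ Idia 𝔓, TailAll K q lam p I) (ρ β : ℝ) (hρ : 0 < ρ) : ∃ γ C : ℝ, 1 ≤ γ ∧ 0 < C ∧
    ∀ n f, 3 ≤ n → IsDensity f →
    (∃ W : (Fin n → Fin d → ℝ) → ℝ≥0∞, Measurable W ∧ (∀ y, ∀ I ∈ Idia 𝔓, ∀ h, memGrid lam p n I h →
      ENNReal.ofReal γ * Up K q lam p n I h < eLpNorm (xiProc I K f q h y) p volume → eLpNorm (xiProc I K f q h y) p volume ^ ρ ≤ W y) ∧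
      ∫⁻ y, W y ∂obsMeasure d n f q ≤ ENNReal.ofReal (C * (n:ℝ) ^ (-β))) ∧
    (∃ W : (Fin n → Fin d → ℝ) → ℝ≥0∞, Measurable W ∧ (∀ y, ∀ hP ∈ HpSet lam p n 𝔓, ∀ P' ∈ 𝔓, ∀ I ∈ diamond hP.2 P',
      ENNReal.ofReal γ < eLpNorm (xiProc I K f q hP.1 y) p volume → eLpNorm (xiProc I K f q hP.1 y) p volume ^ ρ ≤ W y) ∧
      ∫⁻ y, W y ∂obsMeasure d n f q ≤ ENNReal.ofReal (C * (n:ℝ) ^ (-β))) := by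
  have hT' : ∀ I : Finset (Fin d), ∃ γ C : ℝ, 0 ≤ γ ∧ 0 ≤ C ∧ (I ∈ Idia 𝔓 → ∀ n f h, 3 ≤ n → IsDensity f →
      (memGrid lam p n I h → TailW p I K f q h n (Up K q lam p n I h) γ ρ (C * (n:ℝ) ^ (-(β + d)))) ∧
      ∀ I', I ⊆ I' → memGrid lam p n I' h → TailW p I K f q h n 1 γ ρ (C * (n:ℝ) ^ (-(β + d)))) := by
    intro I
    by_cases hI : I ∈ Idia 𝔓
    · obtain ⟨γ, C, h1, h2, h3⟩ := hT I hI ρ (β + d) hρ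
      exact ⟨γ, C, by linarith, h2.le, fun _ => h3⟩
    · exact ⟨0, 0, le_rfl, le_rfl, fun h => absurd h hI⟩
  choose γ C hγ0 hC0 hTI using hT'
  obtain ⟨R, hR⟩ := grid_idx p
  set G := 1 + ∑ I, γ I with hG
  set C1 := 1 + ∑ I, C I with hC1
  have hGI : ∀ I, γ I ≤ G := fun I => by
    have := Finset.single_le_sum (f := γ) (fun I _ => hγ0 I) (Finset.mem_univ I); linarith
  have hCI : ∀ I, C I ≤ C1 := fun I => by
    have := Finset.single_le_sum (f := C) (fun I _ => hC0 I) (Finset.mem_univ I); linarith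
  have hG1 : 1 ≤ G := by have := Finset.sum_nonneg (s := univ) fun I _ => hγ0 I; linarith
  have hC11 : 1 ≤ C1 := by have := Finset.sum_nonneg (s := univ) fun I _ => hC0 I; linarith
  refine ⟨G, 2 ^ d * (R + 1) ^ d * C1, hG1, by positivity, fun n f hn hf => ?_⟩
  have hn1 : (1:ℝ) ≤ n := by exact_mod_cast (by omega : 1 ≤ n)
  have hn0 : (0:ℝ) < n := by positivity
  have hcard : ENNReal.ofReal (Fintype.card (Finset (Fin d) × (Fin d → Fin (R * n + 1))) * (C1 * (n:ℝ) ^ (-(β + d)))) ≤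
      ENNReal.ofReal (2 ^ d * (R + 1) ^ d * C1 * (n:ℝ) ^ (-β)) := by
    refine ENNReal.ofReal_le_ofReal ?_
    simp only [Fintype.card_prod, Fintype.card_finset, Fintype.card_pi, Fintype.card_fin, Finset.prod_const, Finset.card_univ]
    push_cast
    have : (R * n + 1 : ℝ) ^ d ≤ (R + 1) ^ d * (n:ℝ) ^ (d:ℝ) := by
      rw [Real.rpow_natCast, ← mul_pow]; gcongr; nlinarith
    calc _ ≤ 2 ^ d * ((R + 1) ^ d * (n:ℝ) ^ (d:ℝ)) * (C1 * (n:ℝ) ^ (-(β + d))) := by gcongr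
      _ = 2 ^ d * (R + 1) ^ d * C1 * ((n:ℝ) ^ (d:ℝ) * (n:ℝ) ^ (-(β + d))) := by ring
      _ = _ := by rw [← Real.rpow_add hn0]; congr 2; ring
  have he : 0 ≤ C1 * (n:ℝ) ^ (-(β + d)) := by positivity
  have trivW : ∃ W : (Fin n → Fin d → ℝ) → ℝ≥0∞, Measurable W ∧ (∀ y x, False → x ≤ W y) ∧
      ∫⁻ y, W y ∂obsMeasure d n f q ≤ ENNReal.ofReal (C1 * (n:ℝ) ^ (-(β + d))) := ⟨0, measurable_const, by simp, by simp⟩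
  constructor
  · obtain ⟨W, w1, w2, w3⟩ := sum_tail (ι := Finset (Fin d) × (Fin d → Fin (R * n + 1))) (obsMeasure d n f q)
      (fun i y x => (i.1 ∈ Idia 𝔓 ∧ memGrid lam p n i.1 (hk i.2)) ∧
        ENNReal.ofReal G * Up K q lam p n i.1 (hk i.2) < eLpNorm (xiProc i.1 K f q (hk i.2) y) p volume ∧
        x = eLpNorm (xiProc i.1 K f q (hk i.2) y) p volume ^ ρ) he (by
      rintro ⟨I, κ⟩
      by_cases hI : I ∈ Idia 𝔓 ∧ memGrid lam p n I (hk κ)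
      · obtain ⟨W, h1, h2, h3⟩ := ((hTI I hI.1 n f _ hn hf).1 hI.2).weak (γ' := G) (U' := Up K q lam p n I (hk κ))
          (by gcongr; exact hGI I) (e' := C1 * (n:ℝ) ^ (-(β + d))) (by gcongr; exact hCI I)
        exact ⟨W, h1, fun y x hx => hx.2.2 ▸ h2 y hx.2.1, h3⟩
      · simpa [hI] using trivW)
    refine ⟨W, w1, fun y I hI h hg hlt => ?_, w3.trans hcard⟩
    choose! k hk' using hR n hn hg
    have e1 : ∀ j ∈ I, h j = hk k j := hk'
    rw [xi_congr e1] at hlt ⊢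
    rw [Up_congr e1] at hlt
    exact w2 (I, k) y _ ⟨⟨hI, memGrid_congr e1 hg⟩, hlt, rfl⟩
  · obtain ⟨W, w1, w2, w3⟩ := sum_tail (ι := Finset (Fin d) × (Fin d → Fin (R * n + 1))) (obsMeasure d n f q)
      (fun i y x => (i.1 ∈ Idia 𝔓 ∧ ∃ I', i.1 ⊆ I' ∧ memGrid lam p n I' (hk i.2)) ∧
        ENNReal.ofReal G < eLpNorm (xiProc i.1 K f q (hk i.2) y) p volume ∧
        x = eLpNorm (xiProc i.1 K f q (hk i.2) y) p volume ^ ρ) he (by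
      rintro ⟨I, κ⟩
      by_cases hI : I ∈ Idia 𝔓 ∧ ∃ I', I ⊆ I' ∧ memGrid lam p n I' (hk κ)
      · obtain ⟨hI1, I', hII, hg⟩ := hI
        obtain ⟨W, h1, h2, h3⟩ := ((hTI I hI1 n f _ hn hf).2 I' hII hg).weak (γ' := G) (U' := 1)
          (by gcongr; exact hGI I) (e' := C1 * (n:ℝ) ^ (-(β + d))) (by gcongr; exact hCI I)
        exact ⟨W, h1, fun y x hx => hx.2.2 ▸ h2 y (by rw [mul_one]; exact hx.2.1), h3⟩
      · simpa [hI] using trivW)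
    refine ⟨W, w1, fun y hP hhP P' hP' I hI hlt => ?_, w3.trans hcard⟩
    have hall : ∀ j, ∃ k : Fin (R * n + 1), hP.1 j = 2 ^ (-((k : ℕ) : ℝ)) := fun j => by
      obtain ⟨t, ht, hj⟩ := hP.2.exists_mem (Finset.mem_univ j)
      exact hR n hn (hhP.2 t ht) j hj
    choose k hk' using hall
    have e1 : hP.1 = hk k := funext hk'
    have hI2 := hI
    rw [diamond, Finset.mem_filter, Finset.mem_image] at hI2
    obtain ⟨⟨z, hz, hzI⟩, -⟩ := hI2
    rw [Finset.mem_product] at hz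
    have hg := hhP.2 z.1 hz.1
    rw [e1] at hlt hg ⊢
    exact w2 (I, k) y _ ⟨⟨⟨_, hhP.1, P', hP', hI⟩, z.1, hzI ▸ Finset.inter_subset_left, hg⟩, hlt, rfl⟩

end

section

variable {d : ℕ} {K : ℝ → ℝ} {q f : (Fin d → ℝ) → ℝ} {A : ℝ} {lam : Fin d → ℝ} {p : ℝ≥0∞}
  {I : Finset (Fin d)} {h : Fin d → ℝ} {𝔓 : Set (Part d)}

lemma fHat_le (S : Std K q A lam p I) (hp : 1 < p) (hf : IsDensity f) (hh : BW I h) {n : ℕ} (y : Fin n → Fin d → ℝ) :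
    eLpNorm (fHat I K q h y) p volume ≤ eLpNorm (xiProc I K f q h y) p volume +
      ENNReal.ofReal ((∫ z, |K z|) ^ d) * eLpNorm (marginal I f) p volume := by
  obtain ⟨C, hC, hL⟩ := L_bounds S
  have hLc := (hL h hh).1
  have := hf.prob
  have := S.hq.prob
  have hres : Continuous (res I) := by unfold res; fun_prop
  have h1 : Continuous (fHat I K q h y) := by
    have : ∀ k, Continuous fun x : I → ℝ => Lh I K q h (fun j => x j - y k ↑j) := fun k => by
      refine hLc.comp ?_; fun_prop
    unfold fHat
    fun_prop
  have h2 : Measurable (fHatMean I K f q h) := by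
    have hm0 : Measurable fun z : (I → ℝ) × (Fin d → ℝ) => Lh I K q h (z.1 - res I z.2) := by
      have : Continuous fun z : (I → ℝ) × (Fin d → ℝ) => Lh I K q h (z.1 - res I z.2) := by fun_prop
      exact this.measurable
    have := (hm0.stronglyMeasurable.integral_prod_right' (ν := Pd q ∗ Pd f)).measurable
    unfold fHatMean
    rw [law_eq hf S.hq]
    exact this
  have e : fHat I K q h y = xiProc I K f q h y + fHatMean I K f q h := by
    ext x; simp [xiProc]
  have h3 : Measurable (xiProc I K f q h y) := h1.measurable.sub h2
  rw [e]
  exact (eLpNorm_add_le h3.aestronglyMeasurable h2.aestronglyMeasurable hp.le).trans (add_le_add le_rfl (mean_norm S hf hh hp))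

lemma pow_split {x y : ℝ≥0∞} {ρ : ℝ} (hρ : 0 ≤ ρ) : (x + y) ^ ρ ≤ 2 ^ ρ * (x ^ ρ + y ^ ρ) := by
  rcases le_total x y with h | h
  · calc (x + y) ^ ρ ≤ (2 * y) ^ ρ := by gcongr; rw [two_mul]; gcongr
      _ = 2 ^ ρ * y ^ ρ := ENNReal.mul_rpow_of_nonneg _ _ hρ
      _ ≤ _ := by gcongr; exact le_add_self
  · calc (x + y) ^ ρ ≤ (2 * x) ^ ρ := by gcongr; rw [two_mul]; gcongr
      _ = 2 ^ ρ * x ^ ρ := ENNReal.mul_rpow_of_nonneg _ _ hρ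
      _ ≤ _ := by gcongr; exact le_self_add

lemma le_root {x y : ℝ≥0∞} {z : ℝ} (hz : 0 < z) : x ≤ y ^ (1 / z) ↔ x ^ z ≤ y := by
  rw [one_div]; exact ENNReal.le_rpow_inv_iff hz

lemma diamond_sub {P P' : Part d} (hI : I ∈ diamond P P') : ∃ t ∈ P.parts, I ⊆ t := by
  rw [diamond, Finset.mem_filter, Finset.mem_image] at hI
  obtain ⟨⟨z, hz, hzI⟩, -⟩ := hI
  exact ⟨z.1, (Finset.mem_product.1 hz).1, hzI ▸ Finset.inter_subset_left⟩

lemma stmt_aux (d : ℕ) (K : ℝ → ℝ) (hK : IsKernel K) (q : (Fin d → ℝ) → ℝ) (hq : IsDensity q)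
    (A : ℝ) (lam : Fin d → ℝ) (𝔓 : Set (Part d)) (p : ℝ≥0∞) (hp : 1 < p)
    (hN : ∀ P ∈ 𝔓, ∀ P' ∈ 𝔓, ∀ I ∈ diamond P P', N1N2 p I q A lam) (r : ℝ) (hr : 0 < r) :
    ∃ γp : ℝ≥0∞, 0 < γp ∧ γp ≠ ⊤ ∧ ∃ c1 : ℝ≥0∞, 0 < c1 ∧ c1 ≠ ⊤ ∧ ∃ c2 : ℝ → ℝ≥0∞,
      (∀ M : ℝ, ∃ c : ℝ≥0∞, c ≠ ⊤ ∧ ∀ x ∈ Set.Icc (0 : ℝ) M, c2 x ≤ c) ∧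
      ∀ n : ℕ, 3 ≤ n → ∀ f : (Fin d → ℝ) → ℝ, IsDensity f → fpE p 𝔓 f ≠ ⊤ →
        (∫⁻ y, xiP K f q lam p 𝔓 γp y ^ r ∂obsMeasure d n f q) ^ (1 / r) ≤
          c1 * ENNReal.ofReal ((n : ℝ) ^ (-(1 : ℝ) / 2)) ∧
        (∫⁻ y, fbarP K f q lam p 𝔓 y ^ r ∂obsMeasure d n f q) ^ (1 / r) ≤ c2 ((fpE p 𝔓 f).toReal) := by
  have hS : ∀ P ∈ 𝔓, ∀ P' ∈ 𝔓, ∀ I ∈ diamond P P', Std K q A lam p I := fun P hP P' hP' I hI =>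
    ⟨hK, hq, (Finset.mem_filter.1 hI).2, hN P hP P' hP' I hI⟩
  have hT : ∀ I ∈ Idia 𝔓, TailAll K q lam p I := fun I ⟨P, hP, P', hP', hI⟩ => tail_all (hS P hP P' hP' I hI) hp
  set N := Dd 𝔓 * (Dd 𝔓 - 1) + (Dd 𝔓 - 1) + 1 with hNd
  set ρ : ℝ := N * r with hρd
  have hN0 : (0:ℝ) < N := by exact_mod_cast Nat.succ_pos _
  have hρ : 0 < ρ := by positivity
  obtain ⟨γ, C, hγ, hC, H1⟩ := unif hT r (r / 2) hr
  obtain ⟨γ', C', hγ', hC', H2⟩ := unif hT ρ 0 hρ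
  set a := ENNReal.ofReal ((∫ z, |K z|) ^ d) with ha
  have ha1 : 1 ≤ a := by
    rw [ha, ← ENNReal.ofReal_one]
    exact ENNReal.ofReal_le_ofReal (one_le_pow₀ (K_one_le hK))
  have hat : a ≠ ⊤ := ENNReal.ofReal_ne_top
  set c2 : ℝ → ℝ≥0∞ := fun x => (((Dd 𝔓 : ℝ≥0∞) ^ 2 * a) ^ r * (2 ^ ρ * ((a * (ENNReal.ofReal γ' + a * ENNReal.ofReal x)) ^ ρ +
    a ^ ρ * ENNReal.ofReal C'))) ^ (1 / r) with hc2
  have hr' : 0 ≤ 1 / r := by positivity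
  refine ⟨ENNReal.ofReal γ, by simpa using by linarith, ENNReal.ofReal_ne_top, ENNReal.ofReal (C ^ (1 / r)), by simpa using by positivity,
    ENNReal.ofReal_ne_top, c2, fun M => ⟨c2 M, ?_, fun x hx => ?_⟩, fun n hn f hf hfin => ⟨?_, ?_⟩⟩
  · simp only [hc2]
    refine ENNReal.rpow_ne_top_of_nonneg hr' (ENNReal.mul_ne_top (ENNReal.rpow_ne_top_of_nonneg hr.le (by finiteness))
      (ENNReal.mul_ne_top (ENNReal.rpow_ne_top_of_nonneg hρ.le (by finiteness)) (ENNReal.add_ne_top.2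
        ⟨ENNReal.rpow_ne_top_of_nonneg hρ.le (by finiteness), ENNReal.mul_ne_top (ENNReal.rpow_ne_top_of_nonneg hρ.le hat) (by finiteness)⟩)))
  · have hx2 := hx.2
    simp only [hc2]
    gcongr
  · obtain ⟨W, -, w2, w3⟩ := (H1 n f hn hf).1
    have hn0 : (0:ℝ) < n := by positivity
    have hle : ∀ y, xiP K f q lam p 𝔓 (ENNReal.ofReal γ) y ^ r ≤ W y := fun y => by
      rw [← le_root hr]
      refine iSup₂_le fun I hI => iSup₂_le fun h hg => ?_
      rcases le_or_gt (eLpNorm (xiProc I K f q h y) p volume) (ENNReal.ofReal γ * Up K q lam p n I h) with hc | hc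
      · rw [tsub_eq_zero_of_le hc]; exact zero_le
      · rw [le_root hr]
        exact le_trans (by gcongr; exact tsub_le_self) (w2 y I hI h hg hc)
    calc _ ≤ (ENNReal.ofReal (C * (n:ℝ) ^ (-(r / 2)))) ^ (1 / r) := by gcongr; exact (lintegral_mono hle).trans w3
      _ = _ := by
        rw [ENNReal.ofReal_rpow_of_nonneg (by positivity) hr', Real.mul_rpow hC.le (by positivity), ENNReal.ofReal_mul (by positivity),
          ← Real.rpow_mul hn0.le]
        congr 3; field_simp
  · obtain ⟨W, w1, w2, w3⟩ := (H2 n f hn hf).2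
    have := hf.prob
    have := hq.prob
    have : IsProbabilityMeasure (obsMeasure d n f q) := by
      unfold obsMeasure; rw [law_eq hf hq]; infer_instance
    set F := fpE p 𝔓 f with hF
    have hF1 : 1 ≤ F := le_max_left _ _
    have hFx : ENNReal.ofReal F.toReal = F := ENNReal.ofReal_toReal hfin
    set b := a * (ENNReal.ofReal γ' + a * F) with hb
    have hle : ∀ y, fbarP K f q lam p 𝔓 y ^ r ≤ ((Dd 𝔓 : ℝ≥0∞) ^ 2 * a) ^ r * (2 ^ ρ * (b ^ ρ + a ^ ρ * W y)) := fun y => by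
      set Z := b + a * W y ^ (1 / ρ) with hZ
      have haF : a * F ≤ Z := by
        calc a * F = 1 * (a * F) := (one_mul _).symm
          _ ≤ a * (a * F) := by gcongr
          _ ≤ b := by rw [hb]; gcongr; exact le_add_self
          _ ≤ Z := le_self_add
      have hZ1 : 1 ≤ Z := le_trans (one_le_mul ha1 hF1) haF
      have hG : Gbar K q lam p 𝔓 y ≤ Z := by
        refine max_le hZ1 ?_
        rw [← ha, show Z = a * (ENNReal.ofReal γ' + a * F + W y ^ (1 / ρ)) by rw [hZ, hb]; ring]
        refine mul_le_mul_right (iSup₂_le fun hP hhP => iSup₂_le fun P' hP' => iSup₂_le fun I hI => ?_) _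
        obtain ⟨t, ht, hIt⟩ := diamond_sub hI
        have hbw : BW I hP.1 := fun j hj => (hhP.2 t ht).bw j (hIt hj)
        refine (fHat_le (hS _ hhP.1 P' hP' I hI) hp hf hbw y).trans ?_
        have m1 : eLpNorm (marginal I f) p volume ≤ F :=
          le_trans (le_iSup₂_of_le hP.2 hhP.1 (le_iSup₂_of_le P' hP' (le_iSup₂ (f := fun I (_ : I ∈ diamond hP.2 P') => eLpNorm (marginal I f) p volume) I hI))) (le_max_right _ _)
        have m2 : eLpNorm (xiProc I K f q hP.1 y) p volume ≤ ENNReal.ofReal γ' + W y ^ (1 / ρ) := by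
          rcases le_or_gt (eLpNorm (xiProc I K f q hP.1 y) p volume) (ENNReal.ofReal γ') with hc | hc
          · exact hc.trans le_self_add
          · exact ((le_root hρ).2 (w2 y hP hhP P' hP' I hI hc)).trans le_add_self
        rw [add_right_comm]
        exact add_le_add m2 (mul_le_mul_right m1 _)
      have hfb : fbarP K f q lam p 𝔓 y ≤ (Dd 𝔓 : ℝ≥0∞) ^ 2 * a * Z ^ N := by
        unfold fbarP
        rw [← ha, ← hF]
        calc _ ≤ (Dd 𝔓 : ℝ≥0∞) ^ 2 * a * Z ^ (Dd 𝔓 * (Dd 𝔓 - 1)) * Z ^ (Dd 𝔓 - 1) := by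
              gcongr; exact max_le hG haF
          _ = (Dd 𝔓 : ℝ≥0∞) ^ 2 * a * Z ^ (Dd 𝔓 * (Dd 𝔓 - 1) + (Dd 𝔓 - 1)) := by rw [mul_assoc, ← pow_add]
          _ ≤ _ := by
              refine mul_le_mul_right (pow_le_pow_right₀ hZ1 (by omega)) _
      calc fbarP K f q lam p 𝔓 y ^ r ≤ ((Dd 𝔓 : ℝ≥0∞) ^ 2 * a * Z ^ N) ^ r := by gcongr
        _ = ((Dd 𝔓 : ℝ≥0∞) ^ 2 * a) ^ r * Z ^ ρ := by
          rw [ENNReal.mul_rpow_of_nonneg _ _ hr.le, ← ENNReal.rpow_natCast Z N, ← ENNReal.rpow_mul]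
        _ ≤ ((Dd 𝔓 : ℝ≥0∞) ^ 2 * a) ^ r * (2 ^ ρ * (b ^ ρ + (a * W y ^ (1 / ρ)) ^ ρ)) := by
          gcongr; exact pow_split hρ.le
        _ = _ := by
          rw [ENNReal.mul_rpow_of_nonneg a (W y ^ (1 / ρ)) hρ.le, ← ENNReal.rpow_mul, one_div_mul_cancel hρ.ne', ENNReal.rpow_one]
    simp only [hc2, hFx]
    gcongr
    refine (lintegral_mono hle).trans ?_
    rw [lintegral_const_mul _ (by fun_prop), lintegral_const_mul _ (by fun_prop), lintegral_add_left measurable_const, lintegral_const_mul _ w1]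
    simp only [lintegral_const, measure_univ, mul_one]
    gcongr
    simpa using w3

end

/-- **Lemma 1**: for `𝔓 ≠ {{1,…,d}}`, `p ∈ (1,∞]` and `r ∈ {r_1,r_2,r_4}`
(`r_k = kp` for `p < ∞`, `r_k = k` for `p = ∞`), under Assumptions (N1)-(N2) there are
constants `c_{p,1}(r) > 0` and `c_{p,2}(r,𝐟_p) > 0` (the latter bounded on any bounded
interval in `𝐟_p`) such that for all `n ≥ 3` and all `f ∈ 𝔽_p[𝔓]`,
`(E_f |ξ_p|^r)^{1/r} ≤ c_{p,1}(r) n^{-1/2}` and `(E_f |f̄_p|^r)^{1/r} ≤ c_{p,2}(r,𝐟_p)`. -/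
theorem statement12 (d : ℕ) (hd : 0 < d)
    (K : ℝ → ℝ) (hK : IsKernel K) (q : (Fin d → ℝ) → ℝ) (hq : IsDensity q)
    (A : ℝ) (lam : Fin d → ℝ) (𝔓 : Set (Part d))
    (hnotriv : ∀ P0 : Part d, P0.parts = {(Finset.univ : Finset (Fin d))} → 𝔓 ≠ {P0})
    (p : ℝ≥0∞) (hp : 1 < p)
    (hN : ∀ P ∈ 𝔓, ∀ P' ∈ 𝔓, ∀ I ∈ diamond P P', N1N2 p I q A lam)
    (k : ℕ) (hk : k ∈ ({1, 2, 4} : Set ℕ)) (r : ℝ)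
    (hrdef : r = if p = ⊤ then (k : ℝ) else k * p.toReal) :
    ∃ γp : ℝ≥0∞, 0 < γp ∧ γp ≠ ⊤ ∧
    ∃ c1 : ℝ≥0∞, 0 < c1 ∧ c1 ≠ ⊤ ∧
    ∃ c2 : ℝ → ℝ≥0∞,
      (∀ M : ℝ, ∃ c : ℝ≥0∞, c ≠ ⊤ ∧ ∀ x ∈ Set.Icc (0 : ℝ) M, c2 x ≤ c) ∧
      ∀ n : ℕ, 3 ≤ n → ∀ f : (Fin d → ℝ) → ℝ, IsDensity f → fpE p 𝔓 f ≠ ⊤ →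
        (∫⁻ y, xiP K f q lam p 𝔓 γp y ^ r ∂obsMeasure d n f q) ^ (1 / r) ≤
          c1 * ENNReal.ofReal ((n : ℝ) ^ (-(1 : ℝ) / 2)) ∧
        (∫⁻ y, fbarP K f q lam p 𝔓 y ^ r ∂obsMeasure d n f q) ^ (1 / r) ≤
          c2 ((fpE p 𝔓 f).toReal) := by
  have hr : 0 < r := by
    have hk0 : (0:ℝ) < k := by
      rcases hk with h | h | h <;> (rw [h]; norm_num)
    rw [hrdef]
    split_ifs with hpt
    · exact hk0
    · exact mul_pos hk0 (ENNReal.toReal_pos (zero_lt_one.trans hp).ne' hpt)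
  exact stmt_aux d K hK q hq A lam 𝔓 p hp hN r hr

end Deconv
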